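/- arXiv:2307.11284 — 8 statements merged into one kernel-verified Lean document; each statement's English description precedes it below -/
import Mathlib

section
/- Let ℝ^d = X_+ ⊕ X_− where X_+ and X_− are spanned by complementary subsets of the standard basis, with coordinate projections π_+ and π_−. Let λ_− < λ_+ be reals, ε > 0 with λ_− + 3ε < λ_+ − 3ε, ϱ ∈ (λ_− + 3ε, λ_+ − 3ε), and K ≥ 1. Let (Λ_n)_{n∈ℤ} be invertible linear maps on ℝ^d with Λ_nX_± = X_± whose cocycle Λ(m,n) satisfies ‖Λ(m,n)|_{X_+}‖ ≤ Ke^{ε|n|}e^{(λ_+−ε)m} for all m < 0 and ‖Λ(m,n)|_{X_−}‖ ≤ Ke^{ε|n|}e^{(λ_−+ε)m} for all m ≥ 0. For each n ∈ ℤ let f_n : ℝ^d → ℝ^d be C¹ with f_n(0) = 0 and K·e^{ε|n+1|}·sup_x ‖Df_n(x)‖ ≤ δ, set F_n := Λ_n + f_n, and let F(k,x) denote the forward orbit from time 0: F(0,x) = x and F(k+1,x) = F_k(F(k,x)). Then there exists δ_0 > 0, depending only on λ_+, λ_−, ϱ and ε, such that if δ ≤ δ_0 then for every x ∈ ℝ^d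 and y ∈ X_− the following hold. (i) There is a unique sequence (q_n(x,y))_{n≥0} in ℝ^d with sup_{n≥0} e^{−ϱn}‖q_n(x,y)‖ < ∞ satisfying, with all series absolutely convergent, the Lyapunov–Perron equation q_n(x,y) = Λ(n,0)(y − π_−x) + Σ_{k=0}^{n−1} Λ(n−k−1, k+1)( π_−[ f_k(q_k(x,y) + F(k,x)) − f_k(F(k,x)) ] ) − Σ_{k=n}^{∞} Λ(n−k−1, k+1)( π_+[ f_k(q_k(x,y) + F(k,x)) − f_k(F(k,x)) ] ) for every n ≥ 0. (ii) q_n(x, π_−x) = 0 for all n ≥ 0, and sup_{n≥0} e^{−ϱn}‖q_n(x,y)‖ ≤ 2K(‖x‖ + ‖y‖). (iii) Each map y ↦ q_n(x,y) from X_− to ℝ^d is C¹ with sup_{n≥0} e^{−ϱn}‖∂_y q_n(x,y)‖ ≤ 2K, and ‖∂_y q_0(x,y) − ι‖ ≤ CKδ, where ι : X_− → ℝ^d is the inclusion and C > 0 depends only on λ_+, λ_−, ϱ and ε. -/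
abbrev Ed (d : ℕ) := EuclideanSpace ℝ (Fin d)

/-- `T` is the cocycle generated by the sequence of invertible linear maps `Λ`:
T(0,n) = id and T(m+1,n) = Λ_{n+m} ∘ T(m,n) for all m, n ∈ ℤ. -/
def IsLinCocycle {E : Type*} [NormedAddCommGroup E] [NormedSpace ℝ E]
    (Λ : ℤ → (E ≃L[ℝ] E)) (T : ℤ → ℤ → (E ≃L[ℝ] E)) : Prop :=
  (∀ n : ℤ, T 0 n = ContinuousLinearEquiv.refl ℝ E) ∧
  ∀ m n : ℤ, T (m + 1) n = (T m n).trans (Λ (n + m))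

/-- The sequence `Q` solves the Lyapunov–Perron equation (for the stable foliation)
associated with data `(Λc, π₊, π₋, f, F-orbit Fo)` at base point `x` with parameter `y`,
within the class sup_{n≥0} e^{−ϱn}‖Q n‖ < ∞, all series being absolutely convergent.
The tail sum over k ≥ n is reindexed by k = n + j. -/
def IsLPSolution {d : ℕ} (ϱ : ℝ) (Λc : ℤ → ℤ → (Ed d ≃L[ℝ] Ed d))
    (πp πm : Ed d →L[ℝ] Ed d) (f : ℤ → Ed d → Ed d) (Fo : ℕ → Ed d → Ed d)
    (x y : Ed d) (Q : ℕ → Ed d) : Prop :=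
  (∃ Cb : ℝ, ∀ n : ℕ, Real.exp (-(ϱ * n)) * ‖Q n‖ ≤ Cb) ∧
  (∀ n : ℕ, Summable (fun j : ℕ =>
    ‖Λc (-(j : ℤ) - 1) ((n : ℤ) + j + 1)
      (πp (f ((n : ℤ) + j) (Q (n + j) + Fo (n + j) x) - f ((n : ℤ) + j) (Fo (n + j) x)))‖)) ∧
  ∀ n : ℕ, Q n = Λc (n : ℤ) 0 (y - πm x)
    + ∑ k ∈ Finset.range n,
        Λc ((n : ℤ) - k - 1) ((k : ℤ) + 1)
          (πm (f (k : ℤ) (Q k + Fo k x) - f (k : ℤ) (Fo k x)))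
    - ∑' j : ℕ, Λc (-(j : ℤ) - 1) ((n : ℤ) + j + 1)
          (πp (f ((n : ℤ) + j) (Q (n + j) + Fo (n + j) x) - f ((n : ℤ) + j) (Fo (n + j) x)))

open Filter Topology

structure KB (c : ℕ → ℕ → ℝ) (w : ℕ → ℝ) (θ : ℝ) : Prop where
  c0 : ∀ n k, 0 ≤ c n k
  w0 : ∀ n, 0 < w n
  sm : ∀ n, Summable fun k => c n k * w k
  le : ∀ n, ∑' k, c n k * w k ≤ θ * w n
  th : θ ≤ 1 / 2

theorem KB.bound {F : Type*} [NormedAddCommGroup F] {c : ℕ → ℕ → ℝ} {w : ℕ → ℝ} {θ : ℝ}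
    (h : KB c w θ) (n : ℕ) (u : ℕ → F) (C : ℝ) (hC : 0 ≤ C)
    (hu : ∀ k, ‖u k‖ ≤ c n k * (C * w k)) :
    Summable (fun k => ‖u k‖) ∧ ‖∑' k, u k‖ ≤ C * θ * w n := by
  have hs : Summable (fun k => C * (c n k * w k)) := (h.sm n).mul_left C
  have hu' : ∀ k, ‖u k‖ ≤ C * (c n k * w k) := fun k => (hu k).trans (le_of_eq (by ring))
  have hsu : Summable (fun k => ‖u k‖) := Summable.of_nonneg_of_le (fun k => norm_nonneg _) hu' hs
  refine ⟨hsu, ?_⟩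
  calc ‖∑' k, u k‖ ≤ ∑' k, ‖u k‖ := norm_tsum_le_tsum_norm hsu
    _ ≤ ∑' k, C * (c n k * w k) := hsu.tsum_le_tsum hu' hs
    _ = C * ∑' k, c n k * w k := tsum_mul_left
    _ ≤ C * (θ * w n) := mul_le_mul_of_nonneg_left (h.le n) hC
    _ = _ := by ring

theorem KB.bound' {F : Type*} [NormedAddCommGroup F] {c : ℕ → ℕ → ℝ} {w : ℕ → ℝ} {θ : ℝ}
    (h : KB c w θ) (n : ℕ) (u : ℕ → F) (C : ℝ) (hC : 0 ≤ C)
    (hu : ∀ k, ‖u k‖ ≤ c n k * (C * w k)) :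
    ‖∑' k, u k‖ ≤ C / 2 * w n := by
  refine (h.bound n u C hC hu).2.trans ?_
  have := mul_le_mul_of_nonneg_left h.th hC
  have := mul_le_mul_of_nonneg_right this (h.w0 n).le
  linarith

theorem KB.stab {w : ℕ → ℝ} (r : ℕ → ℝ) (η C : ℝ) (hη : 0 ≤ η) (hC : 0 ≤ C)
    (hw : ∀ n, 0 < w n)
    (h1 : ∀ n, r n ≤ C * w n)
    (h2 : ∀ C', 0 ≤ C' → (∀ k, r k ≤ C' * w k) → ∀ n, r n ≤ (η + C' / 2) * w n) :
    ∀ n, r n ≤ 2 * η * w n := by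
  have key : ∀ i : ℕ, ∀ n, r n ≤ (2 * η + C * (1 / 2) ^ i) * w n := by
    intro i
    induction i with
    | zero =>
      intro n
      refine (h1 n).trans (mul_le_mul_of_nonneg_right ?_ (hw n).le)
      simp; linarith
    | succ i ih =>
      intro n
      refine (h2 _ (by positivity) ih n).trans (le_of_eq ?_)
      rw [pow_succ]; ring
  intro n
  have ht : Tendsto (fun i : ℕ => (2 * η + C * (1 / 2 : ℝ) ^ i) * w n) atTop
      (𝓝 ((2 * η + C * 0) * w n)) :=
    ((tendsto_pow_atTop_nhds_zero_of_lt_one (by norm_num) (by norm_num)).const_mul C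
      |>.const_add _).mul_const _
  have := ge_of_tendsto' ht (fun i => key i n)
  simpa using this

theorem KB.exists_sol {F : Type*} [NormedAddCommGroup F] [CompleteSpace F]
    {c : ℕ → ℕ → ℝ} {w : ℕ → ℝ} {θ : ℝ}
    (h : KB c w θ) (G : ℕ → ℕ → F → F) (hG0 : ∀ n k, G n k 0 = 0)
    (hG : ∀ n k u v, ‖G n k u - G n k v‖ ≤ c n k * ‖u - v‖)
    (b : ℕ → F) (β : ℝ) (hβ : 0 ≤ β) (hb : ∀ n, ‖b n‖ ≤ β * w n) :
    ∃ Q : ℕ → F, (∀ n, ‖Q n‖ ≤ 2 * β * w n) ∧ ∀ n, Q n = b n + ∑' k, G n k (Q k) := by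
  let P : ℕ → ℕ → F := fun i => Nat.rec (fun _ => 0) (fun _ q n => b n + ∑' k, G n k (q k)) i
  have P0 : ∀ n, P 0 n = 0 := fun n => rfl
  have PS : ∀ i n, P (i + 1) n = b n + ∑' k, G n k (P i k) := fun i n => rfl
  have hGs : ∀ n (u : ℕ → F) (C : ℝ), 0 ≤ C → (∀ k, ‖u k‖ ≤ C * w k) →
      Summable (fun k => G n k (u k)) := by
    intro n u C hC hu
    refine (h.bound n (fun k => G n k (u k)) C hC (fun k => ?_)).1.of_norm
    have := hG n k (u k) 0
    rw [hG0, sub_zero, sub_zero] at this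
    exact this.trans (mul_le_mul_of_nonneg_left (hu k) (h.c0 n k))
  have hGd : ∀ n (u v : ℕ → F) (C C₁ C₂ : ℝ), 0 ≤ C → 0 ≤ C₁ → 0 ≤ C₂ →
      (∀ k, ‖u k‖ ≤ C₁ * w k) → (∀ k, ‖v k‖ ≤ C₂ * w k) →
      (∀ k, ‖u k - v k‖ ≤ C * w k) →
      ‖∑' k, G n k (u k) - ∑' k, G n k (v k)‖ ≤ C / 2 * w n := by
    intro n u v C C₁ C₂ hC hC₁ hC₂ hu hv huv
    rw [← (hGs n u C₁ hC₁ hu).tsum_sub (hGs n v C₂ hC₂ hv)]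
    exact h.bound' n _ C hC (fun k => (hG n k _ _).trans
      (mul_le_mul_of_nonneg_left (huv k) (h.c0 n k)))
  have hPb : ∀ i n, ‖P i n‖ ≤ 2 * β * w n := by
    intro i
    induction i with
    | zero =>
      intro n; rw [P0, norm_zero]; have := h.w0 n; positivity
    | succ i ih =>
      intro n
      rw [PS]
      have h1 := hGd n (P i) (fun _ => 0) (2 * β) (2 * β) 0 (by positivity) (by positivity) le_rfl
        ih (by simp) (by simpa using ih)
      simp only [hG0, tsum_zero, sub_zero] at h1
      have := norm_add_le (b n) (∑' k, G n k (P i k))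
      have := hb n
      linarith
  have hPd : ∀ i n, ‖P i n - P (i + 1) n‖ ≤ β * (1 / 2) ^ i * w n := by
    intro i
    induction i with
    | zero =>
      intro n; rw [PS]; simp [P0, hG0, hb n]
    | succ i ih =>
      intro n
      rw [PS, PS (i + 1), add_sub_add_left_eq_sub]
      refine (hGd n (P i) (P (i + 1)) (β * (1 / 2) ^ i) (2 * β) (2 * β) (by positivity)
        (by positivity) (by positivity) (hPb i) (hPb (i + 1)) ih).trans (le_of_eq ?_)
      rw [pow_succ]; ring
  have hdist : ∀ n i, dist (P i n) (P (i + 1) n) ≤ (β * w n) * (1 / 2) ^ i := by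
    intro n i
    rw [dist_eq_norm]
    exact (hPd i n).trans (le_of_eq (by ring))
  have hc : ∀ n, ∃ q, Tendsto (fun i => P i n) atTop (𝓝 q) := fun n =>
    cauchySeq_tendsto_of_complete (cauchySeq_of_le_geometric (1 / 2) (β * w n) (by norm_num)
      (hdist n))
  choose Q hQ using hc
  have hQb : ∀ n, ‖Q n‖ ≤ 2 * β * w n := fun n =>
    le_of_tendsto' (hQ n).norm (fun i => hPb i n)
  have hPQ : ∀ i n, ‖P i n - Q n‖ ≤ 2 * β * (1 / 2) ^ i * w n := by
    intro i n
    have := dist_le_of_le_geometric_of_tendsto (1 / 2) (β * w n) (by norm_num) (hdist n) (hQ n) i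
    rw [dist_eq_norm] at this
    refine this.trans (le_of_eq ?_)
    norm_num; ring
  refine ⟨Q, hQb, fun n => ?_⟩
  have ht : Tendsto (fun i => ∑' k, G n k (P i k)) atTop (𝓝 (∑' k, G n k (Q k))) := by
    rw [tendsto_iff_norm_sub_tendsto_zero]
    have h0 : Tendsto (fun i : ℕ => β * (1 / 2 : ℝ) ^ i * w n) atTop (𝓝 (β * 0 * w n)) :=
      ((tendsto_pow_atTop_nhds_zero_of_lt_one (by norm_num) (by norm_num)).const_mul β).mul_const _
    rw [mul_zero, zero_mul] at h0
    refine squeeze_zero (fun _ => norm_nonneg _) (fun i => ?_) h0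
    refine (hGd n (P i) Q (2 * β * (1 / 2) ^ i) (2 * β) (2 * β) (by positivity)
        (by positivity) (by positivity) (hPb i) hQb (hPQ i)).trans (le_of_eq (by ring))
  have h1 : Tendsto (fun i => P (i + 1) n) atTop (𝓝 (b n + ∑' k, G n k (Q k))) := by
    simp only [PS]
    exact ht.const_add _
  exact tendsto_nhds_unique ((tendsto_add_atTop_iff_nat 1).2 (hQ n)) h1

theorem KB.unif {P : Type*} [TopologicalSpace P] {w w' : ℕ → ℝ}
    (hw : ∀ n, 0 < w n) (hww : Tendsto (fun n => w' n / w n) atTop (𝓝 0))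
    (y : Filter P) (D : ℕ → P → ℝ) (s : P → ℝ) (C : ℝ) (hs : ∀ p, 0 ≤ s p)
    (h1 : ∀ k p, D k p ≤ C * w' k * s p)
    (h2 : ∀ k, ∀ η > 0, ∀ᶠ p in y, D k p ≤ η * s p) (hC : 0 ≤ C) :
    ∀ η > 0, ∀ᶠ p in y, ∀ k, D k p ≤ η * w k * s p := by
  intro η hη
  have : ∀ᶠ k in atTop, w' k / w k < η / (C + 1) := hww.eventually_lt_const (by positivity)
  obtain ⟨N, hN⟩ := eventually_atTop.1 this
  have hfin : ∀ᶠ p in y, ∀ k ∈ Finset.range N, D k p ≤ η * w k * s p := by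
    rw [Finset.eventually_all]
    intro k _
    exact h2 k _ (mul_pos hη (hw k))
  filter_upwards [hfin] with p hp k
  by_cases hk : k < N
  · exact hp k (Finset.mem_range.2 hk)
  · refine (h1 k p).trans (mul_le_mul_of_nonneg_right ?_ (hs p))
    have h3 := hN k (not_lt.1 hk)
    rw [div_lt_div_iff₀ (hw k) (by positivity)] at h3
    have := mul_pos hη (hw k)
    by_cases h0 : 0 ≤ w' k
    · nlinarith
    · nlinarith

theorem KB.lin {E : Type*} [NormedAddCommGroup E] [NormedSpace ℝ E] [CompleteSpace E]
    {c : ℕ → ℕ → ℝ} {w : ℕ → ℝ} {θ : ℝ}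
    (h : KB c w θ) (A : ℕ → ℕ → E →L[ℝ] E) (hA : ∀ n k, ‖A n k‖ ≤ c n k) (n : ℕ) (u : ℕ → E)
    (C : ℝ) (hC : 0 ≤ C) (hu : ∀ k, ‖u k‖ ≤ C * w k) :
    Summable (fun k => A n k (u k)) ∧ ‖∑' k, A n k (u k)‖ ≤ C / 2 * w n := by
  have h1 : ∀ k, ‖A n k (u k)‖ ≤ c n k * (C * w k) := fun k =>
    ((A n k).le_opNorm _).trans (mul_le_mul (hA n k) (hu k) (norm_nonneg _) (h.c0 n k))
  exact ⟨(h.bound n _ C hC h1).1.of_norm, h.bound' n _ C hC h1⟩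

theorem KB.linc {P E : Type*} [NormedAddCommGroup E] [NormedSpace ℝ E] [CompleteSpace E]
    [NormedAddCommGroup P] [NormedSpace ℝ P]
    {c : ℕ → ℕ → ℝ} {w : ℕ → ℝ} {θ : ℝ}
    (h : KB c w θ) (A : ℕ → ℕ → E →L[ℝ] E) (hA : ∀ n k, ‖A n k‖ ≤ c n k) (n : ℕ)
    (u : ℕ → P →L[ℝ] E)
    (C : ℝ) (hC : 0 ≤ C) (hu : ∀ k, ‖u k‖ ≤ C * w k) :
    Summable (fun k => (A n k).comp (u k)) ∧ ‖∑' k, (A n k).comp (u k)‖ ≤ C / 2 * w n ∧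
      ‖∑' k, (A n k).comp (u k)‖ ≤ C * θ * w n := by
  have h1 : ∀ k, ‖(A n k).comp (u k)‖ ≤ c n k * (C * w k) := fun k =>
    ((A n k).opNorm_comp_le _).trans (mul_le_mul (hA n k) (hu k) (norm_nonneg _) (h.c0 n k))
  exact ⟨(h.bound n _ C hC h1).1.of_norm, h.bound' n _ C hC h1, (h.bound n _ C hC h1).2⟩

theorem lp_abstract {P E : Type*} [NormedAddCommGroup E] [NormedSpace ℝ E] [CompleteSpace E]
    [NormedAddCommGroup P] [NormedSpace ℝ P]
    {c : ℕ → ℕ → ℝ} {w w' : ℕ → ℝ} {θ : ℝ} (hw : KB c w θ) (hw' : KB c w' θ)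
    (hle : ∀ n, w' n ≤ w n) (hww : Tendsto (fun n => w' n / w n) atTop (𝓝 0))
    (A : ℕ → ℕ → E →L[ℝ] E) (hA : ∀ n k, ‖A n k‖ ≤ c n k)
    (g : ℕ → E → E) (hg : ∀ k, ContDiff ℝ 1 (g k)) (hg0 : ∀ k, g k 0 = 0)
    (hg1 : ∀ k v, ‖fderiv ℝ (g k) v‖ ≤ 1)
    (B : ℕ → P →L[ℝ] E) (K : ℝ) (hK : 0 ≤ K) (hB : ∀ n, ‖B n‖ ≤ K * w' n)
    (b0 : ℕ → E) (β : P → ℝ) (hβ : ∀ y, 0 ≤ β y)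
    (hb : ∀ y n, ‖B n y + b0 n‖ ≤ β y * w' n) :
    ∃ q : ℕ → P → E, (∀ y n, ‖q n y‖ ≤ 2 * β y * w' n) ∧
      (∀ y n, q n y = B n y + b0 n + ∑' k, A n k (g k (q k y))) ∧
      (∀ y (Q : ℕ → E) (C : ℝ), (∀ n, ‖Q n‖ ≤ C * w n) →
        (∀ n, Q n = B n y + b0 n + ∑' k, A n k (g k (Q k))) → ∀ n, Q n = q n y) ∧
      (∀ n, ContDiff ℝ 1 (q n)) ∧
      (∀ n y, ‖fderiv ℝ (q n) y‖ ≤ 2 * K * w' n) ∧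
      (∀ y, ‖fderiv ℝ (q 0) y - B 0‖ ≤ 2 * K * θ * w' 0) := by
  have hlip : ∀ k u v, ‖g k u - g k v‖ ≤ ‖u - v‖ := by
    intro k u v
    have := Convex.norm_image_sub_le_of_norm_fderiv_le (𝕜 := ℝ) (f := g k) (s := Set.univ)
      (x := v) (y := u) (C := 1)
      (fun x _ => (hg k).differentiable (by norm_num) x) (fun x _ => hg1 k x)
      convex_univ trivial trivial
    simpa using this
  have hgn : ∀ k u, ‖g k u‖ ≤ ‖u‖ := by
    intro k u; simpa [hg0] using hlip k u 0
  -- existence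
  have hex : ∀ y, ∃ Q : ℕ → E, (∀ n, ‖Q n‖ ≤ 2 * β y * w' n) ∧
      ∀ n, Q n = B n y + b0 n + ∑' k, A n k (g k (Q k)) := by
    intro y
    refine hw'.exists_sol (fun n k v => A n k (g k v)) (fun n k => by simp [hg0])
      (fun n k u v => ?_) (fun n => B n y + b0 n) (β y) (hβ y) (hb y)
    rw [← map_sub]
    exact ((A n k).le_opNorm _).trans
      (mul_le_mul (hA n k) (hlip k u v) (norm_nonneg _) (hw'.c0 n k))
  choose q0 hqb hqe using hex
  -- general difference estimate
  have hdiff : ∀ (v : ℕ → ℝ), KB c v θ → ∀ (y y' : P) (Q Q' : ℕ → E) (C C' η : ℝ), 0 ≤ η →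
      (∀ n, ‖Q n‖ ≤ C * v n) → (∀ n, ‖Q' n‖ ≤ C' * v n) →
      (∀ n, Q n = B n y + b0 n + ∑' k, A n k (g k (Q k))) →
      (∀ n, Q' n = B n y' + b0 n + ∑' k, A n k (g k (Q' k))) →
      (∀ n, ‖B n (y - y')‖ ≤ η * v n) → ∀ n, ‖Q n - Q' n‖ ≤ 2 * η * v n := by
    intro v hv y y' Q Q' C C' η hη hQ hQ' hQe hQe' hBn
    have hC : 0 ≤ C := by
      have := (norm_nonneg _).trans (hQ 0)
      exact nonneg_of_mul_nonneg_left this (hv.w0 0)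
    have hC' : 0 ≤ C' := by
      have := (norm_nonneg _).trans (hQ' 0)
      exact nonneg_of_mul_nonneg_left this (hv.w0 0)
    refine KB.stab (fun n => ‖Q n - Q' n‖) η (C + C') hη (by positivity) hv.w0 (fun n => ?_) ?_
    · have := norm_sub_le (Q n) (Q' n)
      have := hQ n
      have := hQ' n
      show ‖Q n - Q' n‖ ≤ _
      linarith
    · intro C'' hC'' hr n
      show ‖Q n - Q' n‖ ≤ _
      have s1 := (hv.lin A hA n (fun k => g k (Q k)) C hC (fun k => (hgn k _).trans (hQ k))).1
      have s2 := (hv.lin A hA n (fun k => g k (Q' k)) C' hC' (fun k => (hgn k _).trans (hQ' k))).1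
      have s3 := (hv.lin A hA n (fun k => g k (Q k) - g k (Q' k)) C'' hC''
        (fun k => (hlip k _ _).trans (hr k))).2
      have e : Q n - Q' n = B n (y - y') + ∑' k, A n k (g k (Q k) - g k (Q' k)) := by
        simp only [map_sub]
        rw [s1.tsum_sub s2]
        conv_lhs => rw [hQe n, hQe' n]
        abel
      rw [e]
      have := norm_add_le (B n (y - y')) (∑' k, A n k (g k (Q k) - g k (Q' k)))
      have := hBn n
      linarith
  have hqlip : ∀ y y' n, ‖q0 y n - q0 y' n‖ ≤ 2 * K * w' n * ‖y - y'‖ := by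
    intro y y' n
    have := hdiff w' hw' y y' (q0 y) (q0 y') _ _ (K * ‖y - y'‖) (by positivity) (hqb y) (hqb y')
      (hqe y) (hqe y') (fun n => ((B n).le_opNorm _).trans
        ((mul_le_mul_of_nonneg_right (hB n) (norm_nonneg _)).trans (le_of_eq (by ring)))) n
    linarith
  have hqcont : ∀ n, Continuous (fun y => q0 y n) := by
    intro n
    rw [continuous_iff_continuousAt]
    intro y
    rw [ContinuousAt, tendsto_iff_norm_sub_tendsto_zero]
    refine squeeze_zero (fun _ => norm_nonneg _) (fun y' => hqlip y' y n) ?_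
    have : Continuous (fun y' : P => 2 * K * w' n * ‖y' - y‖) := by fun_prop
    simpa using this.tendsto y
  -- derivative
  have hexD : ∀ y, ∃ D : ℕ → P →L[ℝ] E, (∀ n, ‖D n‖ ≤ 2 * K * w' n) ∧
      ∀ n, D n = B n + ∑' k, (A n k).comp ((fderiv ℝ (g k) (q0 y k)).comp (D k)) := by
    intro y
    refine hw'.exists_sol (fun n k T => (A n k).comp ((fderiv ℝ (g k) (q0 y k)).comp T))
      (fun n k => by simp)
      (fun n k u v => ?_) B K hK hB
    rw [← ContinuousLinearMap.comp_sub, ← ContinuousLinearMap.comp_sub]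
    refine ((A n k).opNorm_comp_le _).trans
      (mul_le_mul (hA n k) ?_ (norm_nonneg _) (hw'.c0 n k))
    refine (ContinuousLinearMap.opNorm_comp_le _ _).trans ?_
    simpa using mul_le_mul_of_nonneg_right (hg1 k (q0 y k)) (norm_nonneg (u - v))
  choose D hDb hDe using hexD
  have hfd : ∀ k y (T : P →L[ℝ] E), ‖(fderiv ℝ (g k) y).comp T‖ ≤ ‖T‖ := by
    intro k y T
    refine (ContinuousLinearMap.opNorm_comp_le _ _).trans ?_
    simpa using mul_le_mul_of_nonneg_right (hg1 k y) (norm_nonneg T)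
  have hfd1 : ∀ k y (v : E), ‖fderiv ℝ (g k) y v‖ ≤ ‖v‖ := by
    intro k y v
    refine (ContinuousLinearMap.le_opNorm _ _).trans ?_
    simpa using mul_le_mul_of_nonneg_right (hg1 k y) (norm_nonneg v)
  have hderiv : ∀ n y, HasFDerivAt (fun y => q0 y n) (D y n) y := by
    intro n y
    have hun := KB.unif (w := w) (w' := w') hw.w0 hww (𝓝 y)
      (fun k p => ‖g k (q0 p k) - g k (q0 y k) - fderiv ℝ (g k) (q0 y k) (q0 p k - q0 y k)‖)
      (fun p => ‖p - y‖) (2 * (2 * K)) (fun p => norm_nonneg _) ?_ ?_ (by positivity)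
    rotate_left
    · intro k p
      have h1 := norm_sub_le (g k (q0 p k) - g k (q0 y k))
        (fderiv ℝ (g k) (q0 y k) (q0 p k - q0 y k))
      have h2 := hlip k (q0 p k) (q0 y k)
      have h3 := hfd1 k (q0 y k) (q0 p k - q0 y k)
      have h4 := hqlip p y k
      show ‖g k (q0 p k) - g k (q0 y k) - fderiv ℝ (g k) (q0 y k) (q0 p k - q0 y k)‖ ≤ _
      linarith
    · intro k η hη
      have hd : HasFDerivAt (g k) (fderiv ℝ (g k) (q0 y k)) (q0 y k) :=
        ((hg k).differentiable (by norm_num) _).hasFDerivAt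
      have hpos : 0 < 2 * K * w' k + 1 := by have := (hw'.w0 k); positivity
      have h1 := (hasFDerivAt_iff_isLittleO.1 hd).def (c := η / (2 * K * w' k + 1)) (by positivity)
      have h2 := ((hqcont k).tendsto y).eventually h1
      filter_upwards [h2] with p hp
      refine hp.trans ?_
      have h4 := hqlip p y k
      calc η / (2 * K * w' k + 1) * ‖q0 p k - q0 y k‖
          ≤ η / (2 * K * w' k + 1) * ((2 * K * w' k + 1) * ‖p - y‖) := by
            refine mul_le_mul_of_nonneg_left (h4.trans ?_) (by positivity)
            have := norm_nonneg (p - y)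
            linarith
        _ = η * ‖p - y‖ := by field_simp
    rw [hasFDerivAt_iff_isLittleO, Asymptotics.isLittleO_iff]
    intro η hη
    have hwn := hw.w0 n
    filter_upwards [hun (η / w n) (by positivity)] with p hp
    set s := ‖p - y‖ with hs
    have hs0 : 0 ≤ s := norm_nonneg _
    set Δ : ℕ → E := fun k =>
      g k (q0 p k) - g k (q0 y k) - fderiv ℝ (g k) (q0 y k) (q0 p k - q0 y k) with hΔ
    set r : ℕ → E := fun k => q0 p k - q0 y k - D y k (p - y) with hr
    have hDp : ∀ k, ‖D y k (p - y)‖ ≤ 2 * K * s * w k := by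
      intro k
      refine ((D y k).le_opNorm _).trans ?_
      have := mul_le_mul_of_nonneg_right (hDb y k) hs0
      refine this.trans ?_
      have := mul_le_mul_of_nonneg_left (hle k) (show 0 ≤ 2 * K * s by positivity)
      linarith
    have hqq : ∀ k, ‖q0 p k - q0 y k‖ ≤ 2 * K * s * w k := by
      intro k
      refine (hqlip p y k).trans ?_
      have := mul_le_mul_of_nonneg_left (hle k) (show 0 ≤ 2 * K * s by positivity)
      linarith
    have hqw : ∀ y k, ‖q0 y k‖ ≤ 2 * β y * w k := by
      intro y k
      exact (hqb y k).trans (mul_le_mul_of_nonneg_left (hle k) (by have := hβ y; positivity))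
    have hfinal := KB.stab (fun k => ‖r k‖) (η / w n * s / 2) (4 * K * s) (by positivity)
      (by positivity) hw.w0 (fun k => ?_) ?_ n
    · have e : 2 * (η / w n * s / 2) * w n = η * s := by field_simp
      rw [e] at hfinal
      exact hfinal
    · show ‖q0 p k - q0 y k - D y k (p - y)‖ ≤ _
      have := norm_sub_le (q0 p k - q0 y k) (D y k (p - y))
      have := hDp k
      have := hqq k
      linarith
    · intro C' hC' hC'r m
      have e : r m = ∑' k, A m k (fderiv ℝ (g k) (q0 y k) (r k)) + ∑' k, A m k (Δ k) := by
        have hβp := hβ p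
        have hβy := hβ y
        have s1 := (hw.lin A hA m (fun k => fderiv ℝ (g k) (q0 y k) (r k)) C' hC'
          (fun k => (hfd1 k _ _).trans (hC'r k))).1
        have s2 := (hw.lin A hA m Δ (η / w n * s) (by positivity)
          (fun k => (hp k).trans (le_of_eq (by ring)))).1
        have s3 := (hw.lin A hA m (fun k => g k (q0 p k)) (2 * β p) (by positivity)
          (fun k => (hgn k _).trans (hqw p k))).1
        have s4 := (hw.lin A hA m (fun k => g k (q0 y k)) (2 * β y) (by positivity)
          (fun k => (hgn k _).trans (hqw y k))).1
        have s5 := (hw.lin A hA m (fun k => fderiv ℝ (g k) (q0 y k) (D y k (p - y)))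
          (2 * K * s) (by positivity) (fun k => (hfd1 k _ _).trans (hDp k))).1
        have s6 := (hw'.linc A hA m (fun k => (fderiv ℝ (g k) (q0 y k)).comp (D y k)) (2 * K)
          (by positivity) (fun k => (hfd k _ _).trans (hDb y k))).1
        have e6 : D y m (p - y) = B m (p - y)
            + ∑' k, A m k (fderiv ℝ (g k) (q0 y k) (D y k (p - y))) := by
          have := congrArg (fun T : P →L[ℝ] E => T (p - y)) (hDe y m)
          simp only [add_apply] at this
          rw [this]
          congr 1
          exact (ContinuousLinearMap.apply ℝ E (p - y)).map_tsum s6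
        rw [← s1.tsum_add s2]
        have e7 : ∀ k, A m k (fderiv ℝ (g k) (q0 y k) (r k)) + A m k (Δ k)
            = A m k (g k (q0 p k)) - A m k (g k (q0 y k))
              - A m k (fderiv ℝ (g k) (q0 y k) (D y k (p - y))) := by
          intro k
          rw [← map_add, ← map_sub, ← map_sub]
          congr 1
          simp only [hr, hΔ, map_sub]
          abel
        simp only [e7]
        rw [(s3.sub s4).tsum_sub s5, s3.tsum_sub s4]
        show q0 p m - q0 y m - D y m (p - y) = _
        rw [e6, map_sub]
        conv_lhs => rw [hqe p m, hqe y m]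
        abel
      show ‖r m‖ ≤ _
      rw [e]
      have n1 := (hw.lin A hA m (fun k => fderiv ℝ (g k) (q0 y k) (r k)) C' hC'
          (fun k => (hfd1 k _ _).trans (hC'r k))).2
      have n2 := (hw.lin A hA m Δ (η / w n * s) (by positivity)
          (fun k => (hp k).trans (le_of_eq (by ring)))).2
      refine (norm_add_le _ _).trans ?_
      linarith
  have hDcont : ∀ n, Continuous (fun y => D y n) := by
    intro n
    rw [continuous_iff_continuousAt]
    intro y
    have hun := KB.unif (w := w) (w' := w') hw.w0 hww (𝓝 y)
      (fun k p => ‖(fderiv ℝ (g k) (q0 p k) - fderiv ℝ (g k) (q0 y k)).comp (D y k)‖)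
      (fun p => 1) (2 * (2 * K)) (fun p => zero_le_one) ?_ ?_ (by positivity)
    rotate_left
    · intro k p
      show ‖(fderiv ℝ (g k) (q0 p k) - fderiv ℝ (g k) (q0 y k)).comp (D y k)‖ ≤ _
      rw [ContinuousLinearMap.sub_comp]
      have h1 := norm_sub_le ((fderiv ℝ (g k) (q0 p k)).comp (D y k))
        ((fderiv ℝ (g k) (q0 y k)).comp (D y k))
      have h2 := hfd k (q0 p k) (D y k)
      have h3 := hfd k (q0 y k) (D y k)
      have h4 := hDb y k
      linarith
    · intro k η hη
      have hc : Continuous (fun p =>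
          ‖(fderiv ℝ (g k) (q0 p k) - fderiv ℝ (g k) (q0 y k)).comp (D y k)‖) := by
        have h1 : Continuous (fun p => fderiv ℝ (g k) (q0 p k)) :=
          ((hg k).continuous_fderiv (by norm_num)).comp (hqcont k)
        exact ((h1.sub continuous_const).clm_comp continuous_const).norm
      have := hc.tendsto y
      simp only [sub_self, ContinuousLinearMap.zero_comp, norm_zero] at this
      filter_upwards [this.eventually_lt_const hη] with p hp
      rw [mul_one]
      exact hp.le
    rw [ContinuousAt, Metric.tendsto_nhds]
    intro η hη
    have hwn := hw.w0 n
    filter_upwards [hun (η / 2 / w n) (by positivity)] with p hp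
    simp only [mul_one] at hp
    rw [dist_eq_norm]
    have hDw : ∀ y k, ‖D y k‖ ≤ 2 * K * w k := by
      intro y k
      exact (hDb y k).trans (mul_le_mul_of_nonneg_left (hle k) (by positivity))
    have hfinal := KB.stab (fun k => ‖D p k - D y k‖) (η / 2 / w n / 2) (4 * K) (by positivity)
      (by positivity) hw.w0 (fun k => ?_) ?_ n
    · have e : 2 * (η / 2 / w n / 2) * w n = η / 2 := by field_simp
      rw [e] at hfinal
      exact hfinal.trans_lt (by linarith)
    · have := norm_sub_le (D p k) (D y k)
      have := hDw p k
      have := hDw y k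
      show ‖D p k - D y k‖ ≤ _
      linarith
    · intro C' hC' hC'r m
      have t1 := hw.linc A hA m (fun k => (fderiv ℝ (g k) (q0 p k)).comp (D p k - D y k)) C' hC'
        (fun k => (hfd k _ _).trans (hC'r k))
      have t2 := hw.linc A hA m
        (fun k => (fderiv ℝ (g k) (q0 p k) - fderiv ℝ (g k) (q0 y k)).comp (D y k))
        (η / 2 / w n) (by positivity) hp
      have t3 := hw.linc A hA m (fun k => (fderiv ℝ (g k) (q0 p k)).comp (D p k)) (2 * K)
        (by positivity) (fun k => (hfd k _ _).trans (hDw p k))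
      have t4 := hw.linc A hA m (fun k => (fderiv ℝ (g k) (q0 y k)).comp (D y k)) (2 * K)
        (by positivity) (fun k => (hfd k _ _).trans (hDw y k))
      have e : D p m - D y m
          = ∑' k, (A m k).comp ((fderiv ℝ (g k) (q0 p k)).comp (D p k - D y k))
          + ∑' k, (A m k).comp
            ((fderiv ℝ (g k) (q0 p k) - fderiv ℝ (g k) (q0 y k)).comp (D y k)) := by
        rw [← t1.1.tsum_add t2.1]
        have e7 : ∀ k, (A m k).comp ((fderiv ℝ (g k) (q0 p k)).comp (D p k - D y k))
            + (A m k).comp ((fderiv ℝ (g k) (q0 p k) - fderiv ℝ (g k) (q0 y k)).comp (D y k))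
            = (A m k).comp ((fderiv ℝ (g k) (q0 p k)).comp (D p k))
              - (A m k).comp ((fderiv ℝ (g k) (q0 y k)).comp (D y k)) := by
          intro k
          ext v
          simp
        simp only [e7]
        rw [t3.1.tsum_sub t4.1]
        conv_lhs => rw [hDe p m, hDe y m]
        abel
      show ‖D p m - D y m‖ ≤ _
      rw [e]
      have n1 := t1.2.1
      have n2 := t2.2.1
      refine (norm_add_le _ _).trans ?_
      linarith
  have hfde : ∀ n y, fderiv ℝ (fun y => q0 y n) y = D y n := fun n y => (hderiv n y).fderiv
  refine ⟨fun n y => q0 y n, hqb, hqe, ?_, ?_, ?_, ?_⟩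
  · intro y Q C hQ hQe n
    have h1 := hdiff w hw y y Q (q0 y) C (2 * β y) 0 le_rfl hQ
      (fun k => (hqb y k).trans
        (mul_le_mul_of_nonneg_left (hle k) (by have := hβ y; positivity))) hQe (hqe y)
      (fun k => by simp) n
    simp only [mul_zero, zero_mul] at h1
    exact sub_eq_zero.1 (norm_le_zero_iff.1 h1)
  · intro n
    rw [contDiff_one_iff_hasFDerivAt]
    exact ⟨fun y => D y n, hDcont n, hderiv n⟩
  · intro n y
    rw [hfde]; exact hDb y n
  · intro y
    rw [hfde, hDe y 0, add_sub_cancel_left]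
    exact (hw'.linc A hA 0 (fun k => (fderiv ℝ (g k) (q0 y k)).comp (D y k)) (2 * K)
          (by positivity) (fun k => (hfd k _ _).trans (hDb y k))).2.2

noncomputable def kern (a p δ : ℝ) (n k : ℕ) : ℝ :=
  if k < n then δ * Real.exp (a * ((n : ℝ) - k - 1)) else δ * Real.exp (p * ((n : ℝ) - k - 1))

noncomputable def MM (a p σ : ℝ) : ℝ :=
  Real.exp (-σ) * ((1 - Real.exp (-(σ - a)))⁻¹ + (1 - Real.exp (-(p - σ)))⁻¹)

theorem MM_pos {a p σ : ℝ} (ha : a < σ) (hp : σ < p) : 0 < MM a p σ := by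
  have h1 : Real.exp (-(σ - a)) < 1 := Real.exp_lt_one_iff.2 (by linarith)
  have h2 : Real.exp (-(p - σ)) < 1 := Real.exp_lt_one_iff.2 (by linarith)
  have h3 := inv_pos.2 (sub_pos.2 h1)
  have h4 := inv_pos.2 (sub_pos.2 h2)
  unfold MM
  positivity

theorem kern_bound {a p σ δ : ℝ} (ha : a < σ) (hp : σ < p) (hδ : 0 ≤ δ) (n : ℕ) :
    Summable (fun k : ℕ => kern a p δ n k * Real.exp (σ * k)) ∧
    ∑' k : ℕ, kern a p δ n k * Real.exp (σ * k) ≤ δ * MM a p σ * Real.exp (σ * n) := by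
  set X := Real.exp (-(σ - a)) with hX
  set Y := Real.exp (-(p - σ)) with hY
  have hX1 : X < 1 := Real.exp_lt_one_iff.2 (by linarith)
  have hY1 : Y < 1 := Real.exp_lt_one_iff.2 (by linarith)
  have hX0 : 0 ≤ X := (Real.exp_pos _).le
  have hY0 : 0 ≤ Y := (Real.exp_pos _).le
  set R := δ * (Real.exp (-σ) * Real.exp (σ * n)) with hR
  have hR0 : 0 ≤ R := by positivity
  have t1 : ∀ j : ℕ, kern a p δ n (j + n) * Real.exp (σ * ((j + n : ℕ) : ℝ)) = R * Y * Y ^ j := by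
    intro j
    have : ¬ (j + n < n) := by omega
    rw [kern, if_neg this, hR, hY, ← Real.exp_nat_mul, mul_assoc, ← Real.exp_add, ← Real.exp_add,
      mul_assoc, mul_assoc, ← Real.exp_add, ← Real.exp_add]
    congr 2
    push_cast; ring
  have t2 : ∀ k ∈ Finset.range n, kern a p δ n k * Real.exp (σ * (k : ℝ))
      = R * X ^ (n - 1 - k) := by
    intro k hk
    have hk' := Finset.mem_range.1 hk
    rw [kern, if_pos hk', hR, hX, ← Real.exp_nat_mul, mul_assoc, ← Real.exp_add, ← Real.exp_add,
      mul_assoc, ← Real.exp_add]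
    congr 2
    have : ((n - 1 - k : ℕ) : ℝ) = (n : ℝ) - 1 - k := by
      rw [Nat.cast_sub (by omega), Nat.cast_sub (by omega)]; simp
    rw [this]; ring
  have hsY : Summable (fun j : ℕ => R * Y * Y ^ j) :=
    (summable_geometric_of_lt_one hY0 hY1).mul_left _
  have hs : Summable (fun k : ℕ => kern a p δ n k * Real.exp (σ * k)) := by
    rw [← summable_nat_add_iff n]
    simp only [t1]
    exact hsY
  refine ⟨hs, ?_⟩
  rw [← hs.sum_add_tsum_nat_add n]
  simp only [t1]
  rw [Finset.sum_congr rfl t2, ← Finset.mul_sum, Finset.sum_range_reflect (fun j => X ^ j) n,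
    tsum_mul_left, tsum_geometric_of_lt_one hY0 hY1]
  have hg : ∑ j ∈ Finset.range n, X ^ j ≤ (1 - X)⁻¹ := by
    rw [← tsum_geometric_of_lt_one hX0 hX1]
    exact (summable_geometric_of_lt_one hX0 hX1).sum_le_tsum _ (fun _ _ => by positivity)
  have hYi : 0 ≤ (1 - Y)⁻¹ := inv_nonneg.2 (by linarith)
  have e : δ * MM a p σ * Real.exp (σ * n) = R * (1 - X)⁻¹ + R * (1 - Y)⁻¹ := by
    rw [MM, hR]; ring
  rw [e]
  refine add_le_add (mul_le_mul_of_nonneg_left hg hR0) ?_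
  rw [mul_assoc]
  refine mul_le_mul_of_nonneg_left ?_ hR0
  nlinarith

theorem kern_KB {a p σ δ M : ℝ} (ha : a < σ) (hp : σ < p) (hδ : 0 ≤ δ) (hM : MM a p σ ≤ M)
    (hδM : δ * M ≤ 1 / 2) : KB (kern a p δ) (fun n : ℕ => Real.exp (σ * n)) (δ * M) where
  c0 n k := by unfold kern; split_ifs <;> positivity
  w0 n := Real.exp_pos _
  sm n := (kern_bound ha hp hδ n).1
  le n := (kern_bound ha hp hδ n).2.trans (by gcongr)
  th := hδM

theorem proj_norm_le {d : ℕ} (t : Fin d → Prop) [DecidablePred t] (π : Ed d → Ed d)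
    (h : ∀ (x : Ed d) (i : Fin d), π x i = if t i then x i else 0) (v : Ed d) :
    ‖π v‖ ≤ ‖v‖ := by
  rw [EuclideanSpace.norm_eq, EuclideanSpace.norm_eq]
  refine Real.sqrt_le_sqrt (Finset.sum_le_sum fun i _ => ?_)
  rw [h]
  split_ifs
  · exact le_rfl
  · simp only [norm_zero, ne_eq, OfNat.ofNat_ne_zero, not_false_eq_true, zero_pow]
    positivity

/-- existence, uniqueness and C¹ dependence on y of the Lyapunov–Perron
solutions (q_n(x,y))_{n≥0} for F_n = Λ_n + f_n, where δ₀ and C depend only on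
λ₊, λ₋, ϱ and ε. -/
theorem lyapunov_perron_existence
    (lamp lamm ε ϱ : ℝ) (hlt : lamm < lamp) (hε : 0 < ε)
    (hgap : lamm + 3 * ε < lamp - 3 * ε)
    (hϱ1 : lamm + 3 * ε < ϱ) (hϱ2 : ϱ < lamp - 3 * ε) :
    ∃ δ0 C : ℝ, 0 < δ0 ∧ 0 < C ∧
      ∀ (d : ℕ), 1 ≤ d →
      ∀ K : ℝ, 1 ≤ K →
      ∀ (s : Finset (Fin d)) (πp πm : Ed d →L[ℝ] Ed d),
        (∀ (x : Ed d) (i : Fin d), πp x i = if i ∈ s then x i else 0) →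
        (∀ (x : Ed d) (i : Fin d), πm x i = if i ∈ s then 0 else x i) →
      ∀ Xp Xm : Submodule ℝ (Ed d),
        Xp = LinearMap.range (πp : Ed d →ₗ[ℝ] Ed d) →
        Xm = LinearMap.range (πm : Ed d →ₗ[ℝ] Ed d) →
      ∀ Λ : ℤ → (Ed d ≃L[ℝ] Ed d),
        (∀ n : ℤ, Xp.map (Λ n : Ed d →ₗ[ℝ] Ed d) = Xp) →
        (∀ n : ℤ, Xm.map (Λ n : Ed d →ₗ[ℝ] Ed d) = Xm) →
      ∀ Λc : ℤ → ℤ → (Ed d ≃L[ℝ] Ed d), IsLinCocycle Λ Λc →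
        (∀ m n : ℤ, m < 0 → ∀ v ∈ Xp,
          ‖Λc m n v‖ ≤ K * Real.exp (ε * |(n : ℝ)|) * Real.exp ((lamp - ε) * m) * ‖v‖) →
        (∀ m n : ℤ, 0 ≤ m → ∀ v ∈ Xm,
          ‖Λc m n v‖ ≤ K * Real.exp (ε * |(n : ℝ)|) * Real.exp ((lamm + ε) * m) * ‖v‖) →
      ∀ (δ : ℝ), 0 < δ →
      ∀ f : ℤ → Ed d → Ed d,
        (∀ n : ℤ, ContDiff ℝ 1 (f n)) → (∀ n : ℤ, f n 0 = 0) →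
        (∀ (n : ℤ) (x : Ed d),
          K * Real.exp (ε * |(n : ℝ) + 1|) * ‖fderiv ℝ (f n) x‖ ≤ δ) →
      ∀ Fo : ℕ → Ed d → Ed d,
        (∀ x : Ed d, Fo 0 x = x) →
        (∀ (k : ℕ) (x : Ed d), Fo (k + 1) x = Λ (k : ℤ) (Fo k x) + f (k : ℤ) (Fo k x)) →
      δ ≤ δ0 →
      ∀ x : Ed d, ∃ q : ℕ → Xm → Ed d,
        (∀ y : Xm, IsLPSolution ϱ Λc πp πm f Fo x (y : Ed d) (fun n => q n y)) ∧
        (∀ (y : Xm) (Q : ℕ → Ed d),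
          IsLPSolution ϱ Λc πp πm f Fo x (y : Ed d) Q → ∀ n, Q n = q n y) ∧
        (∀ y : Xm, (y : Ed d) = πm x → ∀ n, q n y = 0) ∧
        (∀ (y : Xm) (n : ℕ),
          Real.exp (-(ϱ * n)) * ‖q n y‖ ≤ 2 * K * (‖x‖ + ‖(y : Ed d)‖)) ∧
        (∀ n : ℕ, ContDiff ℝ 1 (q n)) ∧
        (∀ (y : Xm) (n : ℕ), Real.exp (-(ϱ * n)) * ‖fderiv ℝ (q n) y‖ ≤ 2 * K) ∧
        (∀ y : Xm, ‖fderiv ℝ (q 0) y - Xm.subtypeL‖ ≤ C * K * δ) := by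
  obtain ⟨a, ha⟩ : ∃ a, a = lamm + ε := ⟨_, rfl⟩
  obtain ⟨p, hp⟩ : ∃ p, p = lamp - ε := ⟨_, rfl⟩
  obtain ⟨σ, hσ⟩ : ∃ σ, σ = lamm + 2 * ε := ⟨_, rfl⟩
  rw [← ha, ← hp]
  have haσ : a < σ := by linarith
  have hσϱ : σ < ϱ := by linarith
  have hϱp : ϱ < p := by linarith
  have haϱ : a < ϱ := by linarith
  have hσp : σ < p := by linarith
  have hM1 := MM_pos haσ hσp
  have hM2 := MM_pos haϱ hϱp
  obtain ⟨M, hM⟩ : ∃ M, M = MM a p σ + MM a p ϱ := ⟨_, rfl⟩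
  have hM0 : 0 < M := by linarith
  refine ⟨1 / (2 * M), 2 * M, by positivity, by positivity, ?_⟩
  intro d _ K hK s πp πm hπp hπm Xp Xm hXp hXm Λ _ _ Λc hcoc hbp hbm δ hδ f hf hf0 hfd
    Fo hFo0 hFoS hδ0 x
  have hK0 : 0 < K := by linarith
  have hδM : δ * M ≤ 1 / 2 := by
    have := mul_le_mul_of_nonneg_right hδ0 hM0.le
    refine this.trans (le_of_eq ?_)
    field_simp
  have hKB := kern_KB (M := M) haϱ hϱp hδ.le (by linarith) hδM
  have hKB' := kern_KB (M := M) haσ hσp hδ.le (by linarith) hδM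
  have hnp : ∀ v, ‖πp v‖ ≤ ‖v‖ := proj_norm_le (fun i => i ∈ s) πp hπp
  have hnm : ∀ v, ‖πm v‖ ≤ ‖v‖ := proj_norm_le (fun i => ¬ i ∈ s) πm (fun x i => by
    rw [hπm]; by_cases h : i ∈ s <;> simp [h])
  have hmp : ∀ v, πp v ∈ Xp := fun v => by rw [hXp]; exact ⟨v, rfl⟩
  have hmm : ∀ v, πm v ∈ Xm := fun v => by rw [hXm]; exact ⟨v, rfl⟩
  -- kernel
  obtain ⟨l, hl⟩ : ∃ l : ℕ → ℝ, l = fun k : ℕ => δ / (K * Real.exp (ε * ((k : ℝ) + 1))) := ⟨_, rfl⟩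
  have hl0 : ∀ k, 0 < l k := fun k => by rw [hl]; positivity
  have hlK : ∀ k, l k * (K * Real.exp (ε * ((k : ℝ) + 1))) = δ := fun k => by
    rw [hl]; field_simp
  obtain ⟨A0, hA0⟩ : ∃ A0 : ℕ → ℕ → Ed d →L[ℝ] Ed d, A0 = fun n k : ℕ =>
    if k < n then (Λc ((n : ℤ) - k - 1) ((k : ℤ) + 1) : Ed d →L[ℝ] Ed d).comp πm
    else -((Λc ((n : ℤ) - k - 1) ((k : ℤ) + 1) : Ed d →L[ℝ] Ed d).comp πp) := ⟨_, rfl⟩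
  obtain ⟨g, hg⟩ : ∃ g : ℕ → Ed d → Ed d, g = fun k v =>
    (l k)⁻¹ • (f (k : ℤ) (v + Fo k x) - f (k : ℤ) (Fo k x)) := ⟨_, rfl⟩
  have hAg : ∀ n k v, (l k • A0 n k) (g k v)
      = A0 n k (f (k : ℤ) (v + Fo k x) - f (k : ℤ) (Fo k x)) := by
    intro n k v
    rw [hg]
    simp only [smul_apply, map_smul]
    rw [smul_smul, inv_mul_cancel₀ (hl0 k).ne', one_smul]
  have hA : ∀ n k, ‖l k • A0 n k‖ ≤ kern a p δ n k := by
    intro n k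
    have habs : |(((k : ℤ) + 1 : ℤ) : ℝ)| = (k : ℝ) + 1 := by
      push_cast; exact abs_of_nonneg (by positivity)
    have hcast : (((n : ℤ) - k - 1 : ℤ) : ℝ) = (n : ℝ) - k - 1 := by push_cast; ring
    refine ContinuousLinearMap.opNorm_le_bound _ (hKB.c0 n k) (fun v => ?_)
    rw [smul_apply, norm_smul, Real.norm_of_nonneg (hl0 k).le]
    by_cases hkn : k < n
    · have h1 := hbm ((n : ℤ) - k - 1) ((k : ℤ) + 1) (by omega) (πm v) (hmm v)
      rw [habs, hcast] at h1
      have h2 : ‖A0 n k v‖ ≤ K * Real.exp (ε * ((k : ℝ) + 1)) *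
          Real.exp (a * ((n : ℝ) - k - 1)) * ‖v‖ := by
        simp only [hA0, if_pos hkn]
        exact h1.trans (mul_le_mul_of_nonneg_left (hnm v) (by positivity))
      refine (mul_le_mul_of_nonneg_left h2 (hl0 k).le).trans (le_of_eq ?_)
      rw [kern, if_pos hkn]
      nth_rewrite 1 [← hlK k]
      ring
    · have h1 := hbp ((n : ℤ) - k - 1) ((k : ℤ) + 1) (by omega) (πp v) (hmp v)
      rw [habs, hcast] at h1
      have h2 : ‖A0 n k v‖ ≤ K * Real.exp (ε * ((k : ℝ) + 1)) *
          Real.exp (p * ((n : ℝ) - k - 1)) * ‖v‖ := by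
        simp only [hA0, if_neg hkn]
        rw [neg_apply, norm_neg]
        exact h1.trans (mul_le_mul_of_nonneg_left (hnp v) (by positivity))
      refine (mul_le_mul_of_nonneg_left h2 (hl0 k).le).trans (le_of_eq ?_)
      rw [kern, if_neg hkn]
      nth_rewrite 1 [← hlK k]
      ring
  have hgc : ∀ k, ContDiff ℝ 1 (g k) := by
    intro k
    rw [hg]
    exact (((hf k).comp (contDiff_id.add contDiff_const)).sub contDiff_const).const_smul _
  have hg0 : ∀ k, g k 0 = 0 := by intro k; simp [hg]
  have hg1 : ∀ k v, ‖fderiv ℝ (g k) v‖ ≤ 1 := by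
    intro k v
    have hd : HasFDerivAt (f (k : ℤ)) (fderiv ℝ (f (k : ℤ)) (v + Fo k x)) (v + Fo k x) :=
      ((hf k).differentiable (by norm_num) _).hasFDerivAt
    have hd2 : HasFDerivAt (g k) ((l k)⁻¹ • fderiv ℝ (f (k : ℤ)) (v + Fo k x)) v := by
      rw [hg]
      exact (((hasFDerivAt_comp_add_right (Fo k x)).2 hd).sub_const _).const_smul (l k)⁻¹
    rw [hd2.fderiv, norm_smul, norm_inv, Real.norm_of_nonneg (hl0 k).le,
      inv_mul_le_iff₀ (hl0 k), mul_one]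
    have h1 := hfd k (v + Fo k x)
    have habs : |((k : ℤ) : ℝ) + 1| = (k : ℝ) + 1 := by
      push_cast; exact abs_of_nonneg (by positivity)
    rw [habs] at h1
    rw [hl]
    show _ ≤ δ / (K * Real.exp (ε * ((k : ℝ) + 1)))
    rw [le_div_iff₀ (by positivity)]
    linarith
  -- inhomogeneous term
  have hBv : ∀ (n : ℕ) (v : Ed d), v ∈ Xm → ‖Λc n 0 v‖ ≤ K * Real.exp (σ * n) * ‖v‖ := by
    intro n v hv
    have h1 := hbm n 0 (by omega) v hv
    simp only [Int.cast_zero, abs_zero, mul_zero, Real.exp_zero, mul_one, Int.cast_natCast] at h1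
    refine h1.trans ?_
    gcongr
  have hww : Tendsto (fun n : ℕ => Real.exp (σ * n) / Real.exp (ϱ * n)) atTop (𝓝 0) := by
    have e : ∀ n : ℕ, Real.exp (σ * n) / Real.exp (ϱ * n) = (Real.exp (σ - ϱ)) ^ n := by
      intro n
      rw [← Real.exp_sub, ← Real.exp_nat_mul]; congr 1; ring
    simp only [e]
    exact tendsto_pow_atTop_nhds_zero_of_lt_one (Real.exp_pos _).le
      (Real.exp_lt_one_iff.2 (by linarith))
  have hle : ∀ n : ℕ, Real.exp (σ * n) ≤ Real.exp (ϱ * n) := by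
    intro n; gcongr
  obtain ⟨q, hqb, hqe, hqu, hqc, hqd, hq0⟩ := lp_abstract hKB hKB' hle hww
    (fun n k => l k • A0 n k) hA g hgc hg0 hg1
    (fun n => (Λc n 0 : Ed d →L[ℝ] Ed d).comp Xm.subtypeL) K hK0.le
    (fun n => ContinuousLinearMap.opNorm_le_bound _ (by positivity) (fun v => hBv n v v.2))
    (fun n => -(Λc n 0 (πm x))) (fun y => K * ‖(y : Ed d) - πm x‖) (fun y => by positivity)
    (fun y n => by
      have h1 := hBv n ((y : Ed d) - πm x) (Xm.sub_mem y.2 (hmm x))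
      rw [map_sub, sub_eq_add_neg] at h1
      refine le_trans h1 (le_of_eq ?_)
      ring)
  simp only [hAg] at hqe hqu
  -- splitting of the series
  have hterm : ∀ (Q : ℕ → Ed d) (n j : ℕ),
      A0 n (j + n) (f ((j + n : ℕ) : ℤ) (Q (j + n) + Fo (j + n) x)
        - f ((j + n : ℕ) : ℤ) (Fo (j + n) x))
      = -(Λc (-(j : ℤ) - 1) ((n : ℤ) + j + 1)
      (πp (f ((n : ℤ) + j) (Q (n + j) + Fo (n + j) x) - f ((n : ℤ) + j) (Fo (n + j) x)))) := by
    intro Q n j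
    have h1 : ¬ (j + n < n) := by omega
    simp only [hA0, if_neg h1]
    have e1 : (n : ℤ) - ((j + n : ℕ) : ℤ) - 1 = -(j : ℤ) - 1 := by push_cast; ring
    have e2 : ((j + n : ℕ) : ℤ) = (n : ℤ) + j := by push_cast; ring
    rw [e1, e2, Nat.add_comm j n]
    rfl
  have hsumm : ∀ (Q : ℕ → Ed d) (C : ℝ), (∀ n : ℕ, ‖Q n‖ ≤ C * Real.exp (ϱ * n)) → ∀ n,
      Summable (fun k => ‖A0 n k (f (k : ℤ) (Q k + Fo k x) - f (k : ℤ) (Fo k x))‖) := by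
    intro Q C hQ n
    have hC : 0 ≤ C := nonneg_of_mul_nonneg_left ((norm_nonneg _).trans (hQ 0)) (Real.exp_pos _)
    have hgn : ∀ k u, ‖g k u‖ ≤ ‖u‖ := by
      intro k u
      have := Convex.norm_image_sub_le_of_norm_fderiv_le (𝕜 := ℝ) (f := g k) (s := Set.univ)
        (x := 0) (y := u) (C := 1)
        (fun x _ => (hgc k).differentiable (by norm_num) x) (fun x _ => hg1 k x)
        convex_univ trivial trivial
      simpa [hg0] using this
    refine (hKB.bound n _ C hC (fun k => ?_)).1
    rw [← hAg]
    exact ((l k • A0 n k).le_opNorm _).trans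
      (mul_le_mul (hA n k) ((hgn k _).trans (hQ k)) (norm_nonneg _) (hKB.c0 n k))
  have hsplit : ∀ (Q : ℕ → Ed d) (C : ℝ), (∀ n : ℕ, ‖Q n‖ ≤ C * Real.exp (ϱ * n)) → ∀ n : ℕ,
      ∑' k, A0 n k (f (k : ℤ) (Q k + Fo k x) - f (k : ℤ) (Fo k x))
      = ∑ k ∈ Finset.range n,
        Λc ((n : ℤ) - k - 1) ((k : ℤ) + 1)
          (πm (f (k : ℤ) (Q k + Fo k x) - f (k : ℤ) (Fo k x)))
      - ∑' j : ℕ, Λc (-(j : ℤ) - 1) ((n : ℤ) + j + 1)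
          (πp (f ((n : ℤ) + j) (Q (n + j) + Fo (n + j) x)
            - f ((n : ℤ) + j) (Fo (n + j) x))) := by
    intro Q C hQ n
    rw [← (hsumm Q C hQ n).of_norm.sum_add_tsum_nat_add n]
    simp only [hterm]
    rw [tsum_neg, ← sub_eq_add_neg]
    congr 1
    refine Finset.sum_congr rfl fun k hk => ?_
    simp only [hA0, if_pos (Finset.mem_range.1 hk)]
    rfl
  have hexp : ∀ (n : ℕ) (t C : ℝ), Real.exp (-(ϱ * n)) * t ≤ C ↔ t ≤ C * Real.exp (ϱ * n) := by
    intro n t C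
    rw [Real.exp_neg, inv_mul_le_iff₀ (Real.exp_pos _), mul_comm]
  have hqb' : ∀ y (n : ℕ), ‖q n y‖ ≤ 2 * (K * ‖(y : Ed d) - πm x‖) * Real.exp (ϱ * n) :=
    fun y n => (hqb y n).trans (mul_le_mul_of_nonneg_left (hle n) (by positivity))
  refine ⟨q, ?_, ?_, ?_, ?_, hqc, ?_, ?_⟩
  · intro y
    refine ⟨⟨_, fun n => (hexp n _ _).2 (hqb' y n)⟩, fun n => ?_, fun n => ?_⟩
    · have := (summable_nat_add_iff n).2 (hsumm (fun n => q n y) _ (hqb' y) n)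
      simp only [hterm (fun n => q n y), norm_neg] at this
      exact this
    · have := hqe y n
      rw [hsplit (fun n => q n y) _ (hqb' y) n] at this
      refine this.trans ?_
      rw [map_sub, sub_eq_add_neg (Λc (n : ℤ) 0 (y : Ed d)), add_sub_assoc]
      rfl
  · intro y Q hQ
    obtain ⟨⟨Cb, hCb⟩, _, hQe⟩ := hQ
    have hQb : ∀ n : ℕ, ‖Q n‖ ≤ Cb * Real.exp (ϱ * n) := fun n => (hexp n _ _).1 (hCb n)
    refine hqu y Q Cb hQb (fun n => ?_)
    rw [hsplit Q Cb hQb n]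
    refine (hQe n).trans ?_
    rw [map_sub, sub_eq_add_neg (Λc (n : ℤ) 0 (y : Ed d)), add_sub_assoc]
    rfl
  · intro y hy n
    have := hqb' y n
    rw [hy, sub_self, norm_zero, mul_zero, mul_zero, zero_mul] at this
    exact norm_le_zero_iff.1 this
  · intro y n
    rw [hexp]
    refine (hqb' y n).trans (mul_le_mul_of_nonneg_right ?_ (Real.exp_pos _).le)
    have h1 := norm_sub_le (y : Ed d) (πm x)
    have h2 := hnm x
    rw [mul_assoc]
    have : ‖(y : Ed d) - πm x‖ ≤ ‖x‖ + ‖(y : Ed d)‖ := by linarith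
    gcongr
  · intro y n
    rw [hexp]
    exact (hqd n y).trans (mul_le_mul_of_nonneg_left (hle n) (by positivity))
  · intro y
    have h1 := hq0 y
    have e : (Λc ((0 : ℕ) : ℤ) 0 : Ed d →L[ℝ] Ed d).comp Xm.subtypeL = Xm.subtypeL := by
      have := hcoc.1 0
      rw [Nat.cast_zero, this]
      rfl
    rw [e] at h1
    refine h1.trans (le_of_eq ?_)
    simp
    ring
end

section
/- Let ℝ^d = X_+ ⊕ X_− where X_+ and X_− are spanned by complementary subsets of the standard basis, with coordinate projections π_+ and π_−. Let λ_− < λ_+ be reals, ε > 0 with λ_− + 3ε < λ_+ − 3ε and 100ε < λ_+ − λ_−, and K ≥ 1. Let (Λ_n)_{n∈ℤ} be invertible linear maps on ℝ^d with Λ_nX_± = X_± whose cocycle Λ(m,n) satisfies ‖Λ(m,n)|_{X_+}‖ ≤ Ke^{ε|n|}e^{(λ_+−ε)m} for all m < 0 and ‖Λ(m,n)|_{X_−}‖ ≤ Ke^{ε|n|}e^{(λ_−+ε)m} for all m ≥ 0. For each n ∈ ℤ let f_n : ℝ^d → ℝ^d be C² with f_n(0) = 0, K·e^{ε|n+1|}·sup_x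 ‖Df_n(x)‖ ≤ δ, and sup_x ‖D²f_n(x)‖ ≤ Me^{ε|n|} for some M > 0; set F_n := Λ_n + f_n and let F(k,x) be the forward orbit from time 0. Assume λ_max ≥ λ_+ is a real with sup_z ‖D(F_{m−1}∘⋯∘F_0)(z)‖ ≤ Ke^{λ_max m} for all m ≥ 0, and let σ ∈ (0,1) satisfy σ < (λ_+ − λ_−)/(4λ_max). For x ∈ ℝ^d and y ∈ X_−, let (q_n(x,y))_{n≥0} be the unique family with sup_{n≥0} e^{−ϱn}‖q_n(x,y)‖ < ∞ for some (equivalently, every) ϱ ∈ (λ_− + 3ε, λ_+ − 3ε) solving the Lyapunov–Perron equation q_n(x,y) = Λ(n,0)(y − π_−x) + Σ_{k=0}^{n−1} Λ(n−k−1, k+1)( π_−[ f_k(q_k(x,y) + F(k,x)) − f_k(F(k,x)) ] ) − Σ_{k=n}^{∞} Λ(n−k−1, k+1)( π_+[ f_k(q_k(x,y) + F(k,x)) − f_k(F(k,x)) ] ) for n ≥ 0. Then there exist δ_0 > 0 and L ≥ 1, depending only on K, M, λ_+, λ_−, λ_max, ε and σ, such that if δ ≤ δ_0 then for all x, x̃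 ∈ ℝ^d and y ∈ X_− with ‖x‖ ≤ 1/2, ‖x̃‖ ≤ 1/2 and ‖y‖ ≤ 1/2: sup_{n≥0} e^{−λ_max n}‖q_n(x,y) − q_n(x̃,y)‖ ≤ L‖x − x̃‖^σ, and ‖∂_y q_0(x,y) − ∂_y q_0(x̃,y)‖ ≤ L‖x − x̃‖^{σ²}. -/
set_option linter.unusedSectionVars false

namespace LPHolder

/-- Kernel constant. -/
noncomputable def Cb (a b ε : ℝ) : ℝ :=
  (Real.exp (-a) + Real.exp (-b)) / (1 - Real.exp (-(2 * ε)))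

lemma one_sub_pos {ε : ℝ} (hε : 0 < ε) : 0 < 1 - Real.exp (-(2 * ε)) := by
  have : Real.exp (-(2 * ε)) < 1 := by
    rw [Real.exp_lt_one_iff]; linarith
  linarith

lemma Cb_pos {a b ε : ℝ} (hε : 0 < ε) : 0 < Cb a b ε :=
  div_pos (by positivity) (one_sub_pos hε)

lemma ker_minus {a ε ρ : ℝ} (hε : 0 < ε) (h : a + 2 * ε ≤ ρ) (n : ℕ) :
    ∑ k ∈ Finset.range n, Real.exp (a * ((n : ℝ) - k - 1)) * Real.exp (ρ * k)
      ≤ Real.exp (-a) / (1 - Real.exp (-(2 * ε))) * Real.exp (ρ * n) := by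
  have hp := one_sub_pos hε
  induction n with
  | zero => simp; positivity
  | succ n ih =>
    rw [Finset.sum_range_succ]
    have e1 : ∑ k ∈ Finset.range n, Real.exp (a * (((n + 1 : ℕ) : ℝ) - k - 1)) * Real.exp (ρ * k)
        = Real.exp a *
          ∑ k ∈ Finset.range n, Real.exp (a * ((n : ℝ) - k - 1)) * Real.exp (ρ * k) := by
      rw [Finset.mul_sum]
      refine Finset.sum_congr rfl fun k _ => ?_
      rw [show a * (((n + 1 : ℕ) : ℝ) - k - 1) = a + a * ((n : ℝ) - k - 1) by push_cast; ring,
        Real.exp_add, mul_assoc]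
    have e2 : Real.exp (a * (((n + 1 : ℕ) : ℝ) - n - 1)) = 1 := by
      push_cast
      rw [show a * ((n : ℝ) + 1 - n - 1) = 0 by ring, Real.exp_zero]
    rw [e1, e2, one_mul]
    have h1 := mul_le_mul_of_nonneg_left ih (Real.exp_pos a).le
    set r := Real.exp (-(2 * ε)) with hr
    have hr0 : 0 < r := Real.exp_pos _
    have e3 : Real.exp (ρ * ((n + 1 : ℕ) : ℝ)) = Real.exp ρ * Real.exp (ρ * n) := by
      rw [← Real.exp_add]; congr 1; push_cast; ring
    rw [e3]
    have h2 : Real.exp a * (Real.exp (-a) / (1 - r)) + 1 ≤ Real.exp (-a) / (1 - r) * Real.exp ρ := by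
      have h3 : Real.exp (-a) * Real.exp ρ * r ≥ 1 := by
        rw [hr, ← Real.exp_add, ← Real.exp_add]
        apply Real.one_le_exp; linarith
      have h4 : Real.exp a * Real.exp (-a) = 1 := by rw [← Real.exp_add]; simp
      have : Real.exp (-a) / (1 - r) * Real.exp ρ - Real.exp a * (Real.exp (-a) / (1 - r)) - 1
          = (Real.exp (-a) * Real.exp ρ - 1 - (1 - r)) / (1 - r) := by
        field_simp
        linear_combination -h4
      have h5 : 0 ≤ (Real.exp (-a) * Real.exp ρ - 1 - (1 - r)) / (1 - r) := by
        apply div_nonneg _ hp.le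
        set s := Real.exp (-a) * Real.exp ρ
        have hs : 0 < s := by positivity
        nlinarith [sq_nonneg (1 - r)]
      linarith
    have h3 := mul_le_mul_of_nonneg_right h2 (Real.exp_pos (ρ * n)).le
    nlinarith [h1, h3]

lemma ker_plus {b ε ρ : ℝ} (hε : 0 < ε) (h : ρ ≤ b - 2 * ε) (n : ℕ) :
    ∃ s, HasSum (fun j : ℕ => Real.exp (-(b * ((j : ℝ) + 1))) * Real.exp (ρ * ((n + j : ℕ) : ℝ))) s ∧
      s ≤ Real.exp (-b) / (1 - Real.exp (-(2 * ε))) * Real.exp (ρ * n) := by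
  have hp := one_sub_pos hε
  have hle : Real.exp (ρ - b) ≤ Real.exp (-(2 * ε)) := Real.exp_le_exp.2 (by linarith)
  have hg := (hasSum_geometric_of_lt_one (Real.exp_pos (ρ - b)).le (by linarith)).mul_left
    (Real.exp (-b) * Real.exp (ρ * n))
  refine ⟨Real.exp (-b) * Real.exp (ρ * n) * (1 - Real.exp (ρ - b))⁻¹, ?_, ?_⟩
  · refine Eq.subst (motive := fun g => HasSum g _) (funext fun j => ?_) hg
    symm
    rw [← Real.exp_nat_mul, ← Real.exp_add, ← Real.exp_add, ← Real.exp_add]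
    congr 1; push_cast; ring
  · rw [div_eq_mul_inv]
    have : (1 - Real.exp (ρ - b))⁻¹ ≤ (1 - Real.exp (-(2 * ε)))⁻¹ :=
      inv_anti₀ hp (by linarith)
    have := mul_le_mul_of_nonneg_left this
      (by positivity : 0 ≤ Real.exp (-b) * Real.exp (ρ * n))
    linarith

lemma conv {G : Type*} [NormedAddCommGroup G] [CompleteSpace G] {a b ε ρ ρ2 p r : ℝ}
    (hε : 0 < ε) (h1 : a + 2 * ε ≤ ρ) (h12 : ρ ≤ ρ2) (h2 : ρ2 ≤ b - 2 * ε)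
    (hp : 0 ≤ p) (hr : 0 ≤ r) (n : ℕ) (s t : ℕ → G)
    (hs : ∀ k, k < n → ‖s k‖ ≤ Real.exp (a * ((n : ℝ) - k - 1)) *
      (p * Real.exp (ρ * k) + r * Real.exp (ρ2 * k)))
    (ht : ∀ j : ℕ, ‖t j‖ ≤ Real.exp (-(b * ((j : ℝ) + 1))) *
      (p * Real.exp (ρ * ((n + j : ℕ) : ℝ)) + r * Real.exp (ρ2 * ((n + j : ℕ) : ℝ)))) :
    Summable t ∧ ‖∑ k ∈ Finset.range n, s k‖ + ‖∑' j, t j‖ ≤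
      Cb a b ε * (p * Real.exp (ρ * n) + r * Real.exp (ρ2 * n)) := by
  obtain ⟨S1, hS1, hS1'⟩ := ker_plus (b := b) hε (h12.trans h2) n
  obtain ⟨S2, hS2, hS2'⟩ := ker_plus (b := b) hε h2 n
  have hS := (hS1.mul_left p).add (hS2.mul_left r)
  have ht' : ∀ j, ‖t j‖ ≤ p * (Real.exp (-(b * ((j : ℝ) + 1))) * Real.exp (ρ * ((n + j : ℕ) : ℝ)))
      + r * (Real.exp (-(b * ((j : ℝ) + 1))) * Real.exp (ρ2 * ((n + j : ℕ) : ℝ))) := by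
    intro j; refine (ht j).trans (le_of_eq ?_); ring
  refine ⟨Summable.of_norm_bounded hS.summable ht', ?_⟩
  have A1 := tsum_of_norm_bounded hS ht'
  have A2 : ‖∑ k ∈ Finset.range n, s k‖ ≤
      p * ∑ k ∈ Finset.range n, Real.exp (a * ((n : ℝ) - k - 1)) * Real.exp (ρ * k) +
      r * ∑ k ∈ Finset.range n, Real.exp (a * ((n : ℝ) - k - 1)) * Real.exp (ρ2 * k) := by
    rw [Finset.mul_sum, Finset.mul_sum, ← Finset.sum_add_distrib]
    refine norm_sum_le_of_le _ fun k hk => ?_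
    refine (hs k (Finset.mem_range.1 hk)).trans (le_of_eq ?_); ring
  have B1 := mul_le_mul_of_nonneg_left (ker_minus hε h1 n) hp
  have B2 := mul_le_mul_of_nonneg_left (ker_minus (a := a) hε (h1.trans h12) n) hr
  have B3 := mul_le_mul_of_nonneg_left hS1' hp
  have B4 := mul_le_mul_of_nonneg_left hS2' hr
  have : Cb a b ε * (p * Real.exp (ρ * n) + r * Real.exp (ρ2 * n)) =
    p * (Real.exp (-a) / (1 - Real.exp (-(2 * ε))) * Real.exp (ρ * n)) +
    r * (Real.exp (-a) / (1 - Real.exp (-(2 * ε))) * Real.exp (ρ2 * n)) +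
    (p * (Real.exp (-b) / (1 - Real.exp (-(2 * ε))) * Real.exp (ρ * n)) +
    r * (Real.exp (-b) / (1 - Real.exp (-(2 * ε))) * Real.exp (ρ2 * n))) := by
    unfold Cb; ring
  linarith

section ops
variable {E : Type*} [NormedAddCommGroup E] [NormedSpace ℝ E]

/-- Abstract affine Lyapunov–Perron relation. -/
def Sol (Am Ap : ℕ → ℕ → E →L[ℝ] E) (z U W : ℕ → E) : Prop :=
  ∀ n : ℕ, Summable (fun j => Ap n j (W (n + j))) ∧
    U n = z n + ∑ k ∈ Finset.range n, Am n k (W k) - ∑' j, Ap n j (W (n + j))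

lemma Sol.sub {Am Ap : ℕ → ℕ → E →L[ℝ] E} {z U W z' U' W' : ℕ → E}
    (h : Sol Am Ap z U W) (h' : Sol Am Ap z' U' W') :
    Sol Am Ap (fun n => z n - z' n) (fun n => U n - U' n) (fun n => W n - W' n) := by
  intro n
  simp only [map_sub]
  refine ⟨(h n).1.sub (h' n).1, ?_⟩
  rw [(h n).1.tsum_sub (h' n).1, Finset.sum_sub_distrib, (h n).2, (h' n).2]
  abel

/-- kernel bounds -/
def KB (a b : ℝ) (κ : ℕ → ℝ) (Am Ap : ℕ → ℕ → E →L[ℝ] E) : Prop :=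
  (∀ k, 0 < κ k) ∧
  (∀ n k, k < n → ∀ w, ‖Am n k w‖ ≤ Real.exp (a * ((n : ℝ) - k - 1)) * (κ k * ‖w‖)) ∧
  (∀ n j : ℕ, ∀ w, ‖Ap n j w‖ ≤ Real.exp (-(b * ((j : ℝ) + 1))) * (κ (n + j) * ‖w‖))

lemma gron [CompleteSpace E] {a b ε ρ ρ2 δ A B : ℝ} {κ : ℕ → ℝ} {Am Ap : ℕ → ℕ → E →L[ℝ] E}
    (hKB : KB a b κ Am Ap) {z U W : ℕ → E} (hS : Sol Am Ap z U W)
    (hε : 0 < ε) (h1 : a + 2 * ε ≤ ρ) (h12 : ρ ≤ ρ2) (h2 : ρ2 ≤ b - 2 * ε)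
    (hδ0 : 0 ≤ δ) (hδ : δ * Cb a b ε ≤ 1 / 2) (hA : 0 ≤ A) (hB : 0 ≤ B)
    (hz : ∀ n : ℕ, ‖z n‖ ≤ A * Real.exp (ρ * n))
    (hW : ∀ k : ℕ, κ k * ‖W k‖ ≤ δ * ‖U k‖ + B * Real.exp (ρ * k))
    (hU : ∃ C, ∀ n : ℕ, ‖U n‖ ≤ C * Real.exp (ρ2 * n)) (n : ℕ) :
    ‖U n‖ ≤ 2 * (A + Cb a b ε * B) * Real.exp (ρ * n) := by
  obtain ⟨C, hC⟩ := hU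
  have hC0 : 0 ≤ C := by
    have := (norm_nonneg _).trans (hC 0)
    simpa using this
  have hCb := Cb_pos (a := a) (b := b) hε
  have key : ∀ i : ℕ, ∀ n : ℕ, ‖U n‖ ≤ 2 * (A + Cb a b ε * B) * Real.exp (ρ * n)
      + C * (1 / 2) ^ i * Real.exp (ρ2 * n) := by
    intro i
    induction i with
    | zero =>
      intro n
      have := hC n
      have : 0 ≤ 2 * (A + Cb a b ε * B) * Real.exp (ρ * n) := by positivity
      simp only [pow_zero, mul_one]
      linarith [hC n]
    | succ i ih =>
      intro n
      set X := 2 * (A + Cb a b ε * B) with hX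
      set Y := C * (1 / 2 : ℝ) ^ i with hY
      have hX0 : 0 ≤ X := by positivity
      have hY0 : 0 ≤ Y := by positivity
      have hW' : ∀ k : ℕ, κ k * ‖W k‖ ≤ (δ * X + B) * Real.exp (ρ * k)
          + δ * Y * Real.exp (ρ2 * k) := by
        intro k
        have := mul_le_mul_of_nonneg_left (ih k) hδ0
        linarith [hW k]
      obtain ⟨-, hc⟩ := conv (a := a) (b := b) hε h1 h12 h2 (p := δ * X + B) (r := δ * Y)
        (by positivity) (by positivity) n (fun k => Am n k (W k)) (fun j => Ap n j (W (n + j)))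
        (fun k hk => (hKB.2.1 n k hk _).trans
          (mul_le_mul_of_nonneg_left (hW' k) (Real.exp_pos _).le))
        (fun j => (hKB.2.2 n j _).trans
          (mul_le_mul_of_nonneg_left (hW' (n + j)) (Real.exp_pos _).le))
      have hn : ‖U n‖ ≤ ‖z n‖ + (‖∑ k ∈ Finset.range n, Am n k (W k)‖ +
          ‖∑' j, Ap n j (W (n + j))‖) := by
        rw [(hS n).2]
        refine (norm_sub_le _ _).trans ?_
        linarith [norm_add_le (z n) (∑ k ∈ Finset.range n, Am n k (W k))]
      have e1 := mul_le_mul_of_nonneg_right hδ (by positivity : 0 ≤ X * Real.exp (ρ * n))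
      have e2 := mul_le_mul_of_nonneg_right hδ (by positivity : 0 ≤ Y * Real.exp (ρ2 * n))
      have e3 : C * (1 / 2 : ℝ) ^ (i + 1) = 1 / 2 * Y := by rw [hY, pow_succ]; ring
      rw [e3]
      have e4 : A * Real.exp (ρ * n) + Cb a b ε * B * Real.exp (ρ * n)
          = 1 / 2 * (X * Real.exp (ρ * n)) := by rw [hX]; ring
      nlinarith [hz n]
  have hlim : Filter.Tendsto (fun i : ℕ => 2 * (A + Cb a b ε * B) * Real.exp (ρ * n)
      + C * (1 / 2) ^ i * Real.exp (ρ2 * n)) Filter.atTop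
      (nhds (2 * (A + Cb a b ε * B) * Real.exp (ρ * n) + C * 0 * Real.exp (ρ2 * n))) := by
    refine Filter.Tendsto.const_add _ (Filter.Tendsto.mul_const _ (Filter.Tendsto.const_mul _ ?_))
    exact tendsto_pow_atTop_nhds_zero_of_lt_one (by norm_num) (by norm_num)
  have := ge_of_tendsto' hlim (fun i => key i n)
  simpa using this

lemma exist_lin [CompleteSpace E] {X : Type*} [NormedAddCommGroup X] [NormedSpace ℝ X]
    {a b ε ρ δ A : ℝ} {κ : ℕ → ℝ} {Am Ap : ℕ → ℕ → E →L[ℝ] E}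
    (hKB : KB a b κ Am Ap)
    (hε : 0 < ε) (h1 : a + 2 * ε ≤ ρ) (h2 : ρ ≤ b - 2 * ε)
    (hδ0 : 0 ≤ δ) (hδ : δ * Cb a b ε ≤ 1 / 2)
    (Z : ℕ → X →L[ℝ] E) (hZ : ∀ n : ℕ, ‖Z n‖ ≤ A * Real.exp (ρ * n))
    (B : ℕ → E →L[ℝ] E) (hB : ∀ k, κ k * ‖B k‖ ≤ δ) :
    ∃ P : ℕ → X →L[ℝ] E, (∃ C, ∀ n : ℕ, ‖P n‖ ≤ C * Real.exp (ρ * n)) ∧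
      ∀ v, Sol Am Ap (fun n => Z n v) (fun n => P n v) (fun n => B n (P n v)) := by
  classical
  let Lop : (ℕ → X →L[ℝ] E) → ℕ → X →L[ℝ] E := fun w n =>
    ∑ k ∈ Finset.range n, ((Am n k).comp (B k)).comp (w k)
      - ∑' j, ((Ap n j).comp (B (n + j))).comp (w (n + j))
  have fact1 : ∀ (w : ℕ → X →L[ℝ] E) (c : ℝ), 0 ≤ c → (∀ k : ℕ, ‖w k‖ ≤ c * Real.exp (ρ * k)) →
      ∀ n : ℕ, Summable (fun j => ((Ap n j).comp (B (n + j))).comp (w (n + j))) ∧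
        ‖Lop w n‖ ≤ 1 / 2 * c * Real.exp (ρ * n) := by
    intro w c hc hw n
    have hBw : ∀ k x, κ k * ‖B k (w k x)‖ ≤ (δ * c * Real.exp (ρ * k)) * ‖x‖ := by
      intro k x
      have h3 : ‖B k (w k x)‖ ≤ ‖B k‖ * (‖w k‖ * ‖x‖) :=
        (B k).le_opNorm_of_le ((w k).le_opNorm x)
      have h4 := mul_le_mul_of_nonneg_left h3 (hKB.1 k).le
      have h5 : κ k * ‖B k‖ * (‖w k‖ * ‖x‖) ≤ δ * ((c * Real.exp (ρ * k)) * ‖x‖) :=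
        mul_le_mul (hB k) (mul_le_mul_of_nonneg_right (hw k) (norm_nonneg _)) (by positivity) hδ0
      linarith
    obtain ⟨c1, c2⟩ := conv (G := X →L[ℝ] E) (a := a) (b := b) hε h1 le_rfl h2 (p := δ * c) (r := 0)
        (by positivity) le_rfl n (fun k => ((Am n k).comp (B k)).comp (w k))
        (fun j => ((Ap n j).comp (B (n + j))).comp (w (n + j)))
        (fun k hk => by
          refine ContinuousLinearMap.opNorm_le_bound _ (by positivity) fun x => ?_
          refine (hKB.2.1 n k hk _).trans ?_
          have := mul_le_mul_of_nonneg_left (hBw k x)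
            (Real.exp_pos (a * ((n : ℝ) - k - 1))).le
          refine this.trans (le_of_eq ?_); ring)
        (fun j => by
          refine ContinuousLinearMap.opNorm_le_bound _ (by positivity) fun x => ?_
          refine (hKB.2.2 n j _).trans ?_
          have := mul_le_mul_of_nonneg_left (hBw (n + j) x)
            (Real.exp_pos (-(b * ((j : ℝ) + 1)))).le
          refine this.trans (le_of_eq ?_); ring)
    refine ⟨c1, (norm_sub_le _ _).trans (c2.trans ?_)⟩
    have := mul_le_mul_of_nonneg_right hδ (by positivity : 0 ≤ c * Real.exp (ρ * n))
    linarith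
  have fact2 : ∀ (w w' : ℕ → X →L[ℝ] E) (c c' : ℝ), 0 ≤ c → 0 ≤ c' →
      (∀ k : ℕ, ‖w k‖ ≤ c * Real.exp (ρ * k)) → (∀ k : ℕ, ‖w' k‖ ≤ c' * Real.exp (ρ * k)) →
      ∀ n, Lop w n - Lop w' n = Lop (fun k => w k - w' k) n := by
    intro w w' c c' hc hc' hw hw' n
    have s1 := (fact1 w c hc hw n).1
    have s2 := (fact1 w' c' hc' hw' n).1
    simp only [Lop, ContinuousLinearMap.comp_sub]
    rw [s1.tsum_sub s2, Finset.sum_sub_distrib]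
    abel
  have hA : 0 ≤ A := by
    have := (norm_nonneg _).trans (hZ 0)
    simpa using this
  let S : BoundedContinuousFunction ℕ (X →L[ℝ] E) → ℕ → X →L[ℝ] E :=
    fun u k => Real.exp (ρ * k) • u k
  have hSn : ∀ u k, ‖S u k‖ ≤ ‖u‖ * Real.exp (ρ * k) := by
    intro u k
    simp only [S, norm_smul, Real.norm_eq_abs, Real.abs_exp]
    rw [mul_comm]
    exact mul_le_mul_of_nonneg_right (u.norm_coe_le_norm k) (Real.exp_pos _).le
  have hnn : ∀ u : BoundedContinuousFunction ℕ (X →L[ℝ] E), 0 ≤ ‖u‖ := fun u => norm_nonneg u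
  have hexp : ∀ n : ℕ, Real.exp (-(ρ * n)) * Real.exp (ρ * n) = 1 := by
    intro n; rw [← Real.exp_add]; simp
  let T : BoundedContinuousFunction ℕ (X →L[ℝ] E) → BoundedContinuousFunction ℕ (X →L[ℝ] E) :=
    fun u => BoundedContinuousFunction.ofNormedAddCommGroupDiscrete
      (fun n : ℕ => Real.exp (-(ρ * n)) • (Z n + Lop (S u) n)) (A + 1 / 2 * ‖u‖) (by
        intro n
        simp only [norm_smul, Real.norm_eq_abs, Real.abs_exp]
        have h3 := (fact1 (S u) ‖u‖ (hnn _) (hSn u) n).2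
        have h4 : ‖Z n + Lop (S u) n‖ ≤ (A + 1 / 2 * ‖u‖) * Real.exp (ρ * n) := by
          refine (norm_add_le _ _).trans ?_
          linarith [hZ n]
        have h5 := mul_le_mul_of_nonneg_left h4 (Real.exp_pos (-(ρ * n))).le
        refine h5.trans (le_of_eq ?_)
        linear_combination (A + 1 / 2 * ‖u‖) * hexp n)
  have hT : ∀ u n, T u n = Real.exp (-(ρ * n)) • (Z n + Lop (S u) n) := fun u n => rfl
  have hcon : ContractingWith (1 / 2) T := by
    refine ⟨by rw [← NNReal.coe_lt_coe]; norm_num, LipschitzWith.of_dist_le_mul fun u v => ?_⟩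
    rw [BoundedContinuousFunction.dist_le (by positivity)]
    intro n
    have hd : dist u v = ‖u - v‖ := dist_eq_norm u v
    rw [dist_eq_norm, hd, hT, hT, ← smul_sub, norm_smul, Real.norm_eq_abs, Real.abs_exp,
      add_sub_add_left_eq_sub, fact2 (S u) (S v) _ _ (hnn _) (hnn _) (hSn u) (hSn v)]
    have e : (fun k => S u k - S v k) = S (u - v) := by
      funext k; simp [S, smul_sub]
    rw [e]
    have h3 := (fact1 (S (u - v)) ‖u - v‖ (hnn _) (hSn _) n).2
    have h5 := mul_le_mul_of_nonneg_left h3 (Real.exp_pos (-(ρ * n))).le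
    refine h5.trans (le_of_eq ?_)
    push_cast
    linear_combination (1 / 2 * ‖u - v‖) * hexp n
  let u := hcon.fixedPoint T
  have hu : T u = u := hcon.fixedPoint_isFixedPt
  have hSu : ∀ n, S u n = Z n + Lop (S u) n := by
    intro n
    have : u n = Real.exp (-(ρ * n)) • (Z n + Lop (S u) n) := by
      rw [← hT, hu]
    show Real.exp (ρ * n) • u n = _
    rw [this, smul_smul, mul_comm, hexp, one_smul]
  refine ⟨S u, ⟨‖u‖, hSn u⟩, fun v n => ?_⟩
  have hs := (fact1 (S u) ‖u‖ (hnn _) (hSn u) n).1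
  have hs' := hs.hasSum.mapL (ContinuousLinearMap.apply ℝ E v)
  refine ⟨hs'.summable, ?_⟩
  have ht := hs'.tsum_eq
  simp only [ContinuousLinearMap.apply_apply, ContinuousLinearMap.comp_apply] at ht
  rw [ht]
  have := congrArg (fun g : X →L[ℝ] E => g v) (hSu n)
  simp only [Lop] at this
  show (S u n) v = Z n v + ∑ k ∈ Finset.range n, (Am n k) (B k ((S u k) v)) - _
  rw [this]
  simp only [_root_.add_apply, _root_.sub_apply,
    _root_.sum_apply, ContinuousLinearMap.comp_apply, add_sub_assoc]

end ops

section fl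
variable {E : Type*} [NormedAddCommGroup E] [NormedSpace ℝ E]

lemma lip1 {g : E → E} {ℓ : ℝ} (hd : Differentiable ℝ g) (h : ∀ z, ‖fderiv ℝ g z‖ ≤ ℓ) (x y : E) :
    ‖g x - g y‖ ≤ ℓ * ‖x - y‖ :=
  convex_univ.norm_image_sub_le_of_norm_fderiv_le (𝕜 := ℝ) (fun z _ => hd z) (fun z _ => h z)
    (Set.mem_univ _) (Set.mem_univ _)

lemma lip2 {g : E → E} {ω : ℝ → ℝ} (hd : Differentiable ℝ g)
    (h : ∀ z w, ‖fderiv ℝ g z - fderiv ℝ g w‖ ≤ ω ‖z - w‖) (q F F' : E) :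
    ‖(g (q + F) - g F) - (g (q + F') - g F')‖ ≤ ω ‖F - F'‖ * ‖q‖ := by
  have hh : ∀ z, HasFDerivAt (fun z => g (z + F) - g (z + F'))
      (fderiv ℝ g (z + F) - fderiv ℝ g (z + F')) z := by
    intro z
    have h1 := ((hd (z + F)).hasFDerivAt).comp z ((hasFDerivAt_id z).add_const F)
    have h2 := ((hd (z + F')).hasFDerivAt).comp z ((hasFDerivAt_id z).add_const F')
    exact h1.sub h2
  have := convex_univ.norm_image_sub_le_of_norm_fderiv_le (𝕜 := ℝ)
    (f := fun z => g (z + F) - g (z + F')) (C := ω ‖F - F'‖) (x := 0) (y := q)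
    (fun z _ => (hh z).differentiableAt)
    (fun z _ => by
      rw [(hh z).fderiv]
      refine (h _ _).trans (le_of_eq ?_)
      congr 2; abel)
    (Set.mem_univ _) (Set.mem_univ _)
  simp only [zero_add, sub_zero] at this
  refine le_trans (le_of_eq ?_) this
  congr 1; abel

lemma lip3 {g : E → E} {ω : ℝ → ℝ} (hd : Differentiable ℝ g) (hω : Monotone ω)
    (h : ∀ z w, ‖fderiv ℝ g z - fderiv ℝ g w‖ ≤ ω ‖z - w‖) (z z' : E) :
    ‖g z' - g z - fderiv ℝ g z (z' - z)‖ ≤ ω ‖z' - z‖ * ‖z' - z‖ :=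
  (convex_closedBall z ‖z' - z‖).norm_image_sub_le_of_norm_fderiv_le' (𝕜 := ℝ)
    (fun w _ => hd w)
    (fun w hw => (h w z).trans (hω (by simpa [dist_eq_norm] using hw)))
    (by simp) (by simp [dist_eq_norm])

end fl

lemma interp {t α β σ : ℝ} (ht : 0 ≤ t) (hα : t ≤ α) (hβ : t ≤ β) (h0 : 0 < σ) (h1 : σ < 1) :
    t ≤ α ^ (1 - σ) * β ^ σ := by
  rcases ht.eq_or_lt with rfl | htp
  · exact mul_nonneg (Real.rpow_nonneg hα _) (Real.rpow_nonneg hβ _)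
  · calc t = t ^ (1 - σ) * t ^ σ := by
          rw [← Real.rpow_add htp]; simp
      _ ≤ _ := mul_le_mul (Real.rpow_le_rpow ht hα (by linarith)) (Real.rpow_le_rpow ht hβ h0.le)
          (Real.rpow_nonneg ht _) (Real.rpow_nonneg (ht.trans hα) _)

/-- weights -/
noncomputable def kap (K ε : ℝ) (k : ℕ) : ℝ := K * Real.exp (ε * ((k : ℝ) + 1))

/-- modulus of continuity of the derivative -/
noncomputable def mn (K M ε δ : ℝ) (k : ℕ) (H : ℝ) : ℝ :=
  min (2 * (δ / kap K ε k)) (M * Real.exp (ε * k) * H)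

/-- interpolation constant -/
noncomputable def c1 (K M a b ε σ N : ℝ) : ℝ :=
  (1 / Cb a b ε) ^ (1 - σ) * (K * M * Real.exp ε * N) ^ σ

/-- Hölder constant for the solution. -/
noncomputable def L1 (K M a b ε σ : ℝ) : ℝ := 2 * (K + Cb a b ε * (c1 K M a b ε σ K * (2 * K)))

/-- Hölder constant for the derivative. -/
noncomputable def L2 (K M a b ε σ : ℝ) : ℝ :=
  2 * (0 + Cb a b ε * (c1 K M a b ε σ (L1 K M a b ε σ + K) * (2 * K)))

/-- All hypotheses in abstract form. -/
structure Setup {E X : Type*} [NormedAddCommGroup E] [NormedSpace ℝ E]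
    [NormedAddCommGroup X] [NormedSpace ℝ X] (K M a b ε σ lm δ : ℝ)
    (Am Ap : ℕ → ℕ → E →L[ℝ] E) (Z : ℕ → X →L[ℝ] E) (p : E →L[ℝ] X)
    (f Fo : ℕ → E → E) (q : E → X → ℕ → E) : Prop where
  hε : 0 < ε
  hK : 1 ≤ K
  hM : 0 < M
  hσ0 : 0 < σ
  hσ1 : σ < 1
  hlm : 0 < lm
  hρ : a + 2 * ε + σ * (lm + 2 * ε) ≤ b - 2 * ε
  hblm : b - 2 * ε ≤ lm
  hδ0 : 0 < δ
  hδ : δ * Cb a b ε ≤ 1 / 2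
  hKB : KB a b (kap K ε) Am Ap
  hZ : ∀ (n : ℕ) v, ‖Z n v‖ ≤ K * Real.exp (a * n) * ‖v‖
  hp : ∀ x, ‖p x‖ ≤ ‖x‖
  fd : ∀ k, Differentiable ℝ (f k)
  f1 : ∀ k z, kap K ε k * ‖fderiv ℝ (f k) z‖ ≤ δ
  f2 : ∀ (k : ℕ) z w, ‖fderiv ℝ (f k) z - fderiv ℝ (f k) w‖ ≤ M * Real.exp (ε * k) * ‖z - w‖
  hF : ∀ (k : ℕ) x y, ‖Fo k x - Fo k y‖ ≤ K * Real.exp (lm * k) * ‖x - y‖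
  hq : ∀ x y, Sol Am Ap (fun n => Z n (y - p x)) (q x y)
    (fun k => f k (q x y k + Fo k x) - f k (Fo k x))
  hqb : ∀ x y, ∃ C, ∀ n : ℕ, ‖q x y n‖ ≤ C * Real.exp ((b - 2 * ε) * n)

namespace Setup
variable {E X : Type*} [NormedAddCommGroup E] [NormedSpace ℝ E] [CompleteSpace E]
    [NormedAddCommGroup X] [NormedSpace ℝ X] {K M a b ε σ lm δ : ℝ}
    {Am Ap : ℕ → ℕ → E →L[ℝ] E} {Z : ℕ → X →L[ℝ] E} {p : E →L[ℝ] X}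
    {f Fo : ℕ → E → E} {q : E → X → ℕ → E}

lemma kpos (S : Setup K M a b ε σ lm δ Am Ap Z p f Fo q) (k : ℕ) : 0 < kap K ε k :=
  S.hKB.1 k

lemma lipf (S : Setup K M a b ε σ lm δ Am Ap Z p f Fo q) (k : ℕ) (z w : E) :
    kap K ε k * ‖f k z - f k w‖ ≤ δ * ‖z - w‖ := by
  have h := lip1 (S.fd k) (ℓ := δ / kap K ε k)
    (fun z => by rw [le_div_iff₀ (S.kpos k), mul_comm]; exact S.f1 k z) z w
  have := mul_le_mul_of_nonneg_left h (S.kpos k).le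
  refine this.trans (le_of_eq ?_)
  have := (S.kpos k).ne'
  field_simp

lemma fmn (S : Setup K M a b ε σ lm δ Am Ap Z p f Fo q) (k : ℕ) (z w : E) :
    ‖fderiv ℝ (f k) z - fderiv ℝ (f k) w‖ ≤ mn K M ε δ k ‖z - w‖ := by
  refine le_min ?_ (S.f2 k z w)
  have h : ∀ z, ‖fderiv ℝ (f k) z‖ ≤ δ / kap K ε k := fun z => by
    rw [le_div_iff₀ (S.kpos k), mul_comm]; exact S.f1 k z
  linarith [norm_sub_le (fderiv ℝ (f k) z) (fderiv ℝ (f k) w), h z, h w]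

lemma mn_mono (S : Setup K M a b ε σ lm δ Am Ap Z p f Fo q) (k : ℕ) :
    Monotone (mn K M ε δ k) := by
  intro x y h
  have := S.hM
  exact min_le_min le_rfl (mul_le_mul_of_nonneg_left h (by positivity))

lemma c1_nonneg (S : Setup K M a b ε σ lm δ Am Ap Z p f Fo q) {N : ℝ} (hN : 0 ≤ N) :
    0 ≤ c1 K M a b ε σ N := by
  have := S.hM
  have := S.hK
  have := Cb_pos (a := a) (b := b) S.hε
  unfold c1
  positivity

lemma mn_bound (S : Setup K M a b ε σ lm δ Am Ap Z p f Fo q) (k : ℕ) {H N h : ℝ}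
    (hH0 : 0 ≤ H) (hN : 0 ≤ N) (hh : 0 ≤ h) (hH : H ≤ N * Real.exp (lm * k) * h) :
    kap K ε k * mn K M ε δ k H ≤
      c1 K M a b ε σ N * Real.exp (σ * (lm + 2 * ε) * k) * h ^ σ := by
  have hM := S.hM
  have hK := S.hK
  have hC := Cb_pos (a := a) (b := b) S.hε
  have hδ0 := S.hδ0
  have hk := S.kpos k
  have t0 : 0 ≤ kap K ε k * mn K M ε δ k H :=
    mul_nonneg hk.le (le_min (by positivity) (by positivity))
  have t1 : kap K ε k * mn K M ε δ k H ≤ 1 / Cb a b ε := by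
    have : kap K ε k * mn K M ε δ k H ≤ kap K ε k * (2 * (δ / kap K ε k)) :=
      mul_le_mul_of_nonneg_left (min_le_left _ _) hk.le
    refine this.trans ?_
    rw [le_div_iff₀ hC]
    have e : kap K ε k * (2 * (δ / kap K ε k)) = 2 * δ := by field_simp
    rw [e]; linarith [S.hδ]
  have t2 : kap K ε k * mn K M ε δ k H ≤
      K * M * Real.exp ε * N * Real.exp ((lm + 2 * ε) * k) * h := by
    have h1 : kap K ε k * mn K M ε δ k H ≤ kap K ε k * (M * Real.exp (ε * k) * H) :=
      mul_le_mul_of_nonneg_left (min_le_right _ _) hk.le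
    have h2 : kap K ε k * (M * Real.exp (ε * k) * H) ≤
        kap K ε k * (M * Real.exp (ε * k) * (N * Real.exp (lm * k) * h)) := by gcongr
    refine h1.trans (h2.trans (le_of_eq ?_))
    unfold kap
    rw [show (lm + 2 * ε) * (k : ℝ) = lm * k + ε * k + ε * k by ring,
      show ε * ((k : ℝ) + 1) = ε * k + ε by ring, Real.exp_add, Real.exp_add, Real.exp_add]
    ring
  refine (interp t0 t1 t2 S.hσ0 S.hσ1).trans (le_of_eq ?_)
  rw [Real.mul_rpow (by positivity) hh, Real.mul_rpow (by positivity) (by positivity),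
    ← Real.exp_mul]
  unfold c1
  rw [show (lm + 2 * ε) * (k : ℝ) * σ = σ * (lm + 2 * ε) * k by ring]
  ring

lemma r01 (S : Setup K M a b ε σ lm δ Am Ap Z p f Fo q) :
    a + 2 * ε ≤ a + 2 * ε + σ * (lm + 2 * ε) := by
  have := S.hσ0
  have := S.hlm
  have := S.hε
  have : 0 ≤ σ * (lm + 2 * ε) := by positivity
  linarith

lemma expa (S : Setup K M a b ε σ lm δ Am Ap Z p f Fo q) {ρ : ℝ} (h : a + 2 * ε ≤ ρ) (n : ℕ)
    (v : X) : ‖Z n v‖ ≤ K * ‖v‖ * Real.exp (ρ * n) := by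
  have hK := S.hK
  have hε := S.hε
  have : Real.exp (a * n) ≤ Real.exp (ρ * n) :=
    Real.exp_le_exp.2 (mul_le_mul_of_nonneg_right (by linarith) (Nat.cast_nonneg n))
  have h2 : K * Real.exp (a * n) * ‖v‖ ≤ K * Real.exp (ρ * n) * ‖v‖ := by gcongr
  refine (S.hZ n v).trans (h2.trans (le_of_eq ?_)); ring

lemma qbound (S : Setup K M a b ε σ lm δ Am Ap Z p f Fo q) (x : E) (y : X) (n : ℕ) :
    ‖q x y n‖ ≤ 2 * K * ‖y - p x‖ * Real.exp ((a + 2 * ε) * n) := by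
  have hK := S.hK
  have := gron S.hKB (S.hq x y) S.hε le_rfl (S.r01.trans S.hρ) le_rfl S.hδ0.le S.hδ
    (A := K * ‖y - p x‖) (B := 0) (by positivity) le_rfl
    (fun n => S.expa le_rfl n _)
    (fun k => by simpa using S.lipf k (q x y k + Fo k x) (Fo k x))
    (S.hqb x y) n
  refine this.trans (le_of_eq ?_); ring

lemma sub_bdd {ρ : ℝ} {u v : ℕ → E} (hu : ∃ C, ∀ n : ℕ, ‖u n‖ ≤ C * Real.exp (ρ * n))
    (hv : ∃ C, ∀ n : ℕ, ‖v n‖ ≤ C * Real.exp (ρ * n)) :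
    ∃ C, ∀ n : ℕ, ‖u n - v n‖ ≤ C * Real.exp (ρ * n) := by
  obtain ⟨C, hC⟩ := hu
  obtain ⟨D, hD⟩ := hv
  exact ⟨C + D, fun n => (norm_sub_le _ _).trans (by linarith [hC n, hD n])⟩

lemma qholder (S : Setup K M a b ε σ lm δ Am Ap Z p f Fo q) (x xt : E) (y : X)
    (hx : ‖x - xt‖ ≤ 1) (hy : ‖y - p xt‖ ≤ 1) (n : ℕ) :
    ‖q x y n - q xt y n‖ ≤ L1 K M a b ε σ * ‖x - xt‖ ^ σ *
      Real.exp ((a + 2 * ε + σ * (lm + 2 * ε)) * n) := by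
  have hK := S.hK
  have hc := S.c1_nonneg (N := K) (by linarith)
  have hhσ : ‖x - xt‖ ≤ ‖x - xt‖ ^ σ := by
    have := Real.rpow_le_rpow_of_exponent_ge' (norm_nonneg (x - xt)) hx S.hσ0.le S.hσ1.le
    simpa using this
  have := gron S.hKB ((S.hq x y).sub (S.hq xt y)) S.hε S.r01 S.hρ le_rfl S.hδ0.le S.hδ
    (A := K * ‖x - xt‖ ^ σ) (B := c1 K M a b ε σ K * (2 * K) * ‖x - xt‖ ^ σ)
    (by positivity) (by positivity)
    (fun n => by
      rw [← map_sub, show y - p x - (y - p xt) = - p (x - xt) by rw [map_sub]; abel]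
      refine (S.expa S.r01 n _).trans ?_
      rw [norm_neg]
      gcongr
      exact (S.hp _).trans hhσ)
    (fun k => by
      have d1 := S.lipf k (q x y k + Fo k x) (q xt y k + Fo k x)
      have d2 := lip2 (S.fd k) (S.fmn k) (q xt y k) (Fo k x) (Fo k xt)
      have d3 := S.mn_bound k (norm_nonneg _) (by linarith : 0 ≤ K) (norm_nonneg _) (S.hF k x xt)
      have d4 := S.qbound xt y k
      have d5 : ‖q xt y k‖ ≤ 2 * K * Real.exp ((a + 2 * ε) * k) := by
        refine d4.trans ?_
        have : 2 * K * ‖y - p xt‖ ≤ 2 * K * 1 := by gcongr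
        rw [mul_one] at this
        exact mul_le_mul_of_nonneg_right this (Real.exp_pos _).le
      have kp := (S.kpos k).le
      rw [add_sub_add_right_eq_sub] at d1
      have d6 : kap K ε k * (mn K M ε δ k ‖Fo k x - Fo k xt‖ * ‖q xt y k‖) ≤
          (c1 K M a b ε σ K * Real.exp (σ * (lm + 2 * ε) * k) * ‖x - xt‖ ^ σ) *
          (2 * K * Real.exp ((a + 2 * ε) * k)) := by
        rw [← mul_assoc]
        exact mul_le_mul d3 d5 (norm_nonneg _) (by positivity)
      have d7 : Real.exp ((a + 2 * ε + σ * (lm + 2 * ε)) * k) =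
          Real.exp (σ * (lm + 2 * ε) * k) * Real.exp ((a + 2 * ε) * k) := by
        rw [← Real.exp_add]; congr 1; ring
      have d8 : f k (q x y k + Fo k x) - f k (Fo k x) - (f k (q xt y k + Fo k xt) - f k (Fo k xt))
          = (f k (q x y k + Fo k x) - f k (q xt y k + Fo k x)) +
            ((f k (q xt y k + Fo k x) - f k (Fo k x)) -
              (f k (q xt y k + Fo k xt) - f k (Fo k xt))) := by abel
      rw [d8, d7]
      have d9 := mul_le_mul_of_nonneg_left d2 kp
      have d10 := mul_le_mul_of_nonneg_left (norm_add_le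
        (f k (q x y k + Fo k x) - f k (q xt y k + Fo k x))
        ((f k (q xt y k + Fo k x) - f k (Fo k x)) -
              (f k (q xt y k + Fo k xt) - f k (Fo k xt)))) kp
      linarith)
    (sub_bdd (S.hqb x y) (S.hqb xt y)) n
  refine this.trans (le_of_eq ?_)
  unfold L1; ring

lemma qlip (S : Setup K M a b ε σ lm δ Am Ap Z p f Fo q) (x : E) (y v : X) (n : ℕ) :
    ‖q x (y + v) n - q x y n‖ ≤ 2 * K * ‖v‖ * Real.exp ((a + 2 * ε) * n) := by
  have hK := S.hK
  have := gron S.hKB ((S.hq x (y + v)).sub (S.hq x y)) S.hε le_rfl (S.r01.trans S.hρ) le_rfl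
    S.hδ0.le S.hδ
    (A := K * ‖v‖) (B := 0) (by positivity) le_rfl
    (fun n => by
      rw [← map_sub, show y + v - p x - (y - p x) = v by abel]
      exact S.expa le_rfl n _)
    (fun k => by
      have := S.lipf k (q x (y + v) k + Fo k x) (q x y k + Fo k x)
      simpa using this)
    (sub_bdd (S.hqb x (y + v)) (S.hqb x y)) n
  refine this.trans (le_of_eq ?_); ring

lemma mono_bdd {ρ ρ2 : ℝ} {u : ℕ → E} (h : ρ ≤ ρ2)
    (hu : ∃ C, ∀ n : ℕ, ‖u n‖ ≤ C * Real.exp (ρ * n)) :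
    ∃ C, ∀ n : ℕ, ‖u n‖ ≤ C * Real.exp (ρ2 * n) := by
  obtain ⟨C, hC⟩ := hu
  have hC0 : 0 ≤ C := by
    have := (norm_nonneg _).trans (hC 0)
    simpa using this
  refine ⟨C, fun n => (hC n).trans ?_⟩
  gcongr

/-- The linearised equation has a solution, which is the derivative. -/
lemma exP (S : Setup K M a b ε σ lm δ Am Ap Z p f Fo q) (x : E) (y : X) :
    ∃ P : ℕ → X →L[ℝ] E,
      (∀ v, Sol Am Ap (fun n => Z n v) (fun n => P n v)
        (fun n => fderiv ℝ (f n) (q x y n + Fo n x) (P n v))) ∧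
      (∀ (n : ℕ) v, ‖P n v‖ ≤ 2 * K * ‖v‖ * Real.exp ((a + 2 * ε) * n)) ∧
      HasFDerivAt (fun y' => q x y' 0) (P 0) y := by
  have hK := S.hK
  have hCb := Cb_pos (a := a) (b := b) S.hε
  obtain ⟨P, ⟨C, hC⟩, hP⟩ := exist_lin (X := X) S.hKB S.hε le_rfl (S.r01.trans S.hρ) S.hδ0.le S.hδ
    Z (A := K) (fun n => ContinuousLinearMap.opNorm_le_bound _ (by positivity) fun v => by
      refine (S.expa le_rfl n v).trans (le_of_eq ?_); ring)
    (fun k => fderiv ℝ (f k) (q x y k + Fo k x)) (fun k => S.f1 k _)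
  have hPb : ∀ v, ∃ C, ∀ n : ℕ, ‖P n v‖ ≤ C * Real.exp ((b - 2 * ε) * n) := fun v =>
    mono_bdd (S.r01.trans S.hρ) ⟨C * ‖v‖, fun n => by
      refine ((P n).le_of_opNorm_le (hC n) v).trans (le_of_eq ?_); ring⟩
  have Bd : ∀ k w, kap K ε k * ‖fderiv ℝ (f k) (q x y k + Fo k x) w‖ ≤ δ * ‖w‖ := by
    intro k w
    have h1 := mul_le_mul_of_nonneg_left
      ((fderiv ℝ (f k) (q x y k + Fo k x)).le_opNorm w) (S.kpos k).le
    have h2 := mul_le_mul_of_nonneg_right (S.f1 k (q x y k + Fo k x)) (norm_nonneg w)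
    linarith
  refine ⟨P, hP, fun n v => ?_, ?_⟩
  · have := gron S.hKB (hP v) S.hε le_rfl (S.r01.trans S.hρ) le_rfl S.hδ0.le S.hδ
      (A := K * ‖v‖) (B := 0) (by positivity) le_rfl
      (fun n => S.expa le_rfl n _)
      (fun k => by simpa using Bd k (P k v)) (hPb v) n
    refine this.trans (le_of_eq ?_); ring
  · set c := c1 K M a b ε σ (2 * K) with hcdef
    have hc : 0 ≤ c := S.c1_nonneg (N := 2 * K) (by linarith)
    have hR : ∀ v, ‖q x (y + v) 0 - q x y 0 - P 0 v‖ ≤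
        2 * (Cb a b ε * (c * (2 * K))) * ‖v‖ ^ σ * ‖v‖ := by
      intro v
      have := gron S.hKB (((S.hq x (y + v)).sub (S.hq x y)).sub (hP v)) S.hε S.r01 S.hρ le_rfl
        S.hδ0.le S.hδ
        (A := 0) (B := c * (2 * K) * ‖v‖ ^ σ * ‖v‖) le_rfl (by positivity)
        (fun n => by
          rw [← map_sub, ← map_sub, show y + v - p x - (y - p x) - v = 0 by abel]
          simp)
        (fun k => by
          have kp := (S.kpos k).le
          have u1 := S.qlip x y v k
          have u2 : ‖q x (y + v) k - q x y k‖ ≤ 2 * K * Real.exp (lm * k) * ‖v‖ := by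
            refine u1.trans ?_
            have e : Real.exp ((a + 2 * ε) * k) ≤ Real.exp (lm * k) :=
              Real.exp_le_exp.2 (mul_le_mul_of_nonneg_right
                ((S.r01.trans S.hρ).trans S.hblm) (Nat.cast_nonneg k))
            have : 2 * K * ‖v‖ * Real.exp ((a + 2 * ε) * k) ≤
              2 * K * ‖v‖ * Real.exp (lm * k) := by gcongr
            linarith
          have d3 := S.mn_bound k (norm_nonneg _) (by linarith : 0 ≤ 2 * K) (norm_nonneg _) u2
          have d2 := lip3 (S.fd k) (S.mn_mono k) (S.fmn k) (q x y k + Fo k x)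
            (q x (y + v) k + Fo k x)
          rw [add_sub_add_right_eq_sub] at d2
          have d1 := Bd k (q x (y + v) k - q x y k - P k v)
          have d6 : kap K ε k * (mn K M ε δ k ‖q x (y + v) k - q x y k‖ *
              ‖q x (y + v) k - q x y k‖) ≤
              (c * Real.exp (σ * (lm + 2 * ε) * k) * ‖v‖ ^ σ) *
              (2 * K * ‖v‖ * Real.exp ((a + 2 * ε) * k)) := by
            rw [← mul_assoc]
            exact mul_le_mul d3 u1 (norm_nonneg _) (by positivity)
          have d7 : Real.exp ((a + 2 * ε + σ * (lm + 2 * ε)) * k) =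
              Real.exp (σ * (lm + 2 * ε) * k) * Real.exp ((a + 2 * ε) * k) := by
            rw [← Real.exp_add]; congr 1; ring
          set D := fderiv ℝ (f k) (q x y k + Fo k x)
          have d8 : f k (q x (y + v) k + Fo k x) - f k (Fo k x) -
              (f k (q x y k + Fo k x) - f k (Fo k x)) - D (P k v)
              = D (q x (y + v) k - q x y k - P k v) +
                (f k (q x (y + v) k + Fo k x) - f k (q x y k + Fo k x) -
                  D (q x (y + v) k - q x y k)) := by
            rw [map_sub D (q x (y + v) k - q x y k) (P k v)]; abel
          rw [d8, d7]
          have d9 := mul_le_mul_of_nonneg_left d2 kp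
          have d10 := mul_le_mul_of_nonneg_left (norm_add_le
            (D (q x (y + v) k - q x y k - P k v))
            (f k (q x (y + v) k + Fo k x) - f k (q x y k + Fo k x) -
                  D (q x (y + v) k - q x y k))) kp
          linarith)
        (sub_bdd (sub_bdd (S.hqb x (y + v)) (S.hqb x y)) (hPb v)) 0
      refine this.trans (le_of_eq ?_)
      simp; ring
    rw [hasFDerivAt_iff_isLittleO_nhds_zero, Asymptotics.isLittleO_iff]
    intro e he
    have hlim : Filter.Tendsto (fun v : X => 2 * (Cb a b ε * (c * (2 * K))) * ‖v‖ ^ σ) (nhds 0)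
        (nhds 0) := by
      have h1 : Filter.Tendsto (fun v : X => ‖v‖ ^ σ) (nhds 0) (nhds (‖(0 : X)‖ ^ σ)) :=
        (continuous_norm.tendsto 0).rpow_const (Or.inr S.hσ0.le)
      have h2 := h1.const_mul (2 * (Cb a b ε * (c * (2 * K))))
      simpa [Real.zero_rpow S.hσ0.ne'] using h2
    filter_upwards [hlim.eventually (gt_mem_nhds he)] with v hv
    exact (hR v).trans (mul_le_mul_of_nonneg_right hv.le (norm_nonneg _))

lemma dholder (S : Setup K M a b ε σ lm δ Am Ap Z p f Fo q) (x xt : E) (y : X)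
    (hx : ‖x - xt‖ ≤ 1) (hy : ‖y - p xt‖ ≤ 1) :
    ‖fderiv ℝ (fun y' => q x y' 0) y - fderiv ℝ (fun y' => q xt y' 0) y‖ ≤
      L2 K M a b ε σ * ‖x - xt‖ ^ (σ ^ 2) := by
  have hK := S.hK
  have hCb := Cb_pos (a := a) (b := b) S.hε
  obtain ⟨P, hP, hPb, hPd⟩ := S.exP x y
  obtain ⟨Q, hQ, hQb, hQd⟩ := S.exP xt y
  rw [hPd.fderiv, hQd.fderiv]
  have hcK := S.c1_nonneg (N := K) (by linarith)
  have hL1 : 0 ≤ L1 K M a b ε σ := by unfold L1; positivity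
  set N := L1 K M a b ε σ + K with hN
  have hN0 : 0 ≤ N := by positivity
  have hc := S.c1_nonneg (N := N) hN0
  have hσσ : ‖x - xt‖ ^ (σ ^ 2) = (‖x - xt‖ ^ σ) ^ σ := by
    rw [← Real.rpow_mul (norm_nonneg _), sq]
  have hhσ : ‖x - xt‖ ≤ ‖x - xt‖ ^ σ := by
    have := Real.rpow_le_rpow_of_exponent_ge' (norm_nonneg (x - xt)) hx S.hσ0.le S.hσ1.le
    simpa using this
  set h := ‖x - xt‖ ^ σ with hh
  have hh0 : 0 ≤ h := by positivity
  rw [hσσ]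
  refine ContinuousLinearMap.opNorm_le_bound _ (by unfold L2; positivity) fun v => ?_
  rw [_root_.sub_apply]
  have := gron S.hKB ((hP v).sub (hQ v)) S.hε S.r01 S.hρ le_rfl
    S.hδ0.le S.hδ
    (A := 0) (B := c1 K M a b ε σ N * (2 * K) * h ^ σ * ‖v‖) le_rfl (by positivity)
    (fun n => by simp)
    (fun k => by
      have kp := (S.kpos k).le
      have u2 : ‖(q x y k + Fo k x) - (q xt y k + Fo k xt)‖ ≤ N * Real.exp (lm * k) * h := by
        have e1 := S.qholder x xt y hx hy k
        have e2 := S.hF k x xt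
        have e : Real.exp ((a + 2 * ε + σ * (lm + 2 * ε)) * k) ≤ Real.exp (lm * k) :=
          Real.exp_le_exp.2 (mul_le_mul_of_nonneg_right (S.hρ.trans S.hblm) (Nat.cast_nonneg k))
        have e3 : L1 K M a b ε σ * h * Real.exp ((a + 2 * ε + σ * (lm + 2 * ε)) * k) ≤
          L1 K M a b ε σ * h * Real.exp (lm * k) := by gcongr
        have e4 : K * Real.exp (lm * k) * ‖x - xt‖ ≤ K * Real.exp (lm * k) * h := by gcongr
        have e5 := norm_add_le (q x y k - q xt y k) (Fo k x - Fo k xt)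
        rw [add_sub_add_comm, hN]
        linarith
      have d3 := S.mn_bound k (norm_nonneg _) hN0 hh0 u2
      have d2 := S.fmn k (q x y k + Fo k x) (q xt y k + Fo k xt)
      set D := fderiv ℝ (f k) (q x y k + Fo k x) with hD
      set D' := fderiv ℝ (f k) (q xt y k + Fo k xt) with hD'
      have d1 : kap K ε k * ‖D (P k v - Q k v)‖ ≤ δ * ‖P k v - Q k v‖ := by
        have h1 := mul_le_mul_of_nonneg_left (D.le_opNorm (P k v - Q k v)) kp
        have h2 := mul_le_mul_of_nonneg_right (S.f1 k (q x y k + Fo k x))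
          (norm_nonneg (P k v - Q k v))
        rw [← hD] at h2
        linarith
      have d5 : kap K ε k * ‖(D - D') (Q k v)‖ ≤
          (c1 K M a b ε σ N * Real.exp (σ * (lm + 2 * ε) * k) * h ^ σ) *
              (2 * K * ‖v‖ * Real.exp ((a + 2 * ε) * k)) := by
        have h1 := mul_le_mul_of_nonneg_left ((D - D').le_of_opNorm_le d2 (Q k v)) kp
        refine h1.trans ?_
        rw [← mul_assoc]
        exact mul_le_mul d3 (hQb k v) (norm_nonneg _) (by positivity)
      have d7 : Real.exp ((a + 2 * ε + σ * (lm + 2 * ε)) * k) =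
          Real.exp (σ * (lm + 2 * ε) * k) * Real.exp ((a + 2 * ε) * k) := by
        rw [← Real.exp_add]; congr 1; ring
      have d8 : D (P k v) - D' (Q k v) = D (P k v - Q k v) + (D - D') (Q k v) := by
        rw [map_sub, _root_.sub_apply]; abel
      rw [d8, d7]
      have d10 := mul_le_mul_of_nonneg_left (norm_add_le
        (D (P k v - Q k v)) ((D - D') (Q k v))) kp
      linarith)
    (sub_bdd (mono_bdd (S.r01.trans S.hρ) ⟨_, fun n => hPb n v⟩)
      (mono_bdd (S.r01.trans S.hρ) ⟨_, fun n => hQb n v⟩)) 0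
  refine this.trans (le_of_eq ?_)
  unfold L2
  rw [← hN]
  simp; ring

end Setup

lemma fderiv_lip {E : Type*} [NormedAddCommGroup E] [NormedSpace ℝ E] {g : E → E} {m : ℝ}
    (hg : ContDiff ℝ 2 g) (h : ∀ x, ‖iteratedFDeriv ℝ 2 g x‖ ≤ m) (z w : E) :
    ‖fderiv ℝ g z - fderiv ℝ g w‖ ≤ m * ‖z - w‖ := by
  have hd : Differentiable ℝ (fderiv ℝ g) :=
    (hg.fderiv_right (m := 1) (by norm_num)).differentiable (by norm_num)
  refine convex_univ.norm_image_sub_le_of_norm_fderiv_le (𝕜 := ℝ) (fun z _ => hd z) (fun z _ => ?_)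
    (Set.mem_univ _) (Set.mem_univ _)
  have := h z
  rw [show (2 : ℕ) = 1 + 1 from rfl, ← norm_iteratedFDeriv_fderiv, norm_iteratedFDeriv_one] at this
  exact this

lemma coord_norm_le {d : ℕ} {u v : Ed d} (h : ∀ i, u i = v i ∨ u i = 0) : ‖u‖ ≤ ‖v‖ := by
  rw [EuclideanSpace.norm_eq, EuclideanSpace.norm_eq]
  refine Real.sqrt_le_sqrt (Finset.sum_le_sum fun i _ => ?_)
  rcases h i with h | h <;> rw [h]
  simp; positivity

end LPHolder

/-- Hölder dependence on the base point of the Lyapunov–Perron solutions: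
sup_{n≥0} e^{−λ_max n}‖q_n(x,y) − q_n(x̃,y)‖ ≤ L‖x − x̃‖^σ and
‖∂_y q_0(x,y) − ∂_y q_0(x̃,y)‖ ≤ L‖x − x̃‖^{σ²}, where δ₀ and L depend only on
K, M, λ₊, λ₋, λ_max, ε and σ. -/
theorem lyapunov_perron_holder_base_point
    (K M lamp lamm lamMax ε σ : ℝ)
    (hK : 1 ≤ K) (hM : 0 < M) (hlt : lamm < lamp) (hε : 0 < ε)
    (hgap : lamm + 3 * ε < lamp - 3 * ε) (hε100 : 100 * ε < lamp - lamm)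
    (hlamMax : lamp ≤ lamMax)
    (hσ0 : 0 < σ) (hσ1 : σ < 1) (hσ : σ < (lamp - lamm) / (4 * lamMax)) :
    ∃ δ0 L : ℝ, 0 < δ0 ∧ 1 ≤ L ∧
      ∀ (d : ℕ), 1 ≤ d →
      ∀ (s : Finset (Fin d)) (πp πm : Ed d →L[ℝ] Ed d),
        (∀ (x : Ed d) (i : Fin d), πp x i = if i ∈ s then x i else 0) →
        (∀ (x : Ed d) (i : Fin d), πm x i = if i ∈ s then 0 else x i) →
      ∀ Xp Xm : Submodule ℝ (Ed d),
        Xp = LinearMap.range (πp : Ed d →ₗ[ℝ] Ed d) →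
        Xm = LinearMap.range (πm : Ed d →ₗ[ℝ] Ed d) →
      ∀ Λ : ℤ → (Ed d ≃L[ℝ] Ed d),
        (∀ n : ℤ, Xp.map (Λ n : Ed d →ₗ[ℝ] Ed d) = Xp) →
        (∀ n : ℤ, Xm.map (Λ n : Ed d →ₗ[ℝ] Ed d) = Xm) →
      ∀ Λc : ℤ → ℤ → (Ed d ≃L[ℝ] Ed d), IsLinCocycle Λ Λc →
        (∀ m n : ℤ, m < 0 → ∀ v ∈ Xp,
          ‖Λc m n v‖ ≤ K * Real.exp (ε * |(n : ℝ)|) * Real.exp ((lamp - ε) * m) * ‖v‖) →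
        (∀ m n : ℤ, 0 ≤ m → ∀ v ∈ Xm,
          ‖Λc m n v‖ ≤ K * Real.exp (ε * |(n : ℝ)|) * Real.exp ((lamm + ε) * m) * ‖v‖) →
      ∀ (δ : ℝ), 0 < δ →
      ∀ f : ℤ → Ed d → Ed d,
        (∀ n : ℤ, ContDiff ℝ 2 (f n)) → (∀ n : ℤ, f n 0 = 0) →
        (∀ (n : ℤ) (x : Ed d),
          K * Real.exp (ε * |(n : ℝ) + 1|) * ‖fderiv ℝ (f n) x‖ ≤ δ) →
        (∀ (n : ℤ) (x : Ed d),
          ‖iteratedFDeriv ℝ 2 (f n) x‖ ≤ M * Real.exp (ε * |(n : ℝ)|)) →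
      ∀ Fo : ℕ → Ed d → Ed d,
        (∀ x : Ed d, Fo 0 x = x) →
        (∀ (k : ℕ) (x : Ed d), Fo (k + 1) x = Λ (k : ℤ) (Fo k x) + f (k : ℤ) (Fo k x)) →
        (∀ (m : ℕ) (z : Ed d), ‖fderiv ℝ (Fo m) z‖ ≤ K * Real.exp (lamMax * m)) →
      ∀ q : Ed d → Xm → ℕ → Ed d,
        (∀ (x : Ed d) (y : Xm), ∃ ϱ : ℝ, lamm + 3 * ε < ϱ ∧ ϱ < lamp - 3 * ε ∧
          IsLPSolution ϱ Λc πp πm f Fo x (y : Ed d) (fun n => q x y n)) →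
      δ ≤ δ0 →
      ∀ (x xt : Ed d) (y : Xm), ‖x‖ ≤ 1 / 2 → ‖xt‖ ≤ 1 / 2 → ‖(y : Ed d)‖ ≤ 1 / 2 →
        (∀ n : ℕ, Real.exp (-(lamMax * n)) * ‖q x y n - q xt y n‖ ≤ L * ‖x - xt‖ ^ σ) ∧
        ‖fderiv ℝ (fun y' : Xm => q x y' 0) y - fderiv ℝ (fun y' : Xm => q xt y' 0) y‖ ≤
          L * ‖x - xt‖ ^ (σ ^ 2) := by
  have hlm : 0 < lamMax := by
    by_contra hc
    have : (lamp - lamm) / (4 * lamMax) ≤ 0 :=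
      div_nonpos_of_nonneg_of_nonpos (by linarith) (by linarith)
    linarith
  have hσlm : σ * lamMax < (lamp - lamm) / 4 := by
    rw [lt_div_iff₀ (by positivity)] at hσ
    linarith
  have hCb := LPHolder.Cb_pos (a := lamm + ε) (b := lamp - ε) hε
  refine ⟨1 / (2 * LPHolder.Cb (lamm + ε) (lamp - ε) ε),
    1 + |LPHolder.L1 K M (lamm + ε) (lamp - ε) ε σ| + |LPHolder.L2 K M (lamm + ε) (lamp - ε) ε σ|,
    by positivity, by
      have := abs_nonneg (LPHolder.L1 K M (lamm + ε) (lamp - ε) ε σ)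
      have := abs_nonneg (LPHolder.L2 K M (lamm + ε) (lamp - ε) ε σ)
      linarith, ?_⟩
  intro d _ s πp πm hπp hπm Xp Xm hXp hXm Λ _ _ Λc _ hcp hcm δ hδ f hf2 hf0 hf1 hf2b Fo hFo0 hFos
    hFod q hq hδδ0 x xt y hx hxt hy
  have npp : ∀ w, ‖πp w‖ ≤ ‖w‖ := fun w => LPHolder.coord_norm_le fun i => by
    rw [hπp]; split_ifs <;> simp
  have npm : ∀ w, ‖πm w‖ ≤ ‖w‖ := fun w => LPHolder.coord_norm_le fun i => by
    rw [hπm]; split_ifs <;> simp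
  have memp : ∀ w, πp w ∈ Xp := fun w => by rw [hXp]; exact ⟨w, rfl⟩
  have memm : ∀ w, πm w ∈ Xm := fun w => by rw [hXm]; exact ⟨w, rfl⟩
  have hfd : ∀ n : ℤ, Differentiable ℝ (f n) := fun n => (hf2 n).differentiable (by norm_num)
  have hFd : ∀ k, Differentiable ℝ (Fo k) := by
    intro k
    induction k with
    | zero =>
      have : Fo 0 = id := funext hFo0
      rw [this]; exact differentiable_id
    | succ k ih =>
      have : Fo (k + 1) = fun x => Λ (k : ℤ) (Fo k x) + f (k : ℤ) (Fo k x) := funext (hFos k)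
      rw [this]
      exact ((Λ (k : ℤ)).differentiable.comp ih).add ((hfd k).comp ih)
  have habs : ∀ k : ℕ, |(k : ℝ) + 1| = (k : ℝ) + 1 := fun k => abs_of_nonneg (by positivity)
  have S : LPHolder.Setup (E := Ed d) (X := Xm) K M (lamm + ε) (lamp - ε) ε σ lamMax δ
      (fun n k => (Λc ((n : ℤ) - k - 1) ((k : ℤ) + 1) : Ed d →L[ℝ] Ed d).comp πm)
      (fun n j => (Λc (-(j : ℤ) - 1) ((n : ℤ) + j + 1) : Ed d →L[ℝ] Ed d).comp πp)
      (fun n => (Λc (n : ℤ) 0 : Ed d →L[ℝ] Ed d).comp Xm.subtypeL)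
      (πm.codRestrict Xm memm) (fun k => f (k : ℤ)) Fo q := by
    refine ⟨hε, hK, hM, hσ0, hσ1, hlm, ?_, by linarith, hδ, ?_, ⟨?_, ?_, ?_⟩, ?_, ?_, ?_, ?_, ?_,
      ?_, ?_, ?_⟩
    · nlinarith
    · rw [le_div_iff₀ (by positivity)] at hδδ0
      linarith
    · intro k; unfold LPHolder.kap; positivity
    · intro n k hk w
      have h := hcm ((n : ℤ) - k - 1) ((k : ℤ) + 1) (by omega) (πm w) (memm w)
      push_cast at h
      rw [habs] at h
      have h2 := mul_le_mul_of_nonneg_left (npm w) (by positivity :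
        0 ≤ K * Real.exp (ε * ((k : ℝ) + 1)) * Real.exp ((lamm + ε) * ((n : ℝ) - k - 1)))
      refine (h.trans h2).trans (le_of_eq ?_)
      unfold LPHolder.kap; ring
    · intro n j w
      have h := hcp (-(j : ℤ) - 1) ((n : ℤ) + j + 1) (by omega) (πp w) (memp w)
      push_cast at h
      have e := habs (n + j)
      push_cast at e
      rw [e] at h
      have h2 := mul_le_mul_of_nonneg_left (npp w) (by positivity :
        0 ≤ K * Real.exp (ε * ((n : ℝ) + j + 1)) * Real.exp ((lamp - ε) * (-(j : ℝ) - 1)))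
      refine (h.trans h2).trans (le_of_eq ?_)
      unfold LPHolder.kap
      push_cast
      rw [show (lamp - ε) * (-(j : ℝ) - 1) = -((lamp - ε) * ((j : ℝ) + 1)) by ring]
      ring
    · intro n v
      have h := hcm (n : ℤ) 0 (by omega) v v.2
      simpa using h
    · intro w; exact npm w
    · intro k; exact hfd k
    · intro k z
      have h := hf1 (k : ℤ) z
      push_cast at h
      rw [habs] at h
      exact h
    · intro k z w
      exact LPHolder.fderiv_lip (hf2 k) (fun x => by simpa using hf2b (k : ℤ) x) z w
    · intro k u v
      exact LPHolder.lip1 (hFd k) (fun z => hFod k z) u v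
    · intro x y n
      obtain ⟨ϱ, -, -, -, hs, he⟩ := hq x y
      refine ⟨?_, ?_⟩
      · have h := (hs n).of_norm
        simpa using h
      · have h := he n
        simpa using h
    · intro x y
      obtain ⟨ϱ, -, h2, ⟨C, hC⟩, -, -⟩ := hq x y
      refine LPHolder.Setup.mono_bdd (ρ := ϱ) (by linarith) ⟨C, fun n => ?_⟩
      have h := mul_le_mul_of_nonneg_right (hC n) (Real.exp_pos (ϱ * n)).le
      have e : Real.exp (-(ϱ * n)) * Real.exp (ϱ * n) = 1 := by rw [← Real.exp_add]; simp
      calc ‖q x y n‖ = Real.exp (-(ϱ * n)) * ‖q x y n‖ * Real.exp (ϱ * n) := by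
            linear_combination (-‖q x y n‖) * e
        _ ≤ _ := h
  have hxx : ‖x - xt‖ ≤ 1 := (norm_sub_le _ _).trans (by linarith)
  have hyx : ‖y - (πm.codRestrict Xm memm) xt‖ ≤ 1 := by
    have h1 := norm_sub_le y ((πm.codRestrict Xm memm) xt)
    have h2 := S.hp xt
    have h3 : ‖y‖ ≤ 1 / 2 := hy
    linarith
  have hL1 := le_abs_self (LPHolder.L1 K M (lamm + ε) (lamp - ε) ε σ)
  have hL2 := le_abs_self (LPHolder.L2 K M (lamm + ε) (lamp - ε) ε σ)
  have hL1' := abs_nonneg (LPHolder.L1 K M (lamm + ε) (lamp - ε) ε σ)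
  have hL2' := abs_nonneg (LPHolder.L2 K M (lamm + ε) (lamp - ε) ε σ)
  constructor
  · intro n
    have h := S.qholder x xt y hxx hyx n
    have e : Real.exp ((lamm + ε + 2 * ε + σ * (lamMax + 2 * ε)) * n) ≤ Real.exp (lamMax * n) :=
      Real.exp_le_exp.2 (mul_le_mul_of_nonneg_right (S.hρ.trans S.hblm) (Nat.cast_nonneg n))
    have hpow : 0 ≤ ‖x - xt‖ ^ σ := by positivity
    have h2 : LPHolder.L1 K M (lamm + ε) (lamp - ε) ε σ * ‖x - xt‖ ^ σ *
        Real.exp ((lamm + ε + 2 * ε + σ * (lamMax + 2 * ε)) * n) ≤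
        (1 + |LPHolder.L1 K M (lamm + ε) (lamp - ε) ε σ| +
          |LPHolder.L2 K M (lamm + ε) (lamp - ε) ε σ|) * ‖x - xt‖ ^ σ * Real.exp (lamMax * n) := by
      refine mul_le_mul (mul_le_mul_of_nonneg_right (by linarith) hpow) e (Real.exp_pos _).le
        (by positivity)
    have h3 := mul_le_mul_of_nonneg_left (h.trans h2) (Real.exp_pos (-(lamMax * n))).le
    have e1 : Real.exp (-(lamMax * n)) * Real.exp (lamMax * n) = 1 := by
      rw [← Real.exp_add]; simp
    refine h3.trans (le_of_eq ?_)
    linear_combination ((1 + |LPHolder.L1 K M (lamm + ε) (lamp - ε) ε σ| +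
          |LPHolder.L2 K M (lamm + ε) (lamp - ε) ε σ|) * ‖x - xt‖ ^ σ) * e1
  · refine (S.dholder x xt y hxx hyx).trans ?_
    exact mul_le_mul_of_nonneg_right (by linarith) (by positivity)
end

section
/- Let X and Y be finite-dimensional real vector spaces and let (A_n)_{n∈ℤ} and (B_n)_{n∈ℤ} be invertible linear maps on X and on Y respectively. Let λ_A, λ_B, ν ∈ ℝ, b ∈ (0,2], K ≥ 1 and ε > 0, and suppose there are norms ‖·‖ₙˣ on X and ‖·‖ₙʸ on Y (n ∈ ℤ) with ‖v‖ ≤ ‖v‖ₙ ≤ Ke^{ε|n|}‖v‖ for all v, adapted to the cocycles in the sense that for all n ∈ ℤ and m ≥ 0: ‖A(m,n)x‖ˣ_{n+m} ≤ e^{(λ_A+ε)m}‖x‖ˣ_n and ‖A(−m,n)x‖ˣ_{n−m} ≤ e^{−(λ_A−ε)m}‖x‖ˣ_n for all x ∈ X, and ‖B(m,n)y‖ʸ_{n+m} ≤ e^{(λ_B+ε)m}‖y‖ʸ_n and ‖B(−m,n)y‖ʸ_{n−m} ≤ e^{−(λ_B−ε)m}‖y‖ʸ_n for all y ∈ Y.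 Set w_n := e^{νn + 10ε|n|} and, for a family h = (h_n)_{n∈ℤ} of continuous maps h_n : X → Y with h_n(0) = 0, define N(h) := sup_{n∈ℤ} sup_{x≠0} ‖h_n(x)‖ʸ_n / ( w_n·(‖x‖ˣ_n)^b ). Assume λ_B − ν − bλ_A ≠ 0 and 13ε < |λ_B − ν − bλ_A|, and set C := (1 − e^{−(|λ_B − ν − bλ_A| − 13ε)})^{−1}. Then for every family h with N(h) < ∞ there exists a family g = (g_n)_{n∈ℤ} of continuous maps g_n : X → Y with g_n(0) = 0, N(g) ≤ C·N(h), and g_n(x) − B_n^{−1}(g_{n+1}(A_n x)) = h_n(x) for all n ∈ ℤ and x ∈ X. -/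
theorem cocycle_add {E : Type*} [NormedAddCommGroup E] [NormedSpace ℝ E]
    {L : ℤ → (E ≃L[ℝ] E)} {T : ℤ → ℤ → (E ≃L[ℝ] E)} (hT : IsLinCocycle L T)
    (k m n : ℤ) (x : E) : T (m + k) n x = T k (n + m) (T m n x) := by
  obtain ⟨h0, h1⟩ := hT
  induction k using Int.induction_on with
  | zero => simp [h0]
  | succ k ih =>
    have e1 := h1 (m + k) n
    have e2 := h1 k (n + m)
    rw [← add_assoc, e1, e2]
    simp [ih, add_assoc]
  | pred k ih =>
    have e1 := h1 (m + (-(k:ℤ) - 1)) n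
    have e2 := h1 (-(k:ℤ) - 1) (n + m)
    rw [show m + (-(k:ℤ) - 1) + 1 = m + -(k:ℤ) by ring] at e1
    rw [show (-(k:ℤ) - 1) + 1 = -(k:ℤ) by ring] at e2
    rw [e1, e2] at ih
    simp only [ContinuousLinearEquiv.trans_apply] at ih
    rw [show n + (m + (-(k:ℤ) - 1)) = n + m + (-(k:ℤ) - 1) by ring] at ih
    exact (L _).injective ih

theorem cocycle_symm {E : Type*} [NormedAddCommGroup E] [NormedSpace ℝ E]
    {L : ℤ → (E ≃L[ℝ] E)} {T : ℤ → ℤ → (E ≃L[ℝ] E)} (hT : IsLinCocycle L T)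
    (m n : ℤ) (y : E) : (T m n).symm y = T (-m) (n + m) y := by
  have := cocycle_add hT (-m) m n ((T m n).symm y)
  rw [add_neg_cancel, hT.1] at this
  simpa using this

theorem cocycle_succ {E : Type*} [NormedAddCommGroup E] [NormedSpace ℝ E]
    {L : ℤ → (E ≃L[ℝ] E)} {T : ℤ → ℤ → (E ≃L[ℝ] E)} (hT : IsLinCocycle L T)
    (m n : ℤ) (x : E) : T (m + 1) n x = T m (n + 1) (L n x) := by
  have e := cocycle_add hT m 1 n x
  have e1 := hT.2 0 n
  rw [hT.1, zero_add, add_zero] at e1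
  rw [add_comm m 1, e, e1]
  simp

/-- Summation at a fixed fibre: a series of continuous maps with geometric bounds. -/
theorem sum_fibre {X Y : Type*} [NormedAddCommGroup X]
    [NormedAddCommGroup Y] [NormedSpace ℝ Y] [FiniteDimensional ℝ Y]
    (b M M' W r Ch : ℝ) (hb0 : 0 < b) (hW : 0 < W) (hr0 : 0 ≤ r) (hr1 : r < 1)
    (hM : 0 ≤ M)
    (Nx : X → ℝ) (Ny : Y → ℝ)
    (hNxlow : ∀ v, ‖v‖ ≤ Nx v) (hNxup : ∀ v, Nx v ≤ M * ‖v‖)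
    (hNyadd : ∀ v w, Ny (v + w) ≤ Ny v + Ny w)
    (hNylow : ∀ v, ‖v‖ ≤ Ny v) (hNyup : ∀ v, Ny v ≤ M' * ‖v‖)
    (t : ℕ → X → Y) (ht : ∀ k, Continuous (t k)) (ht0 : ∀ k, t k 0 = 0)
    (hbd : ∀ k x, x ≠ 0 → Ny (t k x) ≤ Ch * r ^ k * (W * Nx x ^ b)) :
    (∀ x, Summable fun k => t k x) ∧ Continuous (fun x => ∑' k, t k x) ∧
    ∀ D : ℝ, (∀ k x, x ≠ 0 → Ny (t k x) ≤ D * r ^ k * (W * Nx x ^ b)) →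
      ∀ x, x ≠ 0 → Ny (∑' k, t k x) ≤ ((1 - r)⁻¹ * D) * (W * Nx x ^ b) := by
  have hNx0 : ∀ x, 0 ≤ Nx x := fun x => (norm_nonneg x).trans (hNxlow x)
  have key : ∀ R : ℝ, ∀ k x, x ∈ Metric.ball (0:X) R →
      ‖t k x‖ ≤ r ^ k * (|Ch| * (W * (M * R) ^ b)) := by
    intro R k x hx
    have hxR : ‖x‖ < R := by simpa using hx
    have hR : 0 < R := (norm_nonneg x).trans_lt hxR
    by_cases h0 : x = 0
    · rw [h0, ht0, norm_zero]; positivity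
    · have h1 : Nx x ^ b ≤ (M * R) ^ b := by
        apply Real.rpow_le_rpow (hNx0 x) _ hb0.le
        exact (hNxup x).trans (by gcongr)
      have h2 : 0 ≤ Nx x ^ b := Real.rpow_nonneg (hNx0 x) b
      calc ‖t k x‖ ≤ Ny (t k x) := hNylow _
        _ ≤ Ch * r ^ k * (W * Nx x ^ b) := hbd k x h0
        _ ≤ |Ch| * r ^ k * (W * (M * R) ^ b) := by
            gcongr
            exact le_abs_self _
        _ = _ := by ring
  have hsumR : ∀ R : ℝ, Summable fun k : ℕ => r ^ k * (|Ch| * (W * (M * R) ^ b)) :=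
    fun R => (summable_geometric_of_lt_one hr0 hr1).mul_right _
  have hsum : ∀ x, Summable fun k => t k x := by
    intro x
    refine Summable.of_norm_bounded (hsumR (‖x‖ + 1)) fun k => key (‖x‖ + 1) k x ?_
    simp
  refine ⟨hsum, ?_, ?_⟩
  · rw [continuous_iff_continuousAt]
    intro x
    have := continuousOn_tsum (s := Metric.ball (0:X) (‖x‖ + 1))
      (fun k => (ht k).continuousOn) (hsumR (‖x‖ + 1)) (key (‖x‖ + 1))
    exact this.continuousAt (Metric.isOpen_ball.mem_nhds (by simp))
  · intro D hD x hx
    have hxp : 0 < Nx x := (norm_pos_iff.2 hx).trans_le (hNxlow x)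
    have hP : 0 < W * Nx x ^ b := mul_pos hW (Real.rpow_pos_of_pos hxp b)
    have hD0 : 0 ≤ D := by
      have h1 := (norm_nonneg _).trans ((hNylow _).trans (hD 0 x hx))
      rw [pow_zero, mul_one] at h1
      exact nonneg_of_mul_nonneg_left h1 hP
    have hNy0 : Ny 0 ≤ 0 := by simpa using hNyup 0
    have hpart : ∀ m : ℕ, Ny (∑ k ∈ Finset.range m, t k x) ≤
        ∑ k ∈ Finset.range m, D * r ^ k * (W * Nx x ^ b) := by
      intro m
      induction m with
      | zero => simpa using hNy0
      | succ m ih =>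
        rw [Finset.sum_range_succ, Finset.sum_range_succ]
        exact (hNyadd _ _).trans (add_le_add ih (hD m x hx))
    have hpart2 : ∀ m : ℕ, ∑ k ∈ Finset.range m, D * r ^ k * (W * Nx x ^ b) ≤
        ((1 - r)⁻¹ * D) * (W * Nx x ^ b) := by
      intro m
      have h1 : ∑ k ∈ Finset.range m, r ^ k ≤ (1 - r)⁻¹ := by
        rw [← tsum_geometric_of_lt_one hr0 hr1]
        exact (summable_geometric_of_lt_one hr0 hr1).sum_le_tsum _ (fun k _ => pow_nonneg hr0 k)
      rw [← Finset.sum_mul, ← Finset.mul_sum, mul_comm D]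
      gcongr
    have hlim := (hsum x).hasSum.tendsto_sum_nat
    have hlim2 : Filter.Tendsto (fun m : ℕ => M' * ‖(∑' k, t k x) - ∑ k ∈ Finset.range m, t k x‖
        + ((1 - r)⁻¹ * D) * (W * Nx x ^ b)) Filter.atTop
        (nhds (M' * ‖(∑' k, t k x) - ∑' k, t k x‖ + ((1 - r)⁻¹ * D) * (W * Nx x ^ b))) :=
      (((hlim.const_sub _).norm).const_mul _).add_const _
    rw [sub_self, norm_zero, mul_zero, zero_add] at hlim2
    refine ge_of_tendsto' hlim2 fun m => ?_
    calc Ny (∑' k, t k x) = Ny (((∑' k, t k x) - ∑ k ∈ Finset.range m, t k x)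
          + ∑ k ∈ Finset.range m, t k x) := by rw [sub_add_cancel]
      _ ≤ _ := hNyadd _ _
      _ ≤ _ := add_le_add (hNyup _) ((hpart m).trans (hpart2 m))

/-- invertibility of the random cohomological operator
g_n(x) − B_n⁻¹(g_{n+1}(A_n x)) = h_n(x) in the weighted spaces defined by the Lyapunov
norms, with explicit constant C = (1 − e^{−(|λ_B − ν − bλ_A| − 13ε)})⁻¹. -/
theorem cohomological_operator_inverse
    {X Y : Type*} [NormedAddCommGroup X] [NormedSpace ℝ X] [FiniteDimensional ℝ X]
    [NormedAddCommGroup Y] [NormedSpace ℝ Y] [FiniteDimensional ℝ Y]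
    (A : ℤ → (X ≃L[ℝ] X)) (B : ℤ → (Y ≃L[ℝ] Y))
    (lamA lamB ν b K ε : ℝ)
    (hb0 : 0 < b) (hb2 : b ≤ 2) (hK : 1 ≤ K) (hε : 0 < ε)
    (Nx : ℤ → X → ℝ) (Ny : ℤ → Y → ℝ)
    (hNxadd : ∀ (n : ℤ) (v w : X), Nx n (v + w) ≤ Nx n v + Nx n w)
    (hNxsmul : ∀ (n : ℤ) (c : ℝ) (v : X), Nx n (c • v) = |c| * Nx n v)
    (hNxlow : ∀ (n : ℤ) (v : X), ‖v‖ ≤ Nx n v)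
    (hNxup : ∀ (n : ℤ) (v : X), Nx n v ≤ K * Real.exp (ε * |(n : ℝ)|) * ‖v‖)
    (hNyadd : ∀ (n : ℤ) (v w : Y), Ny n (v + w) ≤ Ny n v + Ny n w)
    (hNysmul : ∀ (n : ℤ) (c : ℝ) (v : Y), Ny n (c • v) = |c| * Ny n v)
    (hNylow : ∀ (n : ℤ) (v : Y), ‖v‖ ≤ Ny n v)
    (hNyup : ∀ (n : ℤ) (v : Y), Ny n v ≤ K * Real.exp (ε * |(n : ℝ)|) * ‖v‖)
    (Ac : ℤ → ℤ → (X ≃L[ℝ] X)) (Bc : ℤ → ℤ → (Y ≃L[ℝ] Y))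
    (hAc : IsLinCocycle A Ac) (hBc : IsLinCocycle B Bc)
    (hAad : ∀ (n : ℤ) (m : ℕ) (x : X),
      Nx (n + m) (Ac m n x) ≤ Real.exp ((lamA + ε) * m) * Nx n x ∧
      Nx (n - m) (Ac (-(m : ℤ)) n x) ≤ Real.exp (-(lamA - ε) * m) * Nx n x)
    (hBad : ∀ (n : ℤ) (m : ℕ) (y : Y),
      Ny (n + m) (Bc m n y) ≤ Real.exp ((lamB + ε) * m) * Ny n y ∧
      Ny (n - m) (Bc (-(m : ℤ)) n y) ≤ Real.exp (-(lamB - ε) * m) * Ny n y)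
    (hres : lamB - ν - b * lamA ≠ 0)
    (hεs : 13 * ε < |lamB - ν - b * lamA|)
    (h : ℤ → X → Y) (hcont : ∀ n, Continuous (h n)) (h0 : ∀ n, h n 0 = 0)
    (hfin : ∃ Ch : ℝ, ∀ (n : ℤ) (x : X), x ≠ 0 →
      Ny n (h n x) ≤ Ch * (Real.exp (ν * n + 10 * ε * |(n : ℝ)|) * Nx n x ^ b)) :
    ∃ g : ℤ → X → Y,
      (∀ n, Continuous (g n)) ∧ (∀ n, g n 0 = 0) ∧
      (∀ (n : ℤ) (x : X), g n x - (B n).symm (g (n + 1) (A n x)) = h n x) ∧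
      ∀ Ch : ℝ,
        (∀ (n : ℤ) (x : X), x ≠ 0 →
          Ny n (h n x) ≤ Ch * (Real.exp (ν * n + 10 * ε * |(n : ℝ)|) * Nx n x ^ b)) →
        ∀ (n : ℤ) (x : X), x ≠ 0 →
          Ny n (g n x) ≤ ((1 - Real.exp (-(|lamB - ν - b * lamA| - 13 * ε)))⁻¹ * Ch) *
            (Real.exp (ν * n + 10 * ε * |(n : ℝ)|) * Nx n x ^ b) := by
  classical
  obtain ⟨Ch0, hCh0⟩ := hfin
  set δ := lamB - ν - b * lamA with hδ
  set r := Real.exp (-(|δ| - 13 * ε)) with hr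
  have hr0 : 0 ≤ r := (Real.exp_pos _).le
  have hr1 : r < 1 := by rw [hr, Real.exp_lt_one_iff]; linarith
  have hNx0 : ∀ n x, 0 ≤ Nx n x := fun n x => (norm_nonneg x).trans (hNxlow n x)
  let t : ℤ → ℤ → X → Y := fun m n x => (Bc m n).symm (h (n + m) (Ac m n x))
  have htc : ∀ m n, Continuous (t m n) := fun m n =>
    (Bc m n).symm.continuous.comp ((hcont _).comp (Ac m n).continuous)
  have ht0 : ∀ m n, t m n 0 = 0 := fun m n => by simp [t, h0]
  have hthh : ∀ n x, t 0 n x = h n x := fun n x => by simp [t, hAc.1, hBc.1]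
  have htrel : ∀ m n x, (B n).symm (t m (n + 1) (A n x)) = t (m + 1) n x := by
    intro m n x
    simp only [t]
    rw [cocycle_succ hAc, ContinuousLinearEquiv.symm_apply_eq,
      ContinuousLinearEquiv.symm_apply_eq, ← cocycle_succ hBc,
      ContinuousLinearEquiv.apply_symm_apply, show n + 1 + m = n + (m + 1) by ring]
  have general : ∀ (m n : ℤ) (x : X) (D a c : ℝ) (k : ℕ), x ≠ 0 → |(m : ℝ)| = k →
      (∀ (n : ℤ) (x : X), x ≠ 0 →
          Ny n (h n x) ≤ D * (Real.exp (ν * n + 10 * ε * |(n : ℝ)|) * Nx n x ^ b)) →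
      (Nx (n + m) (Ac m n x) ≤ Real.exp a * Nx n x) →
      (∀ y, Ny n (Bc (-m) (n + m) y) ≤ Real.exp c * Ny (n + m) y) →
      c + ν * m + 10 * ε * k + a * b ≤ -(|δ| - 13 * ε) * k →
      Ny n (t m n x) ≤ D * r ^ k * (Real.exp (ν * n + 10 * ε * |(n : ℝ)|) * Nx n x ^ b) := by
    intro m n x D a c k hx hmk hD ha hc hle
    have hxp : 0 < Nx n x := (norm_pos_iff.2 hx).trans_le (hNxlow n x)
    have hD0 : 0 ≤ D := by
      have h1 := (norm_nonneg _).trans ((hNylow _ _).trans (hD n x hx))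
      exact nonneg_of_mul_nonneg_left h1
        (mul_pos (Real.exp_pos _) (Real.rpow_pos_of_pos hxp b))
    have hAx : Ac m n x ≠ 0 := by simpa using hx
    have h1 : Nx (n + m) (Ac m n x) ^ b ≤ Real.exp (a * b) * Nx n x ^ b := by
      calc _ ≤ (Real.exp a * Nx n x) ^ b := Real.rpow_le_rpow (hNx0 _ _) ha hb0.le
        _ = _ := by rw [Real.mul_rpow (Real.exp_pos _).le hxp.le, Real.exp_mul]
    have h2 : |((n + m : ℤ) : ℝ)| ≤ |(n : ℝ)| + k := by
      push_cast; rw [← hmk]; exact abs_add_le _ _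
    have h3 : 0 ≤ Nx n x ^ b := Real.rpow_nonneg hxp.le b
    have h4 : r ^ k = Real.exp (-(|δ| - 13 * ε) * k) := by
      rw [hr, ← Real.exp_nat_mul, mul_comm]
    calc Ny n (t m n x) = Ny n (Bc (-m) (n + m) (h (n + m) (Ac m n x))) := by
          simp only [t]; rw [cocycle_symm hBc]
      _ ≤ Real.exp c * Ny (n + m) (h (n + m) (Ac m n x)) := hc _
      _ ≤ Real.exp c * (D * (Real.exp (ν * (n + m : ℤ) + 10 * ε * |((n + m : ℤ) : ℝ)|)
            * (Real.exp (a * b) * Nx n x ^ b))) := by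
          refine mul_le_mul_of_nonneg_left ((hD _ _ hAx).trans ?_) (Real.exp_pos _).le
          gcongr
      _ = D * Real.exp (c + (ν * (n + m : ℤ) + 10 * ε * |((n + m : ℤ) : ℝ)|) + a * b)
            * Nx n x ^ b := by
          rw [Real.exp_add _ (a * b), Real.exp_add c]; ring
      _ ≤ D * Real.exp (-(|δ| - 13 * ε) * k + (ν * n + 10 * ε * |(n : ℝ)|)) * Nx n x ^ b := by
          have h5 := mul_le_mul_of_nonneg_left h2 (by positivity : 0 ≤ 10 * ε)
          refine mul_le_mul_of_nonneg_right
            (mul_le_mul_of_nonneg_left (Real.exp_le_exp.2 ?_) hD0) h3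
          push_cast at h5 ⊢
          linarith
      _ = _ := by rw [Real.exp_add, h4]; ring
  have hMn : ∀ n : ℤ, 0 ≤ K * Real.exp (ε * |(n : ℝ)|) := fun n => by positivity
  have hbε : b * ε ≤ 2 * ε := by gcongr
  rcases lt_or_gt_of_ne hres with hneg | hpos
  · have habs : |δ| = -δ := abs_of_neg hneg
    have hbdneg : ∀ D : ℝ, (∀ (n : ℤ) (x : X), x ≠ 0 →
          Ny n (h n x) ≤ D * (Real.exp (ν * n + 10 * ε * |(n : ℝ)|) * Nx n x ^ b)) →
        ∀ n (k : ℕ) (x : X), x ≠ 0 → Ny n (t (-((k + 1 : ℕ) : ℤ)) n x) ≤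
          D * r ^ k * (Real.exp (ν * n + 10 * ε * |(n : ℝ)|) * Nx n x ^ b) := by
      intro D hD n k x hx
      have hxp : 0 < Nx n x := (norm_pos_iff.2 hx).trans_le (hNxlow n x)
      have hD0 : 0 ≤ D := by
        have h1 := (norm_nonneg _).trans ((hNylow _ _).trans (hD n x hx))
        exact nonneg_of_mul_nonneg_left h1
          (mul_pos (Real.exp_pos _) (Real.rpow_pos_of_pos hxp b))
      have main := general (-((k + 1 : ℕ) : ℤ)) n x D (-(lamA - ε) * (k + 1 : ℕ))
        ((lamB + ε) * (k + 1 : ℕ)) (k + 1) hx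
        (by rw [Int.cast_neg, abs_neg, Int.cast_natCast, Nat.abs_cast]) hD
        (by rw [← sub_eq_add_neg]; exact (hAad n (k + 1) x).2)
        (by
          intro y
          have := (hBad (n + -((k + 1 : ℕ) : ℤ)) (k + 1) y).1
          rw [neg_add_cancel_right] at this
          rwa [neg_neg])
        (by
          have hk : (0:ℝ) ≤ ((k + 1 : ℕ) : ℝ) := by positivity
          rw [Int.cast_neg, Int.cast_natCast]
          have := mul_le_mul_of_nonneg_right hbε hk
          rw [habs, hδ]
          linarith)
      refine main.trans ?_
      have : r ^ (k + 1) ≤ r ^ k := pow_le_pow_of_le_one hr0 hr1.le (Nat.le_succ k)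
      have h3 : 0 ≤ Nx n x ^ b := Real.rpow_nonneg hxp.le b
      gcongr
    have S := fun n : ℤ => sum_fibre b _ _ _ r Ch0 hb0 (Real.exp_pos (ν * n + 10 * ε * |(n : ℝ)|))
      hr0 hr1 (hMn n) (Nx n) (Ny n) (hNxlow n) (hNxup n) (hNyadd n) (hNylow n) (hNyup n)
      (fun k => t (-((k + 1 : ℕ) : ℤ)) n) (fun k => htc _ n) (fun k => ht0 _ n) (hbdneg Ch0 hCh0 n)
    refine ⟨fun n x => -∑' k : ℕ, t (-((k + 1 : ℕ) : ℤ)) n x, fun n => (S n).2.1.neg,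
      fun n => by simp [ht0], ?_, ?_⟩
    · intro n x
      have e1 : (B n).symm (∑' k : ℕ, t (-((k + 1 : ℕ) : ℤ)) (n + 1) (A n x)) =
          ∑' k : ℕ, t (-(k : ℤ)) n x := by
        rw [(B n).symm.map_tsum]
        refine tsum_congr fun k => ?_
        rw [htrel]
        congr 1
        push_cast
        ring
      have hs : Summable fun k : ℕ => t (-(k : ℤ)) n x :=
        (summable_nat_add_iff (f := fun k : ℕ => t (-(k : ℤ)) n x) 1).1 ((S n).1 x)
      have e2 := hs.tsum_eq_zero_add
      simp only [map_neg]
      rw [e1, e2]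
      simp only [Nat.cast_zero, neg_zero, hthh]
      abel
    · intro D hD n x hx
      have hs := (S n).2.2 D (hbdneg D hD n) x hx
      have : ∀ v, Ny n (-v) = Ny n v := fun v => by
        have := hNysmul n (-1) v
        simpa using this
      simp only [this]
      exact hs
  · have habs : |δ| = δ := abs_of_pos hpos
    have hbdpos : ∀ D : ℝ, (∀ (n : ℤ) (x : X), x ≠ 0 →
          Ny n (h n x) ≤ D * (Real.exp (ν * n + 10 * ε * |(n : ℝ)|) * Nx n x ^ b)) →
        ∀ n (k : ℕ) (x : X), x ≠ 0 → Ny n (t (k : ℤ) n x) ≤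
          D * r ^ k * (Real.exp (ν * n + 10 * ε * |(n : ℝ)|) * Nx n x ^ b) := by
      intro D hD n k x hx
      exact general (k : ℤ) n x D ((lamA + ε) * k)
        (-(lamB - ε) * k) k hx
        (by rw [Int.cast_natCast, Nat.abs_cast]) hD
        (hAad n k x).1
        (by
          intro y
          have := (hBad (n + (k : ℤ)) k y).2
          rwa [add_sub_cancel_right] at this)
        (by
          have hk : (0:ℝ) ≤ (k : ℝ) := by positivity
          rw [Int.cast_natCast]
          have := mul_le_mul_of_nonneg_right hbε hk
          rw [habs, hδ]
          have h6 : 0 ≤ ε * k := by positivity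
          linarith)
    have S := fun n : ℤ => sum_fibre b _ _ _ r Ch0 hb0 (Real.exp_pos (ν * n + 10 * ε * |(n : ℝ)|))
      hr0 hr1 (hMn n) (Nx n) (Ny n) (hNxlow n) (hNxup n) (hNyadd n) (hNylow n) (hNyup n)
      (fun k => t (k : ℤ) n) (fun k => htc _ n) (fun k => ht0 _ n) (hbdpos Ch0 hCh0 n)
    refine ⟨fun n x => ∑' k : ℕ, t (k : ℤ) n x, fun n => (S n).2.1,
      fun n => by simp [ht0], ?_, fun D hD n x hx => (S n).2.2 D (hbdpos D hD n) x hx⟩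
    intro n x
    have e1 : (B n).symm (∑' k : ℕ, t (k : ℤ) (n + 1) (A n x)) =
        ∑' k : ℕ, t ((k + 1 : ℕ) : ℤ) n x := by
      rw [(B n).symm.map_tsum]
      refine tsum_congr fun k => ?_
      rw [htrel]
      congr 1
    have e2 := ((S n).1 x).tsum_eq_zero_add
    simp only
    rw [e1, e2]
    simp only [Nat.cast_zero, hthh]
    abel
end

section
/- For all real numbers ε > 0 and λ > 0 and every non-decreasing bounded function φ : (0,∞) → [0,∞) with lim_{s→0⁺} φ(s) = 0, there exists a non-decreasing function χ : (0,∞) → (0,∞) such that: φ(s) ≤ χ(s) for every s > 0; lim_{s→0⁺} χ(s) = 0; and χ(e^{λk}·s) ≤ e^{εk}·χ(s) for every integer k ≥ 0 and every s > 0. -/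
open Filter Set

/-- For all ε > 0 and λ > 0 and every non-decreasing bounded function
φ : (0,∞) → [0,∞) with lim_{s→0⁺} φ(s) = 0, there exists a non-decreasing
χ : (0,∞) → (0,∞) with φ ≤ χ, lim_{s→0⁺} χ(s) = 0, and
χ(e^{λk}·s) ≤ e^{εk}·χ(s) for every integer k ≥ 0 and s > 0. -/
theorem slowly_varying_majorant
    (ε lam : ℝ) (hε : 0 < ε) (hlam : 0 < lam)
    (φ : ℝ → ℝ)
    (hφ_nonneg : ∀ s : ℝ, 0 < s → 0 ≤ φ s)
    (hφ_mono : ∀ s t : ℝ, 0 < s → s ≤ t → φ s ≤ φ t)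
    (hφ_bdd : ∃ B : ℝ, ∀ s : ℝ, 0 < s → φ s ≤ B)
    (hφ_lim : Tendsto φ (nhdsWithin 0 (Set.Ioi 0)) (nhds 0)) :
    ∃ χ : ℝ → ℝ,
      (∀ s : ℝ, 0 < s → 0 < χ s) ∧
      (∀ s t : ℝ, 0 < s → s ≤ t → χ s ≤ χ t) ∧
      (∀ s : ℝ, 0 < s → φ s ≤ χ s) ∧
      Tendsto χ (nhdsWithin 0 (Set.Ioi 0)) (nhds 0) ∧
      (∀ (k : ℕ) (s : ℝ), 0 < s →
        χ (Real.exp (lam * k) * s) ≤ Real.exp (ε * k) * χ s) := by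
  obtain ⟨B, hB⟩ := hφ_bdd
  have hB0 : 0 ≤ B := (hφ_nonneg 1 one_pos).trans (hB 1 one_pos)
  set T : ℝ → ℕ → ℝ := fun s n => Real.exp (-(ε * n)) * φ (Real.exp (lam * n) * s) with hT
  have hpos : ∀ (n : ℕ) (s : ℝ), 0 < s → 0 < Real.exp (lam * n) * s :=
    fun n s hs => mul_pos (Real.exp_pos _) hs
  have hTB : ∀ s, 0 < s → ∀ n, T s n ≤ Real.exp (-(ε * n)) * B := fun s hs n =>
    mul_le_mul_of_nonneg_left (hB _ (hpos n s hs)) (Real.exp_pos _).le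
  have hexp1 : ∀ n : ℕ, Real.exp (-(ε * n)) ≤ 1 := fun n => by
    rw [Real.exp_le_one_iff]
    have : 0 ≤ ε * n := by positivity
    linarith
  have hbdd : ∀ s, 0 < s → BddAbove (range (T s)) := by
    intro s hs
    refine ⟨B, ?_⟩
    rintro _ ⟨n, rfl⟩
    exact (hTB s hs n).trans (mul_le_of_le_one_left hB0 (hexp1 n))
  have hle : ∀ s, 0 < s → φ s ≤ ⨆ n, T s n := by
    intro s hs
    have h := le_ciSup (hbdd s hs) 0
    simpa [hT] using h
  have ha : 0 < ε / lam := div_pos hε hlam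
  refine ⟨fun s => (⨆ n, T s n) + s ^ (ε / lam), ?_, ?_, ?_, ?_, ?_⟩
  · intro s hs
    have := Real.rpow_pos_of_pos hs (ε / lam)
    have := hle s hs
    have := hφ_nonneg s hs
    show 0 < (⨆ n, T s n) + s ^ (ε / lam)
    linarith
  · intro s t hs hst
    refine add_le_add (ciSup_mono (hbdd t (hs.trans_le hst)) fun n => ?_)
      (Real.rpow_le_rpow hs.le hst ha.le)
    exact mul_le_mul_of_nonneg_left (hφ_mono _ _ (hpos n s hs)
      (mul_le_mul_of_nonneg_left hst (Real.exp_pos _).le)) (Real.exp_pos _).le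
  · intro s hs
    have := Real.rpow_pos_of_pos hs (ε / lam)
    have := hle s hs
    show φ s ≤ (⨆ n, T s n) + s ^ (ε / lam)
    linarith
  · have h2 : Tendsto (fun s : ℝ => s ^ (ε / lam)) (nhdsWithin 0 (Set.Ioi 0)) (nhds 0) := by
      have := (Real.continuousAt_rpow_const 0 (ε / lam) (Or.inr ha.le)).tendsto
      rw [Real.zero_rpow ha.ne'] at this
      exact this.mono_left nhdsWithin_le_nhds
    have h1 : Tendsto (fun s : ℝ => ⨆ n, T s n) (nhdsWithin 0 (Set.Ioi 0)) (nhds 0) := by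
      have hE : Tendsto (fun n : ℕ => Real.exp (-(ε * n)) * B) atTop (nhds 0) := by
        have : Tendsto (fun n : ℕ => Real.exp (-(ε * n))) atTop (nhds 0) :=
          Real.tendsto_exp_neg_atTop_nhds_zero.comp
            (tendsto_natCast_atTop_atTop.const_mul_atTop hε)
        simpa using this.mul_const B
      rw [Metric.tendsto_nhds]
      intro δ hδ
      obtain ⟨N, hN⟩ := (hE.eventually (gt_mem_nhds (half_pos hδ))).exists
      have hsc : Tendsto (fun s : ℝ => Real.exp (lam * N) * s)
          (nhdsWithin 0 (Set.Ioi 0)) (nhdsWithin 0 (Set.Ioi 0)) := by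
        refine tendsto_nhdsWithin_iff.2 ⟨?_, ?_⟩
        · have : Tendsto (fun s : ℝ => Real.exp (lam * N) * s) (nhds 0) (nhds 0) := by
            have h : Continuous (fun s : ℝ => Real.exp (lam * N) * s) := by fun_prop
            simpa using h.tendsto 0
          exact this.mono_left nhdsWithin_le_nhds
        · filter_upwards [self_mem_nhdsWithin] with s hs
          exact hpos N s hs
      filter_upwards [self_mem_nhdsWithin,
        (hφ_lim.comp hsc).eventually (gt_mem_nhds (half_pos hδ))] with s hs hs2
      have hs : 0 < s := hs
      have hs2 : φ (Real.exp (lam * N) * s) < δ / 2 := hs2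
      have h0 : 0 ≤ ⨆ n, T s n := (hφ_nonneg s hs).trans (hle s hs)
      rw [Real.dist_eq, sub_zero, abs_of_nonneg h0]
      refine lt_of_le_of_lt (ciSup_le fun n => ?_) (half_lt_self hδ)
      rcases le_total n N with h | h
      · refine le_trans ?_ hs2.le
        refine (mul_le_of_le_one_left (hφ_nonneg _ (hpos n s hs)) (hexp1 n)).trans ?_
        refine hφ_mono _ _ (hpos n s hs) ?_
        gcongr
      · refine (hTB s hs n).trans (le_trans ?_ hN.le)
        gcongr
    simpa using h1.add h2
  · intro k s hs
    show (⨆ n, T (Real.exp (lam * k) * s) n) + (Real.exp (lam * k) * s) ^ (ε / lam)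
      ≤ Real.exp (ε * k) * ((⨆ n, T s n) + s ^ (ε / lam))
    rw [mul_add]
    refine add_le_add (ciSup_le fun n => ?_) (le_of_eq ?_)
    · have e : T (Real.exp (lam * k) * s) n = Real.exp (ε * k) * T s (n + k) := by
        simp only [hT]
        rw [← mul_assoc, ← mul_assoc, ← Real.exp_add, ← Real.exp_add]
        push_cast
        congr 2
        · ring
        · congr 2
          ring
      rw [e]
      exact mul_le_mul_of_nonneg_left (le_ciSup (hbdd s hs) (n + k)) (Real.exp_pos _).le
    · rw [Real.mul_rpow (Real.exp_pos _).le hs.le, ← Real.exp_mul]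
      congr 2
      field_simp
end

section
/- Let N ≥ 1 and let (A_n)_{n≥1} and (B_n)_{n≥1} be sequences of real N×N matrices such that ‖A_n − B_n‖ ≤ Δ·aⁿ for all integers n ≥ 1, where Δ ∈ (0,1) and a > 1. Assume there exist linear subspaces E_A, E_B ⊆ ℝ^N and numbers 0 < λ < μ and C > 1 with λ < a such that for every n ≥ 1: ‖A_n v‖ ≤ Cλⁿ‖v‖ for all v ∈ E_A and ‖A_n w‖ ≥ C^{−1}μⁿ‖w‖ for all w in the Euclidean orthogonal complement of E_A; and likewise ‖B_n v‖ ≤ Cλⁿ‖v‖ for all v ∈ E_B and ‖B_n w‖ ≥ C^{−1}μⁿ‖w‖ for all w in the Euclidean orthogonal complement of E_B. Then dist(E_A, E_B) ≤ 3C²·(μ/λ)·Δ^{(log μ − log λ)/(log a − log λ)}. -/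
lemma pesin_numeric (Δ a lam mu : ℝ) (hΔ0 : 0 < Δ) (hΔ1 : Δ < 1) (ha : 1 < a)
    (hlam : 0 < lam) (hlammu : lam < mu) (hla : lam < a) :
    ∃ n : ℕ, Δ * a ^ n ≤ lam ^ n ∧ lam ^ n ≤ mu ^ n * ((mu / lam) *
      Δ ^ ((Real.log mu - Real.log lam) / (Real.log a - Real.log lam))) := by
  have hmu : 0 < mu := hlam.trans hlammu
  have ha0 : 0 < a := by linarith
  have hL : 0 < Real.log mu - Real.log lam := sub_pos.2 (Real.log_lt_log hlam hlammu)
  have hK : 0 < Real.log a - Real.log lam := sub_pos.2 (Real.log_lt_log hlam hla)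
  have hD : Real.log Δ < 0 := Real.log_neg hΔ0 hΔ1
  set L := Real.log mu - Real.log lam with hLd
  set K := Real.log a - Real.log lam with hKd
  have hx : 0 ≤ -Real.log Δ / K := by
    apply div_nonneg <;> linarith
  refine ⟨⌊-Real.log Δ / K⌋₊, ?_, ?_⟩
  · have h1 := Nat.floor_le hx
    set n := ⌊-Real.log Δ / K⌋₊
    rw [le_div_iff₀ hK] at h1
    rw [← Real.log_le_log_iff (by positivity) (by positivity),
      Real.log_mul (by positivity) (by positivity), Real.log_pow, Real.log_pow]
    rw [hKd] at h1
    linarith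
  · have h1 := Nat.lt_floor_add_one (-Real.log Δ / K)
    set n := ⌊-Real.log Δ / K⌋₊
    have hp : 0 < Δ ^ (L / K) := Real.rpow_pos_of_pos hΔ0 _
    rw [← Real.log_le_log_iff (by positivity) (by positivity),
      Real.log_mul (by positivity) (by positivity),
      Real.log_mul (by positivity) (by positivity), Real.log_pow, Real.log_pow,
      Real.log_div (by positivity) (by positivity), Real.log_rpow hΔ0]
    have h2 : L / K * Real.log Δ = - (L * (-Real.log Δ / K)) := by ring
    rw [h2]
    have h3 := mul_le_mul_of_nonneg_left h1.le hL.le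
    have h4 : L * ((n : ℝ) + 1) = n * Real.log mu - n * Real.log lam
      + (Real.log mu - Real.log lam) := by rw [hLd]; ring
    linarith

lemma pesin_half (N : ℕ)
    (A B : ℕ → (EuclideanSpace ℝ (Fin N) →L[ℝ] EuclideanSpace ℝ (Fin N)))
    (Δ a : ℝ)
    (hAB : ∀ n : ℕ, 1 ≤ n → ‖A n - B n‖ ≤ Δ * a ^ n)
    (EA EB : Submodule ℝ (EuclideanSpace ℝ (Fin N)))
    (lam mu C R : ℝ) (hlam : 0 < lam) (hmu : 0 < mu) (hC : 1 < C)
    (hAs : ∀ n : ℕ, 1 ≤ n → ∀ v ∈ EA, ‖A n v‖ ≤ C * lam ^ n * ‖v‖)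
    (hBs : ∀ n : ℕ, 1 ≤ n → ∀ v ∈ EB, ‖B n v‖ ≤ C * lam ^ n * ‖v‖)
    (hBu : ∀ n : ℕ, 1 ≤ n → ∀ w ∈ EBᗮ, C⁻¹ * mu ^ n * ‖w‖ ≤ ‖B n w‖)
    (n : ℕ) (h1 : Δ * a ^ n ≤ lam ^ n) (h2 : lam ^ n ≤ mu ^ n * R) (hR : 0 ≤ R) :
    (⨆ v : {v : EuclideanSpace ℝ (Fin N) // v ∈ EA ∧ ‖v‖ = 1},
      ⨅ w : EB, ‖(v : EuclideanSpace ℝ (Fin N)) - (w : EuclideanSpace ℝ (Fin N))‖)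
      ≤ 3 * C ^ 2 * R := by
  refine Real.iSup_le ?_ (by positivity)
  rintro ⟨v, hv, hv1⟩
  have hbdd : BddBelow (Set.range fun w : EB => ‖v - (w : EuclideanSpace ℝ (Fin N))‖) :=
    ⟨0, by rintro _ ⟨w, rfl⟩; exact norm_nonneg _⟩
  rcases Nat.eq_zero_or_pos n with rfl | hn
  · refine (ciInf_le hbdd 0).trans ?_
    simp only [pow_zero, one_mul] at h2
    simp only [ZeroMemClass.coe_zero, sub_zero, hv1]
    nlinarith
  · set p := EB.orthogonalProjection v with hp
    refine (ciInf_le hbdd p).trans ?_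
    have hw : v - (p : EuclideanSpace ℝ (Fin N)) ∈ EBᗮ := EB.sub_starProjection_mem_orthogonal v
    have hpn : ‖(p : EuclideanSpace ℝ (Fin N))‖ ≤ 1 := by
      rw [← hv1]; exact EB.norm_orthogonalProjection_apply_le v
    have e1 := hBu n hn _ hw
    have e2 := hBs n hn _ p.2
    have e3 := hAs n hn v hv
    have e4 : ‖(A n - B n) v‖ ≤ lam ^ n := by
      have := (A n - B n).le_opNorm v
      rw [hv1, mul_one] at this
      exact this.trans ((hAB n hn).trans h1)
    have e5 : B n (v - p) = A n v - (A n - B n) v - B n p := by simp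
    have e6 : ‖B n (v - p)‖ ≤ ‖A n v‖ + ‖(A n - B n) v‖ + ‖B n p‖ := by
      rw [e5]
      exact (norm_sub_le _ _).trans (by gcongr; exact norm_sub_le _ _)
    rw [hv1, mul_one] at e3
    have hl : 0 < lam ^ n := by positivity
    have hm : 0 < mu ^ n := by positivity
    have e7 : ‖B n p‖ ≤ C * lam ^ n := e2.trans (mul_le_of_le_one_right (by positivity) hpn)
    have e8 : lam ^ n ≤ C * lam ^ n := le_mul_of_one_le_left hl.le hC.le
    have e9 : C⁻¹ * mu ^ n * ‖v - p‖ ≤ 3 * C * (mu ^ n * R) := by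
      have : 3 * C * lam ^ n ≤ 3 * C * (mu ^ n * R) := by gcongr
      linarith
    have e10 : mu ^ n * ‖v - p‖ ≤ mu ^ n * (3 * C ^ 2 * R) := by
      have hC0 : 0 < C := by linarith
      have := mul_le_mul_of_nonneg_left e9 hC0.le
      calc mu ^ n * ‖v - p‖ = C * (C⁻¹ * mu ^ n * ‖v - p‖) := by field_simp
        _ ≤ _ := this
        _ = _ := by ring
    exact le_of_mul_le_mul_left e10 hm


/-- The distance between two linear subspaces of a normed space, with the convention
that a supremum over the empty set equals 0. -/
noncomputable def subDist {E : Type*} [NormedAddCommGroup E] [NormedSpace ℝ E]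
    (A B : Submodule ℝ E) : ℝ :=
  max (⨆ v : {v : E // v ∈ A ∧ ‖v‖ = 1}, ⨅ w : B, ‖(v : E) - (w : E)‖)
      (⨆ v : {v : E // v ∈ B ∧ ‖v‖ = 1}, ⨅ w : A, ‖(v : E) - (w : E)‖)

/-- Pesin's comparison lemma for invariant subspaces of two sequences of
matrices (Lemma 3.10 of Pesin's book, as quoted in the paper). -/
theorem pesin_subspace_comparison (N : ℕ) (hN : 1 ≤ N)
    (A B : ℕ → (EuclideanSpace ℝ (Fin N) →L[ℝ] EuclideanSpace ℝ (Fin N)))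
    (Δ a : ℝ) (hΔ0 : 0 < Δ) (hΔ1 : Δ < 1) (ha : 1 < a)
    (hAB : ∀ n : ℕ, 1 ≤ n → ‖A n - B n‖ ≤ Δ * a ^ n)
    (EA EB : Submodule ℝ (EuclideanSpace ℝ (Fin N)))
    (lam mu C : ℝ) (hlam : 0 < lam) (hlammu : lam < mu) (hC : 1 < C) (hla : lam < a)
    (hAs : ∀ n : ℕ, 1 ≤ n → ∀ v ∈ EA, ‖A n v‖ ≤ C * lam ^ n * ‖v‖)
    (hAu : ∀ n : ℕ, 1 ≤ n → ∀ w ∈ EAᗮ, C⁻¹ * mu ^ n * ‖w‖ ≤ ‖A n w‖)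
    (hBs : ∀ n : ℕ, 1 ≤ n → ∀ v ∈ EB, ‖B n v‖ ≤ C * lam ^ n * ‖v‖)
    (hBu : ∀ n : ℕ, 1 ≤ n → ∀ w ∈ EBᗮ, C⁻¹ * mu ^ n * ‖w‖ ≤ ‖B n w‖) :
    subDist EA EB ≤ 3 * C ^ 2 * (mu / lam) *
      Δ ^ ((Real.log mu - Real.log lam) / (Real.log a - Real.log lam)) := by
  have hmu : 0 < mu := hlam.trans hlammu
  obtain ⟨n, h1, h2⟩ := pesin_numeric Δ a lam mu hΔ0 hΔ1 ha hlam hlammu hla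
  have hR : 0 ≤ (mu / lam) *
      Δ ^ ((Real.log mu - Real.log lam) / (Real.log a - Real.log lam)) :=
    mul_nonneg (by positivity) (Real.rpow_nonneg hΔ0.le _)
  rw [mul_assoc]
  refine max_le ?_ ?_
  · exact pesin_half N A B Δ a hAB EA EB lam mu C _ hlam hmu hC hAs hBs hBu n h1 h2 hR
  · refine pesin_half N B A Δ a (fun k hk => ?_) EB EA lam mu C _ hlam hmu hC hBs hAs hAu n h1 h2 hR
    rw [norm_sub_rev]
    exact hAB k hk
end

section
/- Let d ≥ 1, K ≥ 1, M > 0, λ_max > 0, 0 < ε ≤ λ_max/4, and δ ∈ (0,1) with δ ≤ min{(2MK⁵)^{−2}, (2K²)^{−4}}. For each integer n ≥ 0 let F_n : ℝ^d → ℝ^d be a C¹ map and Λ_n a linear map such that sup_x ‖DF_n(x) − Λ_n‖ ≤ δe^{εn} and ‖DF_n(x) − DF_n(y)‖ ≤ Me^{εn}‖x − y‖ for all x, y ∈ ℝ^d. Let F(m,n,·) denote the orbit maps and DF(m,n,x) the derivative cocycle (defined for m, n ≥ 0), and assume ‖DF(m,n,z)‖ ≤ Ke^{εn}e^{λ_max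 m} for all m, n ≥ 0 and z ∈ ℝ^d. Then for every m ≥ 1: ‖DF(m,0,x) − DF(m,0,y)‖ ≤ e^{(2λ_max+1)m}·δ^{1/4}·‖x − y‖^{1/2} for all x, y with ‖x − y‖ ≤ 1, and ‖DF(m,0,x) − DF(m,0,y)‖ ≤ e^{(2λ_max+1)m}·δ^{3/4} for all x, y ∈ ℝ^d. -/
/-- Hölder continuity of the derivative cocycle DF(m,0,·) of a sequence of
C¹ maps that are δ-close to linear maps and have Lipschitz derivatives, with the stated
explicit bounds. -/
theorem derivative_cocycle_holder
    (d : ℕ) (hd : 1 ≤ d) (K M lamMax ε δ : ℝ)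
    (hK : 1 ≤ K) (hM : 0 < M) (hlam : 0 < lamMax) (hε : 0 < ε) (hεlam : ε ≤ lamMax / 4)
    (hδ0 : 0 < δ) (hδ1 : δ < 1)
    (hδ : δ ≤ min (((2 * M * K ^ 5) ^ 2)⁻¹) (((2 * K ^ 2) ^ 4)⁻¹))
    (F : ℕ → EuclideanSpace ℝ (Fin d) → EuclideanSpace ℝ (Fin d))
    (Λ : ℕ → (EuclideanSpace ℝ (Fin d) →L[ℝ] EuclideanSpace ℝ (Fin d)))
    (hFC1 : ∀ n, ContDiff ℝ 1 (F n))
    (hclose : ∀ n x, ‖fderiv ℝ (F n) x - Λ n‖ ≤ δ * Real.exp (ε * n))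
    (hlip : ∀ n x y, ‖fderiv ℝ (F n) x - fderiv ℝ (F n) y‖ ≤ M * Real.exp (ε * n) * ‖x - y‖)
    (orb : ℕ → ℕ → EuclideanSpace ℝ (Fin d) → EuclideanSpace ℝ (Fin d))
    (horb0 : ∀ n x, orb 0 n x = x)
    (horbS : ∀ m n x, orb (m + 1) n x = F (n + m) (orb m n x))
    (Dc : ℕ → ℕ → EuclideanSpace ℝ (Fin d) →
      (EuclideanSpace ℝ (Fin d) →L[ℝ] EuclideanSpace ℝ (Fin d)))
    (hDc0 : ∀ n x, Dc 0 n x = ContinuousLinearMap.id ℝ (EuclideanSpace ℝ (Fin d)))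
    (hDcS : ∀ m n x, Dc (m + 1) n x = (fderiv ℝ (F (n + m)) (orb m n x)).comp (Dc m n x))
    (hDbd : ∀ m n z, ‖Dc m n z‖ ≤ K * Real.exp (ε * n) * Real.exp (lamMax * m)) :
    ∀ m : ℕ, 1 ≤ m →
      (∀ x y, ‖x - y‖ ≤ 1 →
        ‖Dc m 0 x - Dc m 0 y‖ ≤
          Real.exp ((2 * lamMax + 1) * m) * δ ^ ((1 : ℝ) / 4) * ‖x - y‖ ^ ((1 : ℝ) / 2)) ∧
      (∀ x y : EuclideanSpace ℝ (Fin d),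
        ‖Dc m 0 x - Dc m 0 y‖ ≤ Real.exp ((2 * lamMax + 1) * m) * δ ^ ((3 : ℝ) / 4)) := by
  -- orbit cocycle
  have horbC : ∀ a b x, orb a b (orb b 0 x) = orb (b + a) 0 x := by
    intro a b x
    induction a with
    | zero => rw [horb0]; rfl
    | succ a ih => rw [horbS, ih, ← add_assoc, horbS, zero_add]
  -- telescoping
  have htel : ∀ (x y) (m : ℕ), Dc m 0 x - Dc m 0 y = ∑ k ∈ Finset.range m,
      (Dc (m - 1 - k) (k + 1) (orb (k + 1) 0 x)).comp
        ((fderiv ℝ (F k) (orb k 0 x) - fderiv ℝ (F k) (orb k 0 y)).comp (Dc k 0 y)) := by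
    intro x y m
    induction m with
    | zero => simp [hDc0]
    | succ m ih =>
      rw [Finset.sum_range_succ]
      have h1 : ∑ k ∈ Finset.range m,
          (Dc (m + 1 - 1 - k) (k + 1) (orb (k + 1) 0 x)).comp
          ((fderiv ℝ (F k) (orb k 0 x) - fderiv ℝ (F k) (orb k 0 y)).comp (Dc k 0 y))
          = (fderiv ℝ (F m) (orb m 0 x)).comp (Dc m 0 x - Dc m 0 y) := by
        rw [ih, ContinuousLinearMap.comp_finsetSum]
        refine Finset.sum_congr rfl fun k hk => ?_
        have hk := Finset.mem_range.1 hk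
        have e1 : m + 1 - 1 - k = (m - 1 - k) + 1 := by omega
        have e2 : k + 1 + (m - 1 - k) = m := by omega
        rw [e1, hDcS, horbC, e2, ContinuousLinearMap.comp_assoc]
      rw [h1, hDcS, hDcS]
      have e3 : m + 1 - 1 - m = 0 := by omega
      rw [e3, hDc0, ContinuousLinearMap.id_comp, zero_add, ContinuousLinearMap.comp_sub,
        ContinuousLinearMap.sub_comp]
      abel
  -- derivative of orbit maps
  have hder : ∀ m x, HasFDerivAt (orb m 0) (Dc m 0 x) x := by
    intro m
    induction m with
    | zero =>
      intro x
      rw [hDc0]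
      have : orb 0 0 = id := by funext z; exact horb0 0 z
      rw [this]; exact hasFDerivAt_id x
    | succ m ih =>
      intro x
      have : orb (m + 1) 0 = F (0 + m) ∘ orb m 0 := by funext z; exact horbS m 0 z
      rw [this, hDcS]
      exact (((hFC1 (0 + m)).differentiable (by norm_num)) _).hasFDerivAt.comp x (ih x)
  have horbL : ∀ m x y, ‖orb m 0 x - orb m 0 y‖ ≤ K * Real.exp (lamMax * m) * ‖x - y‖ := by
    intro m x y
    refine Convex.norm_image_sub_le_of_norm_hasFDerivWithin_le
      (f' := fun z => Dc m 0 z) (s := Set.univ)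
      (fun z _ => (hder m z).hasFDerivWithinAt) (fun z _ => ?_) convex_univ
      (Set.mem_univ _) (Set.mem_univ _)
    simpa using hDbd m 0 z
  have hK0 : 0 < K := by linarith
  -- generic bound
  have hgen : ∀ (x y) (C : ℝ), 0 ≤ C → (∀ k : ℕ,
      ‖fderiv ℝ (F k) (orb k 0 x) - fderiv ℝ (F k) (orb k 0 y)‖
        ≤ C * (Real.exp (ε * k) * Real.exp (lamMax * k / 2))) → ∀ m : ℕ,
      ‖Dc m 0 x - Dc m 0 y‖ ≤ Real.exp ((2 * lamMax + 1) * m) * (K ^ 2 * C) := by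
    intro x y C hC hc m
    rw [htel]
    have hterm : ∀ k ∈ Finset.range m, ‖(Dc (m - 1 - k) (k + 1) (orb (k + 1) 0 x)).comp
        ((fderiv ℝ (F k) (orb k 0 x) - fderiv ℝ (F k) (orb k 0 y)).comp (Dc k 0 y))‖
        ≤ K ^ 2 * C * Real.exp (2 * lamMax * m) := by
      intro k hk
      have hk := Finset.mem_range.1 hk
      have b1 := hDbd (m - 1 - k) (k + 1) (orb (k + 1) 0 x)
      have b2 := hc k
      have b3 := hDbd k 0 y
      have hkm : (k : ℝ) + 1 ≤ m := by exact_mod_cast hk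
      have ec : ((m - 1 - k : ℕ) : ℝ) = m - 1 - k := by
        have : m = (m - 1 - k) + 1 + k := by omega
        have h2 : (m : ℝ) = ((m - 1 - k : ℕ) : ℝ) + 1 + k := by exact_mod_cast this
        linarith
      rw [ec] at b1
      push_cast at b1
      simp only [Nat.cast_zero, mul_zero, Real.exp_zero, mul_one] at b3
      calc _ ≤ (K * Real.exp (ε * (k + 1)) * Real.exp (lamMax * (m - 1 - k))) *
            ((C * (Real.exp (ε * k) * Real.exp (lamMax * k / 2))) *
              (K * Real.exp (lamMax * k))) := by
            refine (ContinuousLinearMap.opNorm_comp_le _ _).trans ?_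
            refine mul_le_mul b1 ?_ (norm_nonneg _) (by positivity)
            refine (ContinuousLinearMap.opNorm_comp_le _ _).trans ?_
            exact mul_le_mul b2 b3 (norm_nonneg _) (by positivity)
        _ = K ^ 2 * C * Real.exp (ε * (k + 1) + lamMax * (m - 1 - k) + ε * k
              + lamMax * k / 2 + lamMax * k) := by
            simp only [Real.exp_add]; ring
        _ ≤ _ := by
            refine mul_le_mul_of_nonneg_left (Real.exp_le_exp.2 ?_) (by positivity)
            have hk0 : (0 : ℝ) ≤ k := Nat.cast_nonneg k
            have p1 : 0 ≤ (lamMax / 4 - ε) * (2 * k + 1) :=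
              mul_nonneg (by linarith) (by linarith)
            have p2 : 0 ≤ lamMax * (m - (k + 1)) := mul_nonneg hlam.le (by linarith)
            nlinarith
    refine (norm_sum_le_of_le _ hterm).trans ?_
    rw [Finset.sum_const, Finset.card_range, nsmul_eq_mul]
    have hm : (m : ℝ) ≤ Real.exp m := by linarith [Real.add_one_le_exp (m : ℝ)]
    have e : Real.exp ((2 * lamMax + 1) * m) = Real.exp m * Real.exp (2 * lamMax * m) := by
      rw [← Real.exp_add]; congr 1; ring
    rw [e]
    calc _ ≤ Real.exp m * (K ^ 2 * C * Real.exp (2 * lamMax * m)) :=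
          mul_le_mul_of_nonneg_right hm (by positivity)
      _ = _ := by ring
  have hA : ∀ (k : ℕ) (u v), ‖fderiv ℝ (F k) u - fderiv ℝ (F k) v‖
      ≤ 2 * δ * Real.exp (ε * k) := by
    intro k u v
    have h1 := hclose k u
    have h2 := hclose k v
    have h3 := norm_sub_le (fderiv ℝ (F k) u - Λ k) (fderiv ℝ (F k) v - Λ k)
    rw [sub_sub_sub_cancel_right] at h3
    linarith
  obtain ⟨s, hs⟩ : ∃ s, s = δ ^ ((1 : ℝ) / 4) := ⟨_, rfl⟩
  have hs0 : 0 < s := hs ▸ Real.rpow_pos_of_pos hδ0 _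
  have hs4 : s ^ 4 = δ := by
    rw [hs, ← Real.rpow_natCast, ← Real.rpow_mul hδ0.le]; norm_num
  have hs3 : δ ^ ((3 : ℝ) / 4) = s ^ 3 := by
    rw [hs, ← Real.rpow_natCast, ← Real.rpow_mul hδ0.le]; norm_num
  have hd1 : 2 * K ^ 2 * s ≤ 1 := by
    have h := hδ.trans (min_le_right _ _)
    rw [← hs4, ← inv_pow] at h
    have h' := le_of_pow_le_pow_left₀ (by norm_num) (by positivity) h
    rw [le_inv_comm₀ hs0 (by positivity), ← one_div, le_div_iff₀ hs0] at h'
    exact h'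
  obtain ⟨q, hq⟩ : ∃ q, q = Real.sqrt (2 * M * K) := ⟨_, rfl⟩
  have hq0 : 0 ≤ q := hq ▸ Real.sqrt_nonneg _
  have hq2 : q ^ 2 = 2 * M * K := by rw [hq]; exact Real.sq_sqrt (by positivity)
  have hd2 : K ^ 2 * q * s ≤ 1 := by
    have h := hδ.trans (min_le_left _ _)
    rw [← hs4, ← inv_pow, show s ^ 4 = (s ^ 2) ^ 2 by ring] at h
    have h' := le_of_pow_le_pow_left₀ (by norm_num) (by positivity) h
    rw [le_inv_comm₀ (by positivity) (by positivity), ← one_div, le_div_iff₀ (by positivity)] at h'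
    refine le_of_pow_le_pow_left₀ (n := 2) (by norm_num) (by norm_num) ?_
    calc (K ^ 2 * q * s) ^ 2 = K ^ 4 * q ^ 2 * s ^ 2 := by ring
      _ = 2 * M * K ^ 5 * s ^ 2 := by rw [hq2]; ring
      _ ≤ 1 ^ 2 := by simpa using h'
  intro m _
  refine ⟨fun x y _ => ?_, fun x y => ?_⟩
  · obtain ⟨r, hr⟩ : ∃ r, r = ‖x - y‖ ^ ((1 : ℝ) / 2) := ⟨_, rfl⟩
    have hr0 : 0 ≤ r := hr ▸ Real.rpow_nonneg (norm_nonneg _) _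
    have hr2 : r ^ 2 = ‖x - y‖ := by
      rw [hr, ← Real.rpow_natCast, ← Real.rpow_mul (norm_nonneg _)]; norm_num
    rw [← hs, ← hr]
    refine (hgen x y (q * s ^ 2 * r) (by positivity) (fun k => ?_) m).trans ?_
    · have h1 := hA k (orb k 0 x) (orb k 0 y)
      have h2 : ‖fderiv ℝ (F k) (orb k 0 x) - fderiv ℝ (F k) (orb k 0 y)‖
          ≤ M * Real.exp (ε * k) * (K * Real.exp (lamMax * k) * ‖x - y‖) :=
        (hlip k _ _).trans (mul_le_mul_of_nonneg_left (horbL k x y) (by positivity))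
      refine le_of_pow_le_pow_left₀ (n := 2) (by norm_num) (by positivity) ?_
      rw [pow_two]
      refine (mul_le_mul h1 h2 (norm_nonneg _) (by positivity)).trans (le_of_eq ?_)
      have ee : Real.exp (lamMax * k) = Real.exp (lamMax * k / 2) ^ 2 := by
        rw [← Real.exp_nat_mul]; congr 1; push_cast; ring
      rw [ee, ← hr2, ← hs4]
      linear_combination (-(s ^ 4 * r ^ 2 * Real.exp (ε * k) ^ 2
        * Real.exp (lamMax * k / 2) ^ 2)) * hq2
    · have : K ^ 2 * (q * s ^ 2 * r) ≤ s * r := by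
        calc K ^ 2 * (q * s ^ 2 * r) = (K ^ 2 * q * s) * (s * r) := by ring
          _ ≤ 1 * (s * r) := mul_le_mul_of_nonneg_right hd2 (by positivity)
          _ = s * r := one_mul _
      rw [mul_assoc (Real.exp _) s r]
      exact mul_le_mul_of_nonneg_left this (Real.exp_pos _).le
  · rw [hs3]
    refine (hgen x y (2 * δ) (by positivity) (fun k => ?_) m).trans ?_
    · refine (hA k _ _).trans ?_
      rw [← mul_assoc]
      exact le_mul_of_one_le_right (by positivity) (Real.one_le_exp (by positivity))
    · refine mul_le_mul_of_nonneg_left ?_ (Real.exp_pos _).le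
      calc K ^ 2 * (2 * δ) = (2 * K ^ 2 * s) * s ^ 3 := by rw [← hs4]; ring
        _ ≤ 1 * s ^ 3 := mul_le_mul_of_nonneg_right hd1 (by positivity)
        _ = s ^ 3 := one_mul _
end

section
/- Let d ≥ 1 and equip ℝ^d with the Euclidean inner product and norm. Let X_− be the span of a subset of the standard basis vectors and X_+ the span of the complementary standard basis vectors, with orthogonal projections π_− and π_+. Let ℝ^d = E_+ ⊕ E_− be a splitting into linear subspaces with associated projections Π_+ (onto E_+ along E_−) and Π_− (onto E_− along E_+), and suppose ‖Π_+ − π_+‖ ≤ η and ‖Π_− − π_−‖ ≤ η where 0 ≤ η ≤ 1/(12dK²) for some K ≥ 1. Let μ ≥ ν be real numbers and let (A_m)_{m≥0} be linear maps of ℝ^d such that for every m ≥ 0: ‖A_m ζ‖ ≥ K^{−1}e^{μm}‖ζ‖ for all ζ ∈ E_+, and ‖A_m ζ‖ ≤ Ke^{νm}‖ζ‖ for all ζ ∈ E_−. Then for every ζ in the Euclidean orthogonal complement of E_− and every m ≥ 0: ‖A_m ζ‖ ≥ (2K)^{−1}e^{μm}‖ζ‖. -/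
/-- lower expansion estimate on the Euclidean orthogonal complement of E_−
for a sequence of linear maps expanding on E_+ and contracting on E_−, when the
projections of the splitting ℝ^d = E_+ ⊕ E_− are η-close to the coordinate projections,
with η ≤ 1/(12dK²). -/
theorem expansion_on_orthocomplement
    (d : ℕ) (hd : 1 ≤ d) (K : ℝ) (hK : 1 ≤ K)
    (s : Finset (Fin d))
    (πp πm : EuclideanSpace ℝ (Fin d) →L[ℝ] EuclideanSpace ℝ (Fin d))
    (hπm : ∀ (x : EuclideanSpace ℝ (Fin d)) (i : Fin d), πm x i = if i ∈ s then x i else 0)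
    (hπp : ∀ (x : EuclideanSpace ℝ (Fin d)) (i : Fin d), πp x i = if i ∈ s then 0 else x i)
    (Ep Em : Submodule ℝ (EuclideanSpace ℝ (Fin d))) (hcompl : IsCompl Ep Em)
    (Pp Pm : EuclideanSpace ℝ (Fin d) →L[ℝ] EuclideanSpace ℝ (Fin d))
    (hsum : Pp + Pm = ContinuousLinearMap.id ℝ (EuclideanSpace ℝ (Fin d)))
    (hfixp : ∀ ζ ∈ Ep, Pp ζ = ζ) (hfixm : ∀ ζ ∈ Em, Pm ζ = ζ)
    (η : ℝ) (hη0 : 0 ≤ η) (hηp : ‖Pp - πp‖ ≤ η) (hηm : ‖Pm - πm‖ ≤ η)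
    (hηsmall : η ≤ 1 / (12 * d * K ^ 2))
    (mu nu : ℝ) (hmunu : nu ≤ mu)
    (A : ℕ → (EuclideanSpace ℝ (Fin d) →L[ℝ] EuclideanSpace ℝ (Fin d)))
    (hAexp : ∀ m : ℕ, ∀ ζ ∈ Ep, K⁻¹ * Real.exp (mu * m) * ‖ζ‖ ≤ ‖A m ζ‖)
    (hAcon : ∀ m : ℕ, ∀ ζ ∈ Em, ‖A m ζ‖ ≤ K * Real.exp (nu * m) * ‖ζ‖) :
    ∀ ζ ∈ Emᗮ, ∀ m : ℕ, (2 * K)⁻¹ * Real.exp (mu * m) * ‖ζ‖ ≤ ‖A m ζ‖ := by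
  intro ζ hζ m
  obtain ⟨u, hu, v, hv, huv⟩ := Submodule.mem_sup.1
    (hcompl.sup_eq_top ▸ Submodule.mem_top : ζ ∈ Ep ⊔ Em)
  have hs : ∀ x, Pp x + Pm x = x := fun x => by
    have := DFunLike.congr_fun hsum x
    simpa using this
  have hPv : Pp v = 0 := by
    have := hs v
    rw [hfixm v hv] at this
    simpa using this
  have hPζ : Pp ζ = u := by
    rw [← huv, map_add, hPv, hfixp u hu, add_zero]
  have horth : inner ℝ v ζ = (0 : ℝ) := Submodule.inner_right_of_mem_orthogonal hv hζ
  have hsymm : inner ℝ v (πp ζ) = (inner ℝ (πp v) ζ : ℝ) := by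
    simp only [PiLp.inner_apply, hπp]
    refine Finset.sum_congr rfl fun i _ => ?_
    split_ifs <;> simp
  have hn : ∀ x, ‖(Pp - πp) x‖ ≤ η * ‖x‖ := fun x =>
    (ContinuousLinearMap.le_opNorm _ x).trans
      (mul_le_mul_of_nonneg_right hηp (norm_nonneg x))
  have hvu : v = ζ - u := by rw [← huv]; abel
  have hkey : ‖v‖ ^ 2 = -(inner ℝ v ((Pp - πp) ζ) : ℝ) + inner ℝ ((Pp - πp) v) ζ := by
    have h1 : ‖v‖ ^ 2 = (inner ℝ v (ζ - u) : ℝ) := by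
      rw [← hvu, real_inner_self_eq_norm_sq]
    rw [h1, inner_sub_right, horth]
    simp only [ContinuousLinearMap.sub_apply, hPv, hPζ, inner_sub_right, inner_sub_left,
      hsymm, inner_zero_left]
    ring
  have hb1 : |(inner ℝ v ((Pp - πp) ζ) : ℝ)| ≤ ‖v‖ * (η * ‖ζ‖) :=
    (abs_real_inner_le_norm _ _).trans (mul_le_mul_of_nonneg_left (hn ζ) (norm_nonneg v))
  have hb2 : |(inner ℝ ((Pp - πp) v) ζ : ℝ)| ≤ (η * ‖v‖) * ‖ζ‖ :=
    (abs_real_inner_le_norm _ _).trans (mul_le_mul_of_nonneg_right (hn v) (norm_nonneg ζ))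
  have hvle : ‖v‖ ≤ 2 * η * ‖ζ‖ := by
    rcases (norm_nonneg v).eq_or_lt with h0 | h0
    · rw [← h0]; positivity
    · have := (abs_le.1 hb1).1
      have := (abs_le.1 hb2).2
      refine le_of_mul_le_mul_left ?_ h0
      nlinarith
  have hule : ‖ζ‖ ≤ ‖u‖ := by
    have h1 : u = ζ - v := by rw [← huv]; abel
    have h2 : ‖u‖ ^ 2 = ‖ζ‖ ^ 2 + ‖v‖ ^ 2 := by
      rw [h1, norm_sub_sq_real, real_inner_comm, horth]; ring
    refine le_of_sq_le_sq ?_ (norm_nonneg u)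
    nlinarith [sq_nonneg ‖v‖]
  have hK0 : 0 < K := by linarith
  have hηK : 2 * K * η ≤ (2 * K)⁻¹ := by
    have hd' : (1 : ℝ) ≤ d := by exact_mod_cast hd
    have h4 : η ≤ 1 / (4 * K ^ 2) := by
      refine hηsmall.trans (one_div_le_one_div_of_le (by positivity) ?_)
      nlinarith [sq_nonneg K]
    calc 2 * K * η ≤ 2 * K * (1 / (4 * K ^ 2)) := by gcongr
      _ = (2 * K)⁻¹ := by field_simp; norm_num
  have hexp : Real.exp (nu * m) ≤ Real.exp (mu * m) := by gcongr
  have hAu : K⁻¹ * Real.exp (mu * m) * ‖ζ‖ ≤ ‖A m u‖ :=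
    le_trans (by gcongr) (hAexp m u hu)
  have hAv : ‖A m v‖ ≤ (2 * K)⁻¹ * Real.exp (mu * m) * ‖ζ‖ := by
    calc ‖A m v‖ ≤ K * Real.exp (nu * m) * ‖v‖ := hAcon m v hv
      _ ≤ K * Real.exp (mu * m) * (2 * η * ‖ζ‖) := by gcongr
      _ = (2 * K * η) * Real.exp (mu * m) * ‖ζ‖ := by ring
      _ ≤ _ := by gcongr
  have hA : ‖A m u‖ - ‖A m v‖ ≤ ‖A m ζ‖ := by
    rw [← huv, map_add, sub_le_iff_le_add]
    simpa using norm_sub_le (A m u + A m v) (A m v)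
  have hsplit : K⁻¹ * Real.exp (mu * m) * ‖ζ‖ = 2 * ((2 * K)⁻¹ * Real.exp (mu * m) * ‖ζ‖) := by
    rw [mul_inv]; ring
  linarith
end

section
/- Let d ≥ 1 and equip ℝ^d with the Euclidean inner product and norm. Let X_− ⊆ ℝ^d be the span of a subset of the standard basis vectors and π_− the orthogonal projection onto X_−. Let Π : ℝ^d → ℝ^d be a linear projection (Π∘Π = Π) with range E, and suppose ‖Π − π_−‖ ≤ η in operator norm, where η < 1/2. Then dim E = dim X_−, and every vector ζ in the Euclidean orthogonal complement of E satisfies ‖π_− ζ‖ ≤ 2·√d·η·‖ζ‖. -/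
theorem aux_finrank_le {E : Type*} [NormedAddCommGroup E] [InnerProductSpace ℝ E]
    [FiniteDimensional ℝ E] (A B : E →L[ℝ] E) (hA : ∀ x, A (A x) = A x)
    (h : ‖A - B‖ < 1) :
    Module.finrank ℝ (LinearMap.range (A : E →ₗ[ℝ] E)) ≤
      Module.finrank ℝ (LinearMap.range (B : E →ₗ[ℝ] E)) := by
  let f : LinearMap.range (A : E →ₗ[ℝ] E) →ₗ[ℝ] LinearMap.range (B : E →ₗ[ℝ] E) :=
    (B : E →ₗ[ℝ] E).rangeRestrict.comp (Submodule.subtype _)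
  apply LinearMap.finrank_le_finrank_of_injective (f := f)
  rw [injective_iff_map_eq_zero]
  rintro ⟨_, y, rfl⟩ hx
  have hB : B (A y) = 0 := congrArg Subtype.val hx
  have h1 := (A - B).le_opNorm (A y)
  rw [ContinuousLinearMap.sub_apply, hA, hB, sub_zero] at h1
  have h2 : ‖A y‖ = 0 := by
    have := norm_nonneg (A y)
    nlinarith
  ext
  simpa using h2

/-- if a linear projection Pj on Euclidean ℝ^d is η-close (η < 1/2) to the
orthogonal coordinate projection π_− onto the span X_− of a subset of the standard basis,
then its range has the same dimension as X_−, and every vector orthogonal to the range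
satisfies ‖π_−ζ‖ ≤ 2√d·η·‖ζ‖. -/
theorem projection_near_coordinate_projection
    (d : ℕ) (hd : 1 ≤ d) (s : Finset (Fin d))
    (πm : EuclideanSpace ℝ (Fin d) →L[ℝ] EuclideanSpace ℝ (Fin d))
    (hπm : ∀ (x : EuclideanSpace ℝ (Fin d)) (i : Fin d), πm x i = if i ∈ s then x i else 0)
    (Pj : EuclideanSpace ℝ (Fin d) →L[ℝ] EuclideanSpace ℝ (Fin d))
    (hidem : ∀ x, Pj (Pj x) = Pj x)
    (η : ℝ) (hη : ‖Pj - πm‖ ≤ η) (hη2 : η < 1 / 2) :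
    Module.finrank ℝ
        (LinearMap.range (Pj : EuclideanSpace ℝ (Fin d) →ₗ[ℝ] EuclideanSpace ℝ (Fin d))) = s.card ∧
    ∀ ζ ∈ (LinearMap.range (Pj : EuclideanSpace ℝ (Fin d) →ₗ[ℝ] EuclideanSpace ℝ (Fin d)))ᗮ,
      ‖πm ζ‖ ≤ 2 * Real.sqrt d * η * ‖ζ‖ := by
  have hπ2 : ∀ x, πm (πm x) = πm x := by
    intro x
    ext i
    simp only [hπm]
    split_ifs <;> rfl
  refine ⟨?_, ?_⟩
  · have h1 : ‖Pj - πm‖ < 1 := by linarith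
    have h2 : ‖πm - Pj‖ < 1 := by rwa [norm_sub_rev]
    rw [le_antisymm (aux_finrank_le Pj πm hidem h1) (aux_finrank_le πm Pj hπ2 h2)]
    let r : EuclideanSpace ℝ (Fin d) →ₗ[ℝ] (s → ℝ) :=
      { toFun := fun x i => x i
        map_add' := fun x y => by ext i; simp
        map_smul' := fun c x => by ext i; simp }
    have hr : LinearMap.range r = ⊤ := by
      rw [LinearMap.range_eq_top]
      intro g
      refine ⟨WithLp.toLp 2 (fun i => if h : i ∈ s then g ⟨i, h⟩ else 0), ?_⟩
      ext i
      simp [r]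
    have hk : LinearMap.ker r =
        LinearMap.ker (πm : EuclideanSpace ℝ (Fin d) →ₗ[ℝ] EuclideanSpace ℝ (Fin d)) := by
      ext x
      rw [LinearMap.mem_ker, LinearMap.mem_ker]
      constructor
      · intro h
        ext i
        change πm x i = 0
        rw [hπm]
        split_ifs with hi
        · exact congrFun h ⟨i, hi⟩
        · rfl
      · intro h
        ext i
        have h3 : πm x i = 0 := by
          have h4 : πm x = 0 := h
          rw [h4]; rfl
        rw [hπm, if_pos i.2] at h3
        exact h3
    have e1 := LinearMap.finrank_range_add_finrank_ker r
    have e2 := LinearMap.finrank_range_add_finrank_ker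
      (πm : EuclideanSpace ℝ (Fin d) →ₗ[ℝ] EuclideanSpace ℝ (Fin d))
    rw [hk, hr, finrank_top, Module.finrank_fintype_fun_eq_card, Fintype.card_coe] at e1
    omega
  · intro ζ hζ
    have h0 : inner ℝ (Pj (πm ζ)) ζ = 0 :=
      (Submodule.mem_orthogonal _ _).1 hζ _ ⟨πm ζ, rfl⟩
    have h1 : inner ℝ (πm ζ) ζ = ‖πm ζ‖ ^ 2 := by
      rw [← real_inner_self_eq_norm_sq, PiLp.inner_apply, PiLp.inner_apply]
      refine Finset.sum_congr rfl fun i _ => ?_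
      simp only [hπm]
      split_ifs <;> simp
    have h2 : inner ℝ ((Pj - πm) (πm ζ)) ζ = - ‖πm ζ‖ ^ 2 := by
      rw [ContinuousLinearMap.sub_apply, inner_sub_left, h0, hπ2, h1, zero_sub]
    have h3 := abs_real_inner_le_norm ((Pj - πm) (πm ζ)) ζ
    rw [h2, abs_neg, abs_of_nonneg (sq_nonneg _)] at h3
    have h4 : ‖(Pj - πm) (πm ζ)‖ ≤ η * ‖πm ζ‖ := (Pj - πm).le_of_opNorm_le hη _
    have hη0 : 0 ≤ η := (norm_nonneg _).trans hη
    have h5 : ‖πm ζ‖ ≤ η * ‖ζ‖ := by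
      rcases (norm_nonneg (πm ζ)).eq_or_lt with h | h
      · rw [← h]; positivity
      · have h6 := mul_le_mul_of_nonneg_right h4 (norm_nonneg ζ)
        have h7 : ‖πm ζ‖ * ‖πm ζ‖ ≤ ‖πm ζ‖ * (η * ‖ζ‖) := by nlinarith
        exact le_of_mul_le_mul_left h7 h
    have h8 : (1 : ℝ) ≤ Real.sqrt d := by
      rw [Real.one_le_sqrt]
      exact_mod_cast hd
    have h9 : 0 ≤ η * ‖ζ‖ := by positivity
    nlinarith
end
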